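/- Let F be a field of characteristic 2 and let A be a central simple F-algebra with exp A = 2. Let n ≥ 3 be an integer and assume that A splits over a 2-extension of F of degree 2^n. Then λ_2(A) ≤ 5·2^{n−3} − 1. -/

import Mathlib

open scoped TensorProduct

/-- A finite-dimensional central simple algebra over a field `F`. -/
def IsCSA (F A : Type) [Field F] [Ring A] [Algebra F A] : Prop :=
  Algebra.IsCentral F A ∧ IsSimpleRing A ∧ FiniteDimensional F A

/-- An `F`-algebra is split if it is isomorphic to a matrix algebra over `F`. -/
def IsSplitAlg (F A : Type) [Field F] [Ring A] [Algebra F A] : Prop :=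
  ∃ n : ℕ, 0 < n ∧ Nonempty (A ≃ₐ[F] Matrix (Fin n) (Fin n) F)

/-- Brauer equivalence of two algebras over a field `F`. -/
def IsBrauerEquiv (F A B : Type) [Field F] [Ring A] [Algebra F A] [Ring B] [Algebra F B] :
    Prop :=
  ∃ n m : ℕ, 0 < n ∧ 0 < m ∧
    Nonempty ((Matrix (Fin n) (Fin n) A) ≃ₐ[F] (Matrix (Fin m) (Fin m) B))

/-- `A` has exponent `e`: `e` is the least positive integer such that the `e`-fold tensor
power of `A` over `F` is split. -/
def HasExponent (F A : Type) [Field F] [Ring A] [Algebra F A] (e : ℕ) : Prop :=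
  0 < e ∧ IsSplitAlg F (⨂[F] _ : Fin e, A) ∧
    ∀ k : ℕ, 0 < k → IsSplitAlg F (⨂[F] _ : Fin k, A) → e ≤ k

/-- `A` has (Schur) index `d`: `A` is isomorphic to a matrix algebra over a division
algebra of dimension `d ^ 2` over `F`. -/
def HasIndex (F A : Type) [Field F] [Ring A] [Algebra F A] (d : ℕ) : Prop :=
  ∃ (D : Type) (_ : DivisionRing D) (_ : Algebra F D) (m : ℕ), 0 < m ∧
    Nonempty (A ≃ₐ[F] Matrix (Fin m) (Fin m) D) ∧ Module.finrank F D = d ^ 2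

/-- The (Schur) index of `A` is at most `d`. -/
def IndexLE (F A : Type) [Field F] [Ring A] [Algebra F A] (d : ℕ) : Prop :=
  ∃ e : ℕ, e ≤ d ∧ HasIndex F A e

/-- `A` is the cyclic (symbol) algebra `[a, b)_{p,F}` of degree `p` in characteristic `p`:
it has dimension `p ^ 2` over `F` and is generated by elements `i`, `j` subject to
`i ^ p - i = a`, `j ^ p = b`, `j * i = (i - 1) * j`. -/
def IsCyclicAlgWith (p : ℕ) (F A : Type) [Field F] [Ring A] [Algebra F A] (a b : F) : Prop :=
  b ≠ 0 ∧ Module.finrank F A = p ^ 2 ∧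
    ∃ i j : A, i ^ p - i = algebraMap F A a ∧ j ^ p = algebraMap F A b ∧
      j * i = (i - 1) * j ∧ Algebra.adjoin F {i, j} = ⊤

/-- `A` is a cyclic algebra of degree `p`, i.e. of the form `[a, b)_{p,F}`. -/
def IsCyclicPAlg (p : ℕ) (F A : Type) [Field F] [Ring A] [Algebra F A] : Prop :=
  ∃ a b : F, IsCyclicAlgWith p F A a b

/-- The `p`-symbol length of `A` is at most `m`: `A` is Brauer equivalent to a tensor
product of at most `m` cyclic `F`-algebras of degree `p`. -/
def SymbolLengthLE (p : ℕ) (F A : Type) [Field F] [Ring A] [Algebra F A] (m : ℕ) : Prop :=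
  ∃ k : ℕ, k ≤ m ∧ ∃ (D : Fin k → Type) (_ : ∀ i, Ring (D i)) (_ : ∀ i, Algebra F (D i)),
    (∀ i, IsCyclicPAlg p F (D i)) ∧ IsBrauerEquiv F A (⨂[F] i, D i)

/-- `M` is a compositum `LK` of `L` and `K` over `F`: it is generated as an `F`-algebra by
the images of `L` and `K`. -/
def IsCompositum (F L K M : Type) [Field F] [Field L] [Field K] [Field M]
    [Algebra F L] [Algebra F K] [Algebra F M] [Algebra L M] [Algebra K M]
    [IsScalarTower F L M] [IsScalarTower F K M] : Prop :=
  (IsScalarTower.toAlgHom F L M).range ⊔ (IsScalarTower.toAlgHom F K M).range = ⊤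

/-- A cyclic algebra of degree `m` over `F`: a central simple `F`-algebra of degree `m`
containing a cyclic field extension of `F` of degree `m` (as a maximal subfield). -/
def IsCyclicAlgebra (F A : Type) [Field F] [Ring A] [Algebra F A] (m : ℕ) : Prop :=
  IsCSA F A ∧ Module.finrank F A = m ^ 2 ∧
  ∃ (L : Type) (_ : Field L) (_ : Algebra F L), IsGalois F L ∧ IsCyclic (L ≃ₐ[F] L) ∧
    Module.finrank F L = m ∧ Nonempty (L →ₐ[F] A)

/-- `L/F` is a `p`-extension: there is a tower of intermediate fields from `F` to `L`
each step of which is a cyclic extension of degree `p`. -/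
def IsPExtension (p : ℕ) (F L : Type) [Field F] [Field L] [Algebra F L] : Prop :=
  ∃ (n : ℕ) (T : Fin (n + 1) → IntermediateField F L),
    T 0 = ⊥ ∧ T (Fin.last n) = ⊤ ∧
    ∀ i : Fin n, ∃ h : T i.castSucc ≤ T i.succ,
      IsGalois (T i.castSucc) (IntermediateField.extendScalars h) ∧
      IsCyclic ((IntermediateField.extendScalars h) ≃ₐ[T i.castSucc]
        (IntermediateField.extendScalars h)) ∧
      Module.finrank (T i.castSucc) (IntermediateField.extendScalars h) = p

/-- `F` is `p`-cyclic reducible: for every central simple `F`-algebra `A` of exponent `p`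
and every purely inseparable extension `K/F` with `K ^ p ⊆ F`, either `A_K` is split, or
there is a separable extension `L/F` of degree `ind (A_K) / p` such that `A_{LK}` is
Brauer equivalent to a cyclic `LK`-algebra of degree `p`. -/
def IsPCyclicReducible (p : ℕ) (F : Type) [Field F] : Prop :=
  ∀ (A : Type) [Ring A] [Algebra F A], IsCSA F A → HasExponent F A p →
  ∀ (K : Type) [Field K] [Algebra F K], IsPurelyInseparable F K →
    (∀ z : K, z ^ p ∈ (algebraMap F K).range) →
    IsSplitAlg K (K ⊗[F] A) ∨
    ∃ d : ℕ, HasIndex K (K ⊗[F] A) (p * d) ∧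
      ∃ (L : Type) (_ : Field L) (_ : Algebra F L), Algebra.IsSeparable F L ∧
        Module.finrank F L = d ∧
        ∃ (M : Type) (_ : Field M) (_ : Algebra F M) (_ : Algebra L M) (_ : Algebra K M)
          (_ : IsScalarTower F L M) (_ : IsScalarTower F K M),
          IsCompositum F L K M ∧
          ∃ (C : Type) (_ : Ring C) (_ : Algebra M C),
            IsCyclicPAlg p M C ∧ IsBrauerEquiv M (M ⊗[F] A) C

/-- `F` is `p`-reducible: for every central simple `F`-algebra `A` of exponent `p`
and every purely inseparable extension `K/F` with `K ^ p ⊆ F`, either `A_K` is split, or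
there is a separable extension `L/F` of degree `ind (A_K) / p` with `ind A_{LK} = p`. -/
def IsPReducible (p : ℕ) (F : Type) [Field F] : Prop :=
  ∀ (A : Type) [Ring A] [Algebra F A], IsCSA F A → HasExponent F A p →
  ∀ (K : Type) [Field K] [Algebra F K], IsPurelyInseparable F K →
    (∀ z : K, z ^ p ∈ (algebraMap F K).range) →
    IsSplitAlg K (K ⊗[F] A) ∨
    ∃ d : ℕ, HasIndex K (K ⊗[F] A) (p * d) ∧
      ∃ (L : Type) (_ : Field L) (_ : Algebra F L), Algebra.IsSeparable F L ∧
        Module.finrank F L = d ∧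
        ∃ (M : Type) (_ : Field M) (_ : Algebra F M) (_ : Algebra L M) (_ : Algebra K M)
          (_ : IsScalarTower F L M) (_ : IsScalarTower F K M),
          IsCompositum F L K M ∧ HasIndex M (M ⊗[F] A) p

namespace CharTwoBrauer

/-- Burnside's theorem: an irreducible representation with only scalar endomorphisms is onto. -/
theorem surjective_of_irreducible {F R V : Type*} [Field F] [Ring R] [Algebra F R]
    [AddCommGroup V] [Module F V] [FiniteDimensional F V] [Nontrivial V]
    (ρ : R →ₐ[F] Module.End F V)
    (hs : ∀ W : Submodule F V, (∀ r, ∀ w ∈ W, ρ r w ∈ W) → W = ⊥ ∨ W = ⊤)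
    (hc : ∀ f : Module.End F V, (∀ r v, f (ρ r v) = ρ r (f v)) → ∃ c : F, ∀ v, f v = c • v) :
    Function.Surjective ρ := by
  classical
  let _ : Module R V := Module.compHom V ρ.toRingHom
  have hsm : ∀ (r : R) (v : V), r • v = ρ r v := fun _ _ => rfl
  have hF : ∀ (c : F) (v : V), (algebraMap F R c) • v = c • v := by
    intro c v; rw [hsm]; simp
  have : IsSimpleModule R V := by
    have : IsSimpleOrder (Submodule R V) :=
      { exists_pair_ne := ⟨⊥, ⊤, bot_ne_top⟩
        eq_bot_or_eq_top := by
          intro W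
          let W' : Submodule F V :=
            { carrier := W
              add_mem' := W.add_mem
              zero_mem' := W.zero_mem
              smul_mem' := fun c x hx => by
                rw [← hF]; exact W.smul_mem _ hx }
          rcases hs W' (fun r w hw => W.smul_mem r hw) with h | h
          · left
            ext x
            exact (SetLike.ext_iff.mp h x)
          · right
            ext x
            exact (SetLike.ext_iff.mp h x) }
    exact ⟨⟩
  intro f
  let f' : Module.End (Module.End R V) V :=
    { toFun := f
      map_add' := f.map_add
      map_smul' := by
        intro g v
        let g' : Module.End F V :=
          { toFun := g
            map_add' := g.map_add
            map_smul' := fun c x => by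
              rw [← hF, g.map_smul, hF]; rfl }
        obtain ⟨c, hcv⟩ := hc g' (fun r v => g.map_smul r v)
        have h1 : ∀ v, g v = c • v := hcv
        change f (g v) = g (f v)
        rw [h1, h1, f.map_smul] }
  let B := Module.finBasis F V
  obtain ⟨r, hr⟩ := jacobson_density f' (Finset.univ.image B)
  refine ⟨r, B.ext fun i => ?_⟩
  exact (hr (B i) (by simp)).symm

section Azumaya
variable (F A : Type*) [Field F] [Ring A] [Algebra F A] [Algebra.IsCentral F A] [IsSimpleRing A]
  [FiniteDimensional F A]

theorem mulLeftRight_surjective : Function.Surjective (AlgHom.mulLeftRight F A) := by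
  refine surjective_of_irreducible _ ?_ ?_
  · intro W hW
    by_cases h : W = ⊥
    · exact Or.inl h
    right
    obtain ⟨x, hx, hx0⟩ := W.exists_mem_ne_zero_of_ne_bot h
    have hm : ∀ a b : A, ∀ w ∈ W, a * w * b ∈ W := by
      intro a b w hw
      simpa using hW (a ⊗ₜ MulOpposite.op b) w hw
    let I : TwoSidedIdeal A := TwoSidedIdeal.mk' (W : Set A) W.zero_mem (fun h h' => W.add_mem h h')
      (fun h => W.neg_mem h) (fun {x y} h => by simpa using hm x 1 y h)
      (fun {x y} h => by simpa using hm 1 y x h)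
    have h1 : (1 : A) ∈ I := IsSimpleRing.one_mem_of_ne_zero_mem I hx0
      ((TwoSidedIdeal.mem_mk' _ _ _ _ _ _ x).2 hx)
    have h1' : (1 : A) ∈ W := (TwoSidedIdeal.mem_mk' _ _ _ _ _ _ _).1 h1
    rw [eq_top_iff]
    intro y _
    simpa using hm y 1 1 h1'
  · intro f hf
    have h1 : ∀ a b x : A, f (a * x * b) = a * f x * b := by
      intro a b x
      simpa using hf (a ⊗ₜ MulOpposite.op b) x
    have h2 : f 1 ∈ Subalgebra.center F A := by
      rw [Subalgebra.mem_center_iff]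
      intro b
      have := h1 b 1 1
      have h' := h1 1 b 1
      simp only [mul_one, one_mul] at this h'
      rw [← this, h']
    obtain ⟨c, hc⟩ := Algebra.IsCentral.mem_center_iff F |>.1 h2
    refine ⟨c, fun v => ?_⟩
    have := h1 v 1 1
    simp only [mul_one] at this
    rw [this, hc, Algebra.smul_def, Algebra.commutes]

theorem mulLeftRight_bijective : Function.Bijective (AlgHom.mulLeftRight F A) := by
  have h : Module.finrank F (A ⊗[F] Aᵐᵒᵖ) = Module.finrank F (Module.End F A) := by
    rw [Module.finrank_tensorProduct, Module.finrank_linearMap,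
      (MulOpposite.opLinearEquiv F (M := A)).finrank_eq]
  exact ⟨(LinearMap.injective_iff_surjective_of_finrank_eq_finrank
    (f := (AlgHom.mulLeftRight F A).toLinearMap) h).2 (mulLeftRight_surjective F A),
    mulLeftRight_surjective F A⟩
end Azumaya

section Tensor
variable (F A B : Type*) [Field F] [Ring A] [Algebra F A] [Algebra.IsCentral F A] [IsSimpleRing A]
  [FiniteDimensional F A] [Ring B] [Algebra F B]

/-- Every endomorphism of `A` extends to a map of `A ⊗ B` preserving two-sided ideals. -/
theorem rTensor_mem_twoSidedIdeal (I : TwoSidedIdeal (A ⊗[F] B)) (f : Module.End F A)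
    {x : A ⊗[F] B} (hx : x ∈ I) : f.rTensor B x ∈ I := by
  obtain ⟨t, rfl⟩ := mulLeftRight_surjective F A f
  induction t using TensorProduct.induction_on with
  | zero => simp [I.zero_mem]
  | add s t hs ht =>
    rw [map_add, LinearMap.rTensor_add]; exact I.add_mem hs ht
  | tmul a b =>
    have : (AlgHom.mulLeftRight F A (a ⊗ₜ b)).rTensor B =
        LinearMap.mulLeftRight F ((a ⊗ₜ (1 : B) : A ⊗[F] B), (b.unop ⊗ₜ (1 : B) : A ⊗[F] B)) := by
      ext c d
      simp
    rw [this, LinearMap.mulLeftRight_apply]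
    exact I.mul_mem_right _ _ (I.mul_mem_left _ _ hx)

variable [IsSimpleRing B]

instance isSimpleRing_tensor : IsSimpleRing (A ⊗[F] B) := by
  have : Nontrivial (A ⊗[F] B) := inferInstance
  refine IsSimpleRing.of_eq_bot_or_eq_top fun I => ?_
  by_cases hI : I = ⊥
  · exact Or.inl hI
  right
  obtain ⟨x, hx, hx0⟩ : ∃ x ∈ I, x ≠ 0 := by
    by_contra! h
    exact hI (eq_bot_iff.2 fun x hx => (TwoSidedIdeal.mem_bot _).2 (h x hx))
  let ℬ := Module.finBasis F A
  obtain ⟨i, hi⟩ : ∃ i, TensorProduct.equivFinsuppOfBasisLeft ℬ x i ≠ 0 := by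
    by_contra! h
    exact hx0 ((TensorProduct.equivFinsuppOfBasisLeft ℬ).map_eq_zero_iff.1 (Finsupp.ext h))
  have key : ∀ y : A ⊗[F] B, ((Algebra.linearMap F A ∘ₗ ℬ.coord i).rTensor B) y =
      1 ⊗ₜ TensorProduct.equivFinsuppOfBasisLeft ℬ y i := by
    intro y
    rw [TensorProduct.equivFinsuppOfBasisLeft_apply]
    induction y using TensorProduct.induction_on with
    | zero => simp
    | add s t hs ht => rw [map_add, hs, ht, map_add, map_add, TensorProduct.tmul_add]
    | tmul c d => simp [Algebra.algebraMap_eq_smul_one, TensorProduct.smul_tmul]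
  have h1 := rTensor_mem_twoSidedIdeal F A B I (Algebra.linearMap F A ∘ₗ ℬ.coord i) hx
  rw [key] at h1
  let J : TwoSidedIdeal B := I.comap (Algebra.TensorProduct.includeRight : B →ₐ[F] A ⊗[F] B)
  have hJ : (1 : B) ∈ J := IsSimpleRing.one_mem_of_ne_zero_mem J hi (by
    simpa [J, TwoSidedIdeal.mem_comap] using h1)
  have h2 : (1 : A ⊗[F] B) ∈ I := by
    simpa [J, TwoSidedIdeal.mem_comap, ← Algebra.TensorProduct.one_def] using hJ
  exact (TwoSidedIdeal.one_mem_iff _).1 h2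

end Tensor

instance isCentral_baseChange (F A K : Type*) [Field F] [Ring A] [Algebra F A] [Field K]
    [Algebra F K] [Algebra.IsCentral F A] :
    Algebra.IsCentral K (K ⊗[F] A) where
  out := by
    intro z hz
    have h1 : z ∈ Subalgebra.centralizer F
        (Algebra.TensorProduct.includeRight '' (Set.univ : Set A) : Set (K ⊗[F] A)) := by
      rw [Subalgebra.mem_centralizer_iff]
      rintro _ ⟨a, -, rfl⟩
      exact Subalgebra.mem_center_iff.1 hz _
    rw [Subalgebra.centralizer_coe_image_includeRight_eq_center_tensorProduct] at h1
    obtain ⟨w, rfl⟩ := h1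
    clear hz
    induction w using TensorProduct.induction_on with
    | zero => simp
    | add s t hs ht => rw [map_add]; exact add_mem hs ht
    | tmul c d =>
      obtain ⟨d, hd⟩ := d
      rw [Subalgebra.centralizer_univ] at hd
      obtain ⟨r, rfl⟩ := Algebra.IsCentral.mem_center_iff F |>.1 hd
      refine Algebra.mem_bot.2 ⟨r • c, ?_⟩
      change (r • c) ⊗ₜ[F] (1 : A) = c ⊗ₜ[F] (algebraMap F A r)
      rw [Algebra.algebraMap_eq_smul_one, TensorProduct.tmul_smul, TensorProduct.smul_tmul']

instance isCentral_tensor (F A B : Type*) [Field F] [Ring A] [Algebra F A] [Ring B]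
    [Algebra F B] [Algebra.IsCentral F A] [Algebra.IsCentral F B] : Algebra.IsCentral F (A ⊗[F] B) where
  out := by
    intro z hz
    have h1 : z ∈ Subalgebra.centralizer F
        (Algebra.TensorProduct.includeRight '' (Set.univ : Set B) : Set (A ⊗[F] B)) := by
      rw [Subalgebra.mem_centralizer_iff]
      rintro _ ⟨a, -, rfl⟩
      exact Subalgebra.mem_center_iff.1 hz _
    rw [Subalgebra.centralizer_coe_image_includeRight_eq_center_tensorProduct] at h1
    obtain ⟨w, hw⟩ := h1
    have h2 : ∃ a : A, z = a ⊗ₜ 1 := by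
      rw [← hw]
      clear hw hz
      induction w using TensorProduct.induction_on with
      | zero => exact ⟨0, by simp⟩
      | add s t hs ht =>
        obtain ⟨a, ha⟩ := hs
        obtain ⟨b, hb⟩ := ht
        exact ⟨a + b, by rw [map_add, TensorProduct.add_tmul]; exact congrArg₂ _ ha hb⟩
      | tmul c d =>
        obtain ⟨d, hd⟩ := d
        rw [Subalgebra.centralizer_univ] at hd
        obtain ⟨r, rfl⟩ := Algebra.IsCentral.mem_center_iff F |>.1 hd
        refine ⟨r • c, ?_⟩
        simp [Algebra.algebraMap_eq_smul_one, TensorProduct.smul_tmul]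
    obtain ⟨a, rfl⟩ := h2
    by_cases hB : Nontrivial B
    · have h3 : a ∈ Subalgebra.center F A := by
        rw [Subalgebra.mem_center_iff]
        intro b
        have := Subalgebra.mem_center_iff.1 hz (b ⊗ₜ 1)
        simp only [Algebra.TensorProduct.tmul_mul_tmul, mul_one] at this
        exact Algebra.TensorProduct.includeLeft_injective (S := F) (R := F)
          (FaithfulSMul.algebraMap_injective F B) this
      obtain ⟨r, rfl⟩ := Algebra.IsCentral.mem_center_iff F |>.1 h3
      exact Algebra.mem_bot.2 ⟨r, by simp [Algebra.TensorProduct.algebraMap_apply]⟩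
    · rw [not_nontrivial_iff_subsingleton] at hB
      rw [Subsingleton.elim (1 : B) 0, TensorProduct.tmul_zero]
      exact zero_mem _

instance isSimpleRing_tensor_right (F A B : Type*) [Field F] [Ring A] [Algebra F A]
    [Algebra.IsCentral F A] [IsSimpleRing A] [FiniteDimensional F A] [Ring B] [Algebra F B] [IsSimpleRing B] :
    IsSimpleRing (B ⊗[F] A) :=
  IsSimpleRing.of_ringEquiv (Algebra.TensorProduct.comm F A B).toRingEquiv inferInstance

/-- A homomorphism from a simple algebra to an algebra of the same dimension is bijective. -/
theorem bijective_of_finrank_eq {F A B : Type*} [Field F] [Ring A] [Algebra F A] [IsSimpleRing A]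
    [Ring B] [Algebra F B] [Nontrivial B] [FiniteDimensional F A] [FiniteDimensional F B]
    (f : A →ₐ[F] B) (h : Module.finrank F A = Module.finrank F B) : Function.Bijective f := by
  have hi : Function.Injective f := RingHom.injective f.toRingHom
  exact ⟨hi, (LinearMap.injective_iff_surjective_of_finrank_eq_finrank
    (f := f.toLinearMap) h).1 hi⟩

end CharTwoBrauer

namespace CharTwoBrauer

section ModIso
variable {F C V W : Type*} [Field F] [Ring C] [Algebra F C] [IsSimpleRing C]
  [FiniteDimensional F C] [AddCommGroup V] [Module F V] [FiniteDimensional F V]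
  [AddCommGroup W] [Module F W] [FiniteDimensional F W]

/-- Every finite-dimensional module over a simple algebra is a power of the same simple module. -/
theorem exists_linearEquiv_fun_of_isSimpleModule (S V : Type*) [AddCommGroup S] [Module C S]
    [IsSimpleModule C S] [AddCommGroup V] [Module C V] [Module.Finite C V] :
    IsArtinianRing C → ∃ n : ℕ, Nonempty (V ≃ₗ[C] (Fin n → S)) := by
  intro _
  have h := IsSimpleRing.isIsotypic C (S × V)
  have := IsSimpleModule.congr (LinearEquiv.ofInjective (LinearMap.inl C S V)
    LinearMap.inl_injective).symm
  have h2 := h (LinearMap.range (LinearMap.inl C S V))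
  exact ((h2.of_linearEquiv_type (LinearEquiv.ofInjective (LinearMap.inl C S V)
    LinearMap.inl_injective).symm).of_injective (LinearMap.inr C S V)
      LinearMap.inr_injective).linearEquiv_fun

/-- Representations of a simple algebra of the same dimension are isomorphic. -/
theorem exists_intertwining (ρ : C →ₐ[F] Module.End F V) (σ : C →ₐ[F] Module.End F W)
    (h : Module.finrank F V = Module.finrank F W) :
    ∃ e : V ≃ₗ[F] W, ∀ c v, e (ρ c v) = σ c (e v) := by
  let _ : Module C V := Module.compHom V ρ.toRingHom
  let _ : Module C W := Module.compHom W σ.toRingHom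
  have hV : ∀ (c : C) (v : V), c • v = ρ c v := fun _ _ => rfl
  have hW : ∀ (c : C) (v : W), c • v = σ c v := fun _ _ => rfl
  have : IsScalarTower F C V := ⟨fun a c v => by simp [hV]⟩
  have : IsScalarTower F C W := ⟨fun a c v => by simp [hW]⟩
  have : Module.Finite C V := Module.Finite.of_restrictScalars_finite F C V
  have : Module.Finite C W := Module.Finite.of_restrictScalars_finite F C W
  have hA : IsArtinianRing C := IsArtinianRing.of_finite F C
  obtain ⟨S, hS⟩ := IsSemisimpleModule.exists_simple_submodule C C
  have : FiniteDimensional F S := Module.Finite.trans C S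
  obtain ⟨n, ⟨e1⟩⟩ := exists_linearEquiv_fun_of_isSimpleModule (C := C) S V hA
  obtain ⟨m, ⟨e2⟩⟩ := exists_linearEquiv_fun_of_isSimpleModule (C := C) S W hA
  have h1 := (e1.restrictScalars F).finrank_eq
  have h2 := (e2.restrictScalars F).finrank_eq
  simp only [Module.finrank_pi_fintype, Finset.sum_const, Finset.card_univ, Fintype.card_fin,
    smul_eq_mul] at h1 h2
  have : Nontrivial S := IsSimpleModule.nontrivial C S
  have hpos : 0 < Module.finrank F S := Module.finrank_pos
  have hnm : n = m := Nat.eq_of_mul_eq_mul_right hpos (by omega)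
  subst hnm
  refine ⟨(e1.trans e2.symm).restrictScalars F, fun c v => ?_⟩
  exact (e1.trans e2.symm).map_smul c v
end ModIso

/-- The Skolem–Noether theorem. -/
theorem skolemNoether {F A B : Type*} [Field F] [Ring A] [Algebra F A] [Algebra.IsCentral F A]
    [IsSimpleRing A] [FiniteDimensional F A] [Ring B] [Algebra F B] [IsSimpleRing B]
    [FiniteDimensional F B] (f g : B →ₐ[F] A) : ∃ u : Aˣ, ∀ b, g b = u * f b * ↑u⁻¹ := by
  let r (f : B →ₐ[F] A) : B ⊗[F] Aᵐᵒᵖ →ₐ[F] Module.End F A :=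
    (AlgHom.mulLeftRight F A).comp (Algebra.TensorProduct.map f (AlgHom.id F Aᵐᵒᵖ))
  have hr : ∀ f b a x, r f (b ⊗ₜ a) x = f b * x * a.unop := fun f b a x => by simp [r]
  obtain ⟨e, he⟩ := exists_intertwining (r f) (r g) rfl
  have h1 : ∀ x, e x = e 1 * x := by
    intro x
    have := he (1 ⊗ₜ MulOpposite.op x) 1
    rw [hr, hr] at this
    simpa using this
  have h2 : ∀ b, e 1 * f b = g b * e 1 := by
    intro b
    have := he (b ⊗ₜ 1) 1
    rw [hr, hr] at this
    simp only [mul_one, MulOpposite.unop_one] at this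
    rw [← h1, this]
  obtain ⟨v, hv⟩ := e.surjective 1
  rw [h1] at hv
  have hv' : v * e 1 = 1 := by
    apply e.injective
    rw [h1, ← mul_assoc, hv, one_mul]
  refine ⟨⟨e 1, v, hv, hv'⟩, fun b => ?_⟩
  simp [h2, mul_assoc, hv]

/-- An element of `A ⊗ M` commuting with `1 ⊗ M` lies in `A ⊗ 1`. -/
theorem exists_tmul_one_of_commute {F A M : Type*} [Field F] [Ring A] [Algebra F A]
    [Ring M] [Algebra F M] [Algebra.IsCentral F M] (z : A ⊗[F] M)
    (hz : ∀ m : M, (1 ⊗ₜ m) * z = z * (1 ⊗ₜ m)) : ∃ a : A, z = a ⊗ₜ 1 := by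
  have h1 : z ∈ Subalgebra.centralizer F
      (Algebra.TensorProduct.includeRight '' (Set.univ : Set M) : Set (A ⊗[F] M)) := by
    rw [Subalgebra.mem_centralizer_iff]
    rintro _ ⟨a, -, rfl⟩
    exact hz a
  rw [Subalgebra.centralizer_coe_image_includeRight_eq_center_tensorProduct] at h1
  obtain ⟨w, rfl⟩ := h1
  clear hz
  induction w using TensorProduct.induction_on with
  | zero => exact ⟨0, by simp⟩
  | add s t hs ht =>
    obtain ⟨a, ha⟩ := hs
    obtain ⟨b, hb⟩ := ht
    exact ⟨a + b, by rw [map_add, TensorProduct.add_tmul]; exact congrArg₂ _ ha hb⟩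
  | tmul c d =>
    obtain ⟨d, hd⟩ := d
    rw [Subalgebra.centralizer_univ] at hd
    obtain ⟨r, rfl⟩ := Algebra.IsCentral.mem_center_iff F |>.1 hd
    refine ⟨r • c, ?_⟩
    change c ⊗ₜ[F] (algebraMap F M r) = (r • c) ⊗ₜ[F] (1 : M)
    rw [Algebra.algebraMap_eq_smul_one, TensorProduct.tmul_smul, TensorProduct.smul_tmul']

/-- Central simple algebras can be cancelled in tensor products. -/
theorem nonempty_algEquiv_of_tensor {F A B M : Type*} [Field F] [Ring A] [Algebra F A]
    [IsSimpleRing A] [FiniteDimensional F A] [Ring B] [Algebra F B]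
    [IsSimpleRing B] [Algebra.IsCentral F B] [FiniteDimensional F B]
    [Ring M] [Algebra F M] [IsSimpleRing M] [Algebra.IsCentral F M] [FiniteDimensional F M]
    (e : A ⊗[F] M ≃ₐ[F] B ⊗[F] M) : Nonempty (A ≃ₐ[F] B) := by
  let ιA : M →ₐ[F] A ⊗[F] M := Algebra.TensorProduct.includeRight
  let ιB : M →ₐ[F] B ⊗[F] M := Algebra.TensorProduct.includeRight
  obtain ⟨u, hu⟩ := skolemNoether (e.toAlgHom.comp ιA) ιB
  have hu' : ∀ m, (1 ⊗ₜ m : B ⊗[F] M) = u * e (1 ⊗ₜ m) * ↑u⁻¹ := hu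
  have h1 : ∀ a : A, ∃ b : B, (u : B ⊗[F] M) * e (a ⊗ₜ 1) * ↑u⁻¹ = b ⊗ₜ[F] (1 : M) := by
    intro a
    refine exists_tmul_one_of_commute _ fun m => ?_
    have hc : e (1 ⊗ₜ m) * e (a ⊗ₜ 1) = e (a ⊗ₜ 1) * e (1 ⊗ₜ m) := by
      rw [← map_mul, ← map_mul]; simp
    rw [hu']
    calc _ = u * (e (1 ⊗ₜ m) * e (a ⊗ₜ 1)) * ↑u⁻¹ := by simp [mul_assoc]
      _ = _ := by rw [hc]; simp [mul_assoc]
  choose φ hφ using h1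
  have inj : Function.Injective (fun b : B => (b ⊗ₜ[F] (1 : M))) :=
    Algebra.TensorProduct.includeLeft_injective (S := F) (R := F)
      (FaithfulSMul.algebraMap_injective F M)
  let Φ : A →ₐ[F] B := AlgHom.ofLinearMap
    { toFun := φ
      map_add' := fun x y => inj (by
        simp only [← hφ, TensorProduct.add_tmul, map_add, mul_add, add_mul])
      map_smul' := fun c x => inj (by
        simp only [← hφ, ← TensorProduct.smul_tmul', map_smul, Algebra.mul_smul_comm,
          Algebra.smul_mul_assoc, RingHom.id_apply]) }
    (inj (by
      change φ 1 ⊗ₜ[F] (1 : M) = 1 ⊗ₜ 1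
      rw [← hφ, ← Algebra.TensorProduct.one_def, map_one]; simp
      rfl))
    (fun x y => inj (by
      change φ (x * y) ⊗ₜ[F] (1 : M) = (φ x * φ y) ⊗ₜ[F] (1 : M)
      have : (φ x * φ y) ⊗ₜ[F] (1 : M) = (φ x ⊗ₜ[F] (1 : M)) * (φ y ⊗ₜ[F] (1 : M)) := by simp
      rw [this, ← hφ, ← hφ, ← hφ]
      have : (x * y) ⊗ₜ[F] (1 : M) = (x ⊗ₜ[F] (1 : M)) * (y ⊗ₜ[F] (1 : M)) := by simp
      rw [this, map_mul]
      simp [mul_assoc]))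
  have hd : Module.finrank F A = Module.finrank F B := by
    have := e.toLinearEquiv.finrank_eq
    rw [Module.finrank_tensorProduct, Module.finrank_tensorProduct] at this
    exact Nat.eq_of_mul_eq_mul_right Module.finrank_pos this
  exact ⟨AlgEquiv.ofBijective Φ (bijective_of_finrank_eq Φ hd)⟩

end CharTwoBrauer

namespace CharTwoBrauer

/-- The Brauer group of a field, written additively. -/
def Br (F : Type) [Field F] : Type 1 := BrauerGroup.{0, 0} F

/-- The algebra isomorphism given by a homomorphism from a simple algebra to an algebra
of the same dimension. -/
noncomputable def algEquivOfFinrank {F A B : Type*} [Field F] [Ring A] [Algebra F A]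
    [IsSimpleRing A] [Ring B] [Algebra F B] [Nontrivial B] [FiniteDimensional F A]
    [FiniteDimensional F B] (f : A →ₐ[F] B) (h : Module.finrank F A = Module.finrank F B) :
    A ≃ₐ[F] B :=
  AlgEquiv.ofBijective f (bijective_of_finrank_eq f h)

/-- The extension of an `F`-algebra map `A → C` to `K ⊗ A`. -/
noncomputable def liftBaseChange {F K A C : Type*} [Field F] [Field K] [Algebra F K] [Ring A]
    [Algebra F A] [Ring C] [Algebra F C] [Algebra K C] [IsScalarTower F K C] (g : A →ₐ[F] C) :
    K ⊗[F] A →ₐ[K] C :=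
  Algebra.TensorProduct.lift (Algebra.ofId K C) g (fun x y => Algebra.commutes x (g y))

@[simp] theorem liftBaseChange_tmul {F K A C : Type*} [Field F] [Field K] [Algebra F K] [Ring A]
    [Algebra F A] [Ring C] [Algebra F C] [Algebra K C] [IsScalarTower F K C] (g : A →ₐ[F] C)
    (x : K) (a : A) : liftBaseChange (K := K) g (x ⊗ₜ a) = algebraMap K C x * g a := by
  exact Algebra.TensorProduct.lift_tmul _ _ _ _ _

section Cls
variable (F A B : Type) [Field F] [Ring A] [Algebra F A] [Algebra.IsCentral F A]
  [IsSimpleRing A] [FiniteDimensional F A] [Ring B] [Algebra F B] [Algebra.IsCentral F B]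
  [IsSimpleRing B] [FiniteDimensional F B]

/-- The Brauer class of a central simple algebra. -/
def cls : Br F := Quotient.mk (Brauer.CSA_Setoid F) { toAlgCat := AlgCat.of F A }

variable {F} in
theorem Br.exists_rep (x : Br F) : ∃ (A : Type) (_ : Ring A) (_ : Algebra F A)
    (_ : Algebra.IsCentral F A) (_ : IsSimpleRing A) (_ : FiniteDimensional F A), x = cls F A := by
  obtain ⟨A, rfl⟩ := Quotient.exists_rep x
  exact ⟨A, inferInstance, inferInstance, inferInstance, inferInstance, inferInstance, rfl⟩

theorem cls_eq_iff : cls F A = cls F B ↔ ∃ n m : ℕ, n ≠ 0 ∧ m ≠ 0 ∧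
    Nonempty (Matrix (Fin n) (Fin n) A ≃ₐ[F] Matrix (Fin m) (Fin m) B) :=
  Quotient.eq (r := Brauer.CSA_Setoid F)

variable {F A B} in
theorem cls_congr (e : A ≃ₐ[F] B) : cls F A = cls F B :=
  (cls_eq_iff F A B).2 ⟨1, 1, one_ne_zero, one_ne_zero, ⟨e.mapMatrix⟩⟩

variable {F A B} in
theorem cls_eq_of_matrix {n m : ℕ} (hn : n ≠ 0) (hm : m ≠ 0)
    (e : Matrix (Fin n) (Fin n) A ≃ₐ[F] Matrix (Fin m) (Fin m) B) : cls F A = cls F B :=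
  (cls_eq_iff F A B).2 ⟨n, m, hn, hm, ⟨e⟩⟩

instance isSimpleRing_matrix_fin {n : ℕ} [NeZero n] : IsSimpleRing (Matrix (Fin n) (Fin n) A) :=
  inferInstance

theorem cls_matrix (n : ℕ) [NeZero n] : cls F (Matrix (Fin n) (Fin n) A) = cls F A :=
  cls_eq_of_matrix one_ne_zero (m := 1 * n) (by simpa using NeZero.ne n)
    ((Matrix.compAlgEquiv _ _ _ _).trans (Matrix.reindexAlgEquiv _ _ finProdFinEquiv))

variable {F A B} in
/-- Brauer equivalent algebras of the same dimension are isomorphic. -/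
theorem nonempty_algEquiv_of_cls_eq (h : cls F A = cls F B)
    (hd : Module.finrank F A = Module.finrank F B) : Nonempty (A ≃ₐ[F] B) := by
  obtain ⟨n, m, hn, hm, ⟨e⟩⟩ := (cls_eq_iff F A B).1 h
  have := e.toLinearEquiv.finrank_eq
  simp only [Module.finrank_matrix, Fintype.card_fin, ← hd] at this
  have h2 : n * n = m * m := Nat.eq_of_mul_eq_mul_right (Module.finrank_pos (R := F) (M := A)) this
  have h3 : n = m := Nat.mul_self_inj.1 h2
  subst h3
  have : NeZero n := ⟨hn⟩
  exact nonempty_algEquiv_of_tensor (((matrixEquivTensor (Fin n) F A).symm.trans e).trans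
    (matrixEquivTensor (Fin n) F B))

end Cls

section Group
variable (F : Type) [Field F]

noncomputable instance : Add (Br F) where
  add := Quotient.map₂ (sa := Brauer.CSA_Setoid F) (sb := Brauer.CSA_Setoid F)
    (sc := Brauer.CSA_Setoid F) (fun A B => { toAlgCat := AlgCat.of F (A ⊗[F] B) }) (by
      rintro A A' ⟨n, m, hn, hm, ⟨e⟩⟩ B B' ⟨p, q, hp, hq, ⟨f⟩⟩
      refine ⟨n * p, m * q, by simp [hn, hp], by simp [hm, hq], ⟨?_⟩⟩
      exact (Matrix.reindexAlgEquiv F _ finProdFinEquiv).symm.trans <|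
        (Matrix.kroneckerTMulAlgEquiv (Fin n) (Fin p) F F A B).symm.trans <|
        (Algebra.TensorProduct.congr e f).trans <|
        (Matrix.kroneckerTMulAlgEquiv (Fin m) (Fin q) F F A' B').trans <|
        Matrix.reindexAlgEquiv F _ finProdFinEquiv)

noncomputable instance : Neg (Br F) where
  neg := Quotient.map (sa := Brauer.CSA_Setoid F) (sb := Brauer.CSA_Setoid F)
    (fun A => { toAlgCat := AlgCat.of F Aᵐᵒᵖ }) (by
      rintro A A' ⟨n, m, hn, hm, ⟨e⟩⟩
      exact ⟨n, m, hn, hm, ⟨AlgEquiv.mopMatrix.trans (e.op.trans AlgEquiv.mopMatrix.symm)⟩⟩)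

noncomputable instance : Zero (Br F) := ⟨cls F F⟩

variable (A B : Type) [Ring A] [Algebra F A] [Algebra.IsCentral F A]
  [IsSimpleRing A] [FiniteDimensional F A] [Ring B] [Algebra F B] [Algebra.IsCentral F B]
  [IsSimpleRing B] [FiniteDimensional F B]

theorem cls_tensor : cls F (A ⊗[F] B) = cls F A + cls F B := rfl

theorem cls_op : cls F Aᵐᵒᵖ = -cls F A := rfl

theorem cls_self : cls F F = 0 := rfl

instance isSimpleRing_end (V : Type*) [AddCommGroup V] [Module F V] [FiniteDimensional F V]
    [Nontrivial V] : IsSimpleRing (Module.End F V) := by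
  have : NeZero (Module.finrank F V) := ⟨Module.finrank_pos.ne'⟩
  exact IsSimpleRing.of_ringEquiv (algEquivMatrix (Module.finBasis F V)).symm.toRingEquiv
    inferInstance

theorem cls_end (V : Type) [AddCommGroup V] [Module F V] [FiniteDimensional F V]
    [Nontrivial V] : cls F (Module.End F V) = 0 := by
  have : NeZero (Module.finrank F V) := ⟨Module.finrank_pos.ne'⟩
  rw [cls_congr (algEquivMatrix (Module.finBasis F V)), cls_matrix, cls_self]

noncomputable instance : AddCommGroup (Br F) where
  add_assoc x y z := by
    obtain ⟨A, _, _, _, _, _, rfl⟩ := x.exists_rep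
    obtain ⟨B, _, _, _, _, _, rfl⟩ := y.exists_rep
    obtain ⟨C, _, _, _, _, _, rfl⟩ := z.exists_rep
    simp only [← cls_tensor]
    exact cls_congr (Algebra.TensorProduct.assoc F F F A B C)
  add_comm x y := by
    obtain ⟨A, _, _, _, _, _, rfl⟩ := x.exists_rep
    obtain ⟨B, _, _, _, _, _, rfl⟩ := y.exists_rep
    simp only [← cls_tensor]
    exact cls_congr (Algebra.TensorProduct.comm F A B)
  zero_add x := by
    obtain ⟨A, _, _, _, _, _, rfl⟩ := x.exists_rep
    rw [← cls_self, ← cls_tensor]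
    exact cls_congr (Algebra.TensorProduct.lid F A)
  add_zero x := by
    obtain ⟨A, _, _, _, _, _, rfl⟩ := x.exists_rep
    rw [← cls_self, ← cls_tensor]
    exact cls_congr (Algebra.TensorProduct.rid F F A)
  neg_add_cancel x := by
    obtain ⟨A, _, _, _, _, _, rfl⟩ := x.exists_rep
    rw [← cls_op, ← cls_tensor, cls_congr (Algebra.TensorProduct.comm F Aᵐᵒᵖ A),
      cls_congr (AlgEquiv.ofBijective _ (mulLeftRight_bijective F A)), cls_end]
  nsmul := nsmulRec
  zsmul := zsmulRec

variable {F A} in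
/-- The class of a central simple algebra vanishes iff the algebra is a matrix algebra. -/
theorem cls_eq_zero_iff : cls F A = 0 ↔
    ∃ n : ℕ, n ≠ 0 ∧ Nonempty (A ≃ₐ[F] Matrix (Fin n) (Fin n) F) := by
  constructor
  · intro h
    obtain ⟨n, m, hn, hm, ⟨e⟩⟩ := (cls_eq_iff F A F).1 h
    have h1 := e.toLinearEquiv.finrank_eq
    simp only [Module.finrank_matrix, Fintype.card_fin, Module.finrank_self, mul_one] at h1
    have h2 : n ∣ m := by
      rw [← Nat.pow_dvd_pow_iff two_ne_zero, pow_two, pow_two]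
      exact ⟨_, h1.symm⟩
    obtain ⟨k, rfl⟩ := h2
    have hk : k ≠ 0 := by rintro rfl; simp at hm
    have : NeZero k := ⟨hk⟩
    refine ⟨k, hk, nonempty_algEquiv_of_cls_eq ?_ ?_⟩
    · rw [h, cls_matrix, cls_self]
    · simp only [Module.finrank_matrix, Fintype.card_fin, Module.finrank_self, mul_one]
      have : (n * n) * Module.finrank F A = (n * n) * (k * k) := by rw [h1]; ring
      exact Nat.eq_of_mul_eq_mul_left (by positivity) this
  · rintro ⟨n, hn, ⟨e⟩⟩
    have : NeZero n := ⟨hn⟩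
    rw [cls_congr e, cls_matrix, cls_self]

/-- A central simple algebra with trivial class and a zero divisor-free multiplication is
one-dimensional. -/
theorem finrank_eq_one_of_cls_eq_zero [NoZeroDivisors A] (h : cls F A = 0) :
    Module.finrank F A = 1 := by
  obtain ⟨n, hn, ⟨e⟩⟩ := cls_eq_zero_iff.1 h
  have : n = 1 := by
    by_contra hn1
    have : NeZero n := ⟨hn⟩
    have h1 : 1 < n := by omega
    let i : Fin n := ⟨0, by omega⟩
    let j : Fin n := ⟨1, h1⟩
    have hij : i ≠ j := by simp [i, j]
    have hz : e.symm (Matrix.single i j 1) * e.symm (Matrix.single i j 1) = 0 := by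
      rw [← map_mul, Matrix.single_mul_single_of_ne _ _ _ _ hij.symm, map_zero]
    have := mul_self_eq_zero.1 hz
    rw [EmbeddingLike.map_eq_zero_iff] at this
    have := congrFun (congrFun this i) j
    simp at this
  subst this
  rw [e.toLinearEquiv.finrank_eq, Module.finrank_matrix]
  simp
end Group

section Res
variable (F K L : Type) [Field F] [Field K] [Field L] [Algebra F K] [Algebra K L] [Algebra F L]
  [IsScalarTower F K L]

/-- Base change of matrix algebras. -/
noncomputable def matrixBaseChange (A : Type) [Ring A] [Algebra F A] [Algebra.IsCentral F A]
    [IsSimpleRing A] [FiniteDimensional F A] (n : ℕ) [NeZero n] :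
    K ⊗[F] Matrix (Fin n) (Fin n) A ≃ₐ[K] Matrix (Fin n) (Fin n) (K ⊗[F] A) :=
  algEquivOfFinrank (liftBaseChange (AlgHom.mapMatrix Algebra.TensorProduct.includeRight)) (by
    simp [Module.finrank_matrix, Module.finrank_baseChange])

/-- Restriction of Brauer classes as a function. -/
noncomputable def resFun : Br F → Br K :=
  Quotient.map (sa := Brauer.CSA_Setoid F) (sb := Brauer.CSA_Setoid K)
    (fun A => { toAlgCat := AlgCat.of K (K ⊗[F] A) }) (by
      rintro A A' ⟨n, m, hn, hm, ⟨e⟩⟩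
      have : NeZero n := ⟨hn⟩
      have : NeZero m := ⟨hm⟩
      exact ⟨n, m, hn, hm, ⟨(matrixBaseChange F K A n).symm.trans
        ((Algebra.TensorProduct.congr (AlgEquiv.refl : K ≃ₐ[K] K) e).trans
          (matrixBaseChange F K A' m))⟩⟩)

/-- Restriction of Brauer classes along a field extension. -/
noncomputable def res : Br F →+ Br K where
  toFun := resFun F K
  map_zero' := by
    change cls K (K ⊗[F] F) = cls K K
    exact cls_congr (Algebra.TensorProduct.rid F K K)
  map_add' x y := by
    obtain ⟨A, _, _, _, _, _, rfl⟩ := x.exists_rep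
    obtain ⟨B, _, _, _, _, _, rfl⟩ := y.exists_rep
    change cls K (K ⊗[F] (A ⊗[F] B)) = cls K (K ⊗[F] A) + cls K (K ⊗[F] B)
    rw [← cls_tensor]
    let f : A ⊗[F] B →ₐ[F] (K ⊗[F] A) ⊗[K] (K ⊗[F] B) :=
      Algebra.TensorProduct.lift
        ((Algebra.TensorProduct.includeLeft : K ⊗[F] A →ₐ[K] _).restrictScalars F |>.comp
          Algebra.TensorProduct.includeRight)
        ((Algebra.TensorProduct.includeRight : K ⊗[F] B →ₐ[K] _).restrictScalars F |>.comp
          Algebra.TensorProduct.includeRight)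
        (fun a b => by simp [Commute, SemiconjBy])
    exact cls_congr (algEquivOfFinrank (liftBaseChange f) (by
      simp [Module.finrank_baseChange, Module.finrank_tensorProduct]))

theorem res_cls (A : Type) [Ring A] [Algebra F A] [Algebra.IsCentral F A]
    [IsSimpleRing A] [FiniteDimensional F A] : res F K (cls F A) = cls K (K ⊗[F] A) := rfl

theorem res_res (x : Br F) : res K L (res F K x) = res F L x := by
  obtain ⟨A, _, _, _, _, _, rfl⟩ := x.exists_rep
  rw [res_cls, res_cls, res_cls]
  let f : A →ₐ[F] L ⊗[K] (K ⊗[F] A) :=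
    (Algebra.TensorProduct.includeRight : K ⊗[F] A →ₐ[K] _).restrictScalars F |>.comp
          Algebra.TensorProduct.includeRight
  exact (cls_congr (algEquivOfFinrank (liftBaseChange f) (by
      simp [Module.finrank_baseChange]))).symm

theorem res_self (x : Br F) : res F F x = x := by
  obtain ⟨A, _, _, _, _, _, rfl⟩ := x.exists_rep
  rw [res_cls]
  exact cls_congr (Algebra.TensorProduct.lid F A)
end Res
end CharTwoBrauer

namespace CharTwoBrauer

section MatrixUnits
variable {F S : Type*} [Field F] [Ring S] [Algebra F S] {q : ℕ}

/-- The centralizer of the image of a matrix algebra. -/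
def matrixCentralizer (f : Matrix (Fin q) (Fin q) F →ₐ[F] S) : Subalgebra F S :=
  Subalgebra.centralizer F (f.range : Set S)

theorem commute_of_mem_matrixCentralizer (f : Matrix (Fin q) (Fin q) F →ₐ[F] S)
    (c : matrixCentralizer f) (m : Matrix (Fin q) (Fin q) F) : Commute (c : S) (f m) :=
  (Subalgebra.mem_centralizer_iff F |>.mp c.2 (f m) ⟨m, rfl⟩).symm

theorem mem_matrixCentralizer_of_single (f : Matrix (Fin q) (Fin q) F →ₐ[F] S) (x : S)
    (h : ∀ i j, f (Matrix.single i j 1) * x = x * f (Matrix.single i j 1)) :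
    x ∈ matrixCentralizer f := by
  refine (Subalgebra.mem_centralizer_iff F).mpr ?_
  rintro _ ⟨m, rfl⟩
  change f m * x = x * f m
  induction m using Matrix.induction_on' with
  | h_zero => simp
  | h_add p q hp hq => simp [add_mul, mul_add, hp, hq]
  | h_std_basis i j r =>
    have : Matrix.single i j r = r • Matrix.single i j (1 : F) := by simp
    rw [this, map_smul, smul_mul_assoc, mul_smul_comm, h]

/-- The coefficients of an element with respect to matrix units. -/
theorem sum_mem_matrixCentralizer (f : Matrix (Fin q) (Fin q) F →ₐ[F] S) (x : S)
    (i j : Fin q) : ∑ k, f (Matrix.single k i 1) * x * f (Matrix.single j k 1) ∈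
      matrixCentralizer f := by
  refine mem_matrixCentralizer_of_single f _ fun s t => ?_
  rw [Finset.mul_sum, Finset.sum_mul, Finset.sum_eq_single t, Finset.sum_eq_single s]
  · rw [← mul_assoc, ← mul_assoc, ← map_mul, mul_assoc _ (f _) (f _), ← map_mul]
    simp
  · intro b _ hb
    rw [mul_assoc, ← map_mul, Matrix.single_mul_single_of_ne _ _ _ _ hb]
    simp
  · simp
  · intro b _ hb
    rw [← mul_assoc, ← mul_assoc, ← map_mul, Matrix.single_mul_single_of_ne _ _ _ _ hb.symm]
    simp
  · simp

/-- Multiplication from the centralizer of a matrix algebra tensor the matrix algebra. -/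
noncomputable def matrixCentralizerMul (f : Matrix (Fin q) (Fin q) F →ₐ[F] S) :
    matrixCentralizer f ⊗[F] Matrix (Fin q) (Fin q) F →ₐ[F] S :=
  Algebra.TensorProduct.lift (matrixCentralizer f).val f
    (fun c m => commute_of_mem_matrixCentralizer f c m)

theorem matrixCentralizerMul_tmul (f : Matrix (Fin q) (Fin q) F →ₐ[F] S)
    (c : matrixCentralizer f) (m : Matrix (Fin q) (Fin q) F) :
    matrixCentralizerMul f (c ⊗ₜ m) = c * f m :=
  Algebra.TensorProduct.lift_tmul _ _ _ _ _

theorem matrixCentralizerMul_bijective (f : Matrix (Fin q) (Fin q) F →ₐ[F] S) [NeZero q] :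
    Function.Bijective (matrixCentralizerMul f) := by
  constructor
  · rw [injective_iff_map_eq_zero]
    intro z hz
    obtain ⟨N, rfl⟩ := (matrixEquivTensor (Fin q) F (matrixCentralizer f)).surjective z
    suffices N = 0 by simp [this]
    have hN : matrixCentralizerMul f (matrixEquivTensor (Fin q) F (matrixCentralizer f) N) =
        ∑ p : Fin q × Fin q, (N p.1 p.2 : S) * f (Matrix.single p.1 p.2 1) := by
      rw [matrixEquivTensor_apply, map_sum]
      simp only [matrixCentralizerMul_tmul]
    rw [hN] at hz
    ext i j
    have key : ∑ k, f (Matrix.single k i 1) * (∑ p : Fin q × Fin q, (N p.1 p.2 : S) *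
        f (Matrix.single p.1 p.2 1)) * f (Matrix.single j k 1) = N i j := by
      have : ∀ k, f (Matrix.single k i 1) * (∑ p : Fin q × Fin q, (N p.1 p.2 : S) *
        f (Matrix.single p.1 p.2 1)) * f (Matrix.single j k 1) =
          N i j * f (Matrix.single k k 1) := by
        intro k
        rw [Finset.mul_sum, Finset.sum_mul, Finset.sum_eq_single (i, j)]
        · rw [← mul_assoc, ← (commute_of_mem_matrixCentralizer f _ _).eq, mul_assoc, mul_assoc,
            ← map_mul, ← map_mul]
          simp
        · rintro ⟨s, t⟩ _ hst
          rw [← mul_assoc, ← (commute_of_mem_matrixCentralizer f _ _).eq, mul_assoc, mul_assoc,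
            ← map_mul, ← map_mul]
          by_cases h : i = s
          · have ht : t ≠ j := by rintro rfl; exact hst (by rw [h])
            simp [Matrix.single_mul_single_of_ne _ _ _ _ ht]
          · simp only [← mul_assoc, Matrix.single_mul_single_of_ne _ _ _ _ h]
            simp
        · simp
      simp_rw [this, ← Finset.mul_sum, ← map_sum]
      rw [show ∑ k : Fin q, Matrix.single k k (1 : F) = 1 from by
        rw [Matrix.sum_single_one], map_one, mul_one]
    rw [hz] at key
    simpa using key.symm
  · intro x
    refine ⟨∑ i, ∑ j, (⟨_, sum_mem_matrixCentralizer f x i j⟩ : matrixCentralizer f) ⊗ₜ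
      Matrix.single i j (1 : F), ?_⟩
    simp only [map_sum, matrixCentralizerMul_tmul]
    have : ∀ i j, (∑ k, f (Matrix.single k i 1) * x * f (Matrix.single j k 1)) *
        f (Matrix.single i j 1) = f (Matrix.single i i 1) * x * f (Matrix.single j j 1) := by
      intro i j
      rw [Finset.sum_mul, Finset.sum_eq_single i]
      · rw [mul_assoc, ← map_mul]; simp
      · intro b _ hb
        rw [mul_assoc, ← map_mul, Matrix.single_mul_single_of_ne _ _ _ _ hb]; simp
      · simp
    simp_rw [this, ← Finset.mul_sum, ← Finset.sum_mul, ← map_sum]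
    rw [show ∑ k : Fin q, Matrix.single k k (1 : F) = 1 from by
        rw [Matrix.sum_single_one], map_one, mul_one, one_mul]

theorem isSimpleRing_of_matrix {R : Type*} [Ring R] [Nontrivial R] [NeZero q]
    [h : IsSimpleRing (Matrix (Fin q) (Fin q) R)] : IsSimpleRing R where
  simple := (TwoSidedIdeal.orderIsoMatrix (n := Fin q) (R := R)).isSimpleOrder

end MatrixUnits

section Descent
theorem exists_of_matrix_algHom {F Sg B : Type} [Field F] [Ring Sg] [Algebra F Sg]
    [Algebra.IsCentral F Sg] [IsSimpleRing Sg] [FiniteDimensional F Sg] [Ring B] [Algebra F B]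
    {q : ℕ} [NeZero q] (g : Matrix (Fin q) (Fin q) B →ₐ[F] Sg) :
    ∃ (A : Type) (_ : Ring A) (_ : Algebra F A) (_ : Algebra.IsCentral F A) (_ : IsSimpleRing A)
      (_ : FiniteDimensional F A), cls F A = cls F Sg ∧ Nonempty (B →ₐ[F] A) ∧
      Module.finrank F Sg = q ^ 2 * Module.finrank F A := by
  let f : Matrix (Fin q) (Fin q) F →ₐ[F] Sg := g.comp (Algebra.ofId F B).mapMatrix
  let Φ := AlgEquiv.ofBijective _ (matrixCentralizerMul_bijective f)
  let C := matrixCentralizer f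
  have : FiniteDimensional F C := inferInstance
  let Ψ : Matrix (Fin q) (Fin q) C ≃ₐ[F] Sg := (matrixEquivTensor (Fin q) F C).trans Φ
  have h1 : IsSimpleRing (Matrix (Fin q) (Fin q) C) :=
    IsSimpleRing.of_ringEquiv Ψ.symm.toRingEquiv inferInstance
  have h2 : IsSimpleRing C := isSimpleRing_of_matrix (q := q)
  have h3 : Algebra.IsCentral F C := by
    constructor
    intro z hz
    rw [Subalgebra.mem_center_iff] at hz
    have hc : (z : Sg) ∈ Subalgebra.center F Sg := by
      rw [Subalgebra.mem_center_iff]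
      intro x
      obtain ⟨y, rfl⟩ := Φ.surjective x
      change matrixCentralizerMul f y * _ = _ * matrixCentralizerMul f y
      induction y with
      | zero => simp
      | add a b ha hb => simp only [map_add, add_mul, mul_add, ha, hb]
      | tmul c m =>
        simp only [matrixCentralizerMul_tmul]
        have := congrArg Subtype.val (hz c)
        simp only [Subalgebra.coe_mul] at this
        rw [mul_assoc, ← (commute_of_mem_matrixCentralizer f z m).eq, ← mul_assoc, ← mul_assoc,
          this]
    rw [Algebra.IsCentral.center_eq_bot] at hc
    obtain ⟨r, hr⟩ := Algebra.mem_bot.mp hc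
    exact Algebra.mem_bot.mpr ⟨r, Subtype.ext hr⟩
  refine ⟨C, inferInstance, inferInstance, h3, h2, this, ?_, ?_, ?_⟩
  · rw [← cls_matrix F C q, cls_congr Ψ]
  · let s : B →ₐ[F] Sg := g.comp (Matrix.scalarAlgHom (Fin q) F)
    refine ⟨s.codRestrict C ?_⟩
    intro b
    refine mem_matrixCentralizer_of_single f _ fun i j => ?_
    change g _ * g _ = g _ * g _
    rw [← map_mul, ← map_mul]
    congr 1
    ext k l
    simp [Algebra.ofId_apply, Matrix.scalar_apply, Matrix.single, Matrix.mul_diagonal,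
      Matrix.diagonal_mul]
  · rw [← Ψ.toLinearEquiv.finrank_eq, Module.finrank_matrix]; simp [sq]

variable {F K S B : Type} [Field F] [Field K] [Algebra F K] [FiniteDimensional F K]
  [Ring S] [Algebra F S] [Algebra.IsCentral F S] [IsSimpleRing S] [FiniteDimensional F S]
  [Ring B] [Algebra K B] [Algebra.IsCentral K B] [IsSimpleRing B] [FiniteDimensional K B]
  [Algebra F B] [IsScalarTower F K B]

theorem exists_embedding_of_algEquiv {q : ℕ} [NeZero q]
    (e : K ⊗[F] S ≃ₐ[K] Matrix (Fin q) (Fin q) B) :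
    ∃ (A : Type) (_ : Ring A) (_ : Algebra F A) (_ : Algebra.IsCentral F A) (_ : IsSimpleRing A)
      (_ : FiniteDimensional F A), cls F A = cls F S ∧ Nonempty (B →ₐ[F] A) ∧
      Module.finrank F A = Module.finrank F K ^ 2 * Module.finrank K B := by
  let ι : K ⊗[F] S →ₐ[F] Module.End F K ⊗[F] S :=
    Algebra.TensorProduct.map (Algebra.lmul F K) (AlgHom.id F S)
  let g : Matrix (Fin q) (Fin q) B →ₐ[F] Module.End F K ⊗[F] S :=
    ι.comp (e.symm.toAlgHom.restrictScalars F)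
  obtain ⟨A, i1, i2, i3, i4, i5, h, h', d1⟩ :=
    exists_of_matrix_algHom (F := F) (Sg := Module.End F K ⊗[F] S) (B := B) (q := q) g
  refine ⟨A, i1, i2, i3, i4, i5, ?_, h', ?_⟩
  · rw [h, cls_tensor, cls_end, zero_add]
  · have d2 : Module.finrank F (Module.End F K ⊗[F] S) =
        Module.finrank F K ^ 2 * Module.finrank F S := by
      simp [Module.finrank_tensorProduct, Module.finrank_linearMap, sq]
    have d3 : Module.finrank F S = q ^ 2 * Module.finrank K B := by
      rw [← Module.finrank_baseChange (R := K) (S := F) (M' := S), e.toLinearEquiv.finrank_eq,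
        Module.finrank_matrix]; simp [sq]
    have hq : 0 < q ^ 2 := pow_pos (Nat.pos_of_ne_zero (NeZero.ne q)) 2
    apply Nat.eq_of_mul_eq_mul_left hq
    rw [← d1, d2, d3]; ring

/-- If `S` becomes Brauer equivalent to `B` over `K`, then `B` embeds over `F` into an algebra
Brauer equivalent to `S` of the expected dimension. -/
theorem exists_embedding_of_res_eq (h : res F K (cls F S) = cls K B) :
    ∃ (A : Type) (_ : Ring A) (_ : Algebra F A) (_ : Algebra.IsCentral F A) (_ : IsSimpleRing A)
      (_ : FiniteDimensional F A), cls F A = cls F S ∧ Nonempty (B →ₐ[F] A) ∧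
      Module.finrank F A = Module.finrank F K ^ 2 * Module.finrank K B := by
  rw [res_cls, cls_eq_iff] at h
  obtain ⟨p, q, hp, hq, ⟨e⟩⟩ := h
  have : NeZero p := ⟨hp⟩
  have : NeZero q := ⟨hq⟩
  obtain ⟨A, i1, i2, i3, i4, i5, h, h'⟩ :=
    exists_embedding_of_algEquiv ((matrixBaseChange F K S p).trans e)
  exact ⟨A, i1, i2, i3, i4, i5, h.trans (cls_matrix F S p), h'⟩
end Descent
end CharTwoBrauer

namespace CharTwoBrauer
open Quaternion

section CharTwoModule
theorem add_self_eq_zero_of_module (F : Type*) {M : Type*} [Field F] [CharP F 2] [AddCommGroup M] [Module F M]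
    (x : M) : x + x = 0 := by
  rw [← two_smul F x, CharTwo.two_eq_zero, zero_smul]

theorem neg_eq_of_module (F : Type*) {M : Type*} [Field F] [CharP F 2] [AddCommGroup M] [Module F M]
    (x : M) : -x = x :=
  neg_eq_of_add_eq_zero_left (add_self_eq_zero_of_module F x)

theorem sub_eq_of_module (F : Type*) {M : Type*} [Field F] [CharP F 2] [AddCommGroup M] [Module F M]
    (x y : M) : x - y = x + y := by
  rw [sub_eq_add_neg, neg_eq_of_module F]

theorem eq_of_add_eq_zero_of_module (F : Type*) {M : Type*} [Field F] [CharP F 2] [AddCommGroup M] [Module F M]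
    {x y : M} (h : x + y = 0) : x = y := by
  rw [eq_neg_of_add_eq_zero_left h, neg_eq_of_module F]
end CharTwoModule

section SymHom
variable {F : Type*} [Field F] [CharP F 2] {A : Type*} [Ring A] [Algebra F A]

/-- The homomorphism from a symbol algebra determined by generators satisfying its relations. -/
noncomputable def symHom (s e : F) (i j : A) (hi : i * i = i + algebraMap F A s)
    (hj : j * j = algebraMap F A e) (hij : j * i = i * j + j) : ℍ[F,s,1,e] →ₐ[F] A :=
  QuaternionAlgebra.Basis.liftHom
    { i := i, j := j, k := i * j
      i_mul_i := by rw [hi, one_smul, Algebra.algebraMap_eq_smul_one, add_comm]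
      j_mul_j := by rw [hj, Algebra.algebraMap_eq_smul_one]
      i_mul_j := rfl
      j_mul_i := by rw [hij, one_smul, sub_eq_of_module F, add_comm] }

variable (s e : F)

/-- The first generator of a symbol algebra. -/
def symI : ℍ[F,s,1,e] := ⟨0, 1, 0, 0⟩
/-- The second generator of a symbol algebra. -/
def symJ : ℍ[F,s,1,e] := ⟨0, 0, 1, 0⟩

theorem symI_mul_self : symI s e * symI s e = symI s e + algebraMap F _ s := by
  ext <;> simp [symI, QuaternionAlgebra.algebraMap_eq]
theorem symJ_mul_self : symJ s e * symJ s e = algebraMap F _ e := by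
  ext <;> simp [symJ, QuaternionAlgebra.algebraMap_eq]
theorem symJ_mul_symI : symJ s e * symI s e = symI s e * symJ s e + symJ s e := by
  ext <;> simp [symI, symJ, CharTwo.neg_eq]

theorem commutator_symI (x : ℍ[F,s,1,e]) :
    symI s e * x + x * symI s e = ⟨0, 0, x.imJ, x.imK⟩ := by
  ext <;> simp [symI] <;> ring_nf <;> simp [CharTwo.two_eq_zero, CharTwo.neg_eq]

theorem commutator_symJ (x : ℍ[F,s,1,e]) :
    symJ s e * x + x * symJ s e = ⟨e * x.imK, 0, x.imI, 0⟩ := by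
  ext <;> simp [symJ] <;> ring_nf <;> simp [CharTwo.two_eq_zero, CharTwo.neg_eq, mul_comm]

variable {e}

theorem isCentral_sym (he : e ≠ 0) : Algebra.IsCentral F ℍ[F,s,1,e] where
  out := by
    intro z hz
    rw [Subalgebra.mem_center_iff] at hz
    have h1 := commutator_symI s e z
    have h2 := commutator_symJ s e z
    rw [hz, add_self_eq_zero_of_module F, QuaternionAlgebra.ext_iff] at h1 h2
    simp at h1 h2
    refine Algebra.mem_bot.mpr ⟨z.re, ?_⟩
    ext <;> simp [QuaternionAlgebra.algebraMap_eq, h1.1.symm, h1.2.symm, h2.2.symm]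

theorem isSimpleRing_sym (he : e ≠ 0) : IsSimpleRing ℍ[F,s,1,e] := by
  have hnt : Nontrivial ℍ[F,s,1,e] := inferInstance
  refine IsSimpleRing.of_eq_bot_or_eq_top fun I => ?_
  by_cases hI : I = ⊥
  · exact Or.inl hI
  right
  rw [← TwoSidedIdeal.one_mem_iff]
  obtain ⟨x, hx, hx0⟩ : ∃ x ∈ I, x ≠ 0 := by
    by_contra! h
    exact hI (eq_bot_iff.mpr fun x hx => by simpa using h x hx)
  have unit : ∀ r : F, r ≠ 0 → algebraMap F ℍ[F,s,1,e] r ∈ I → (1 : ℍ[F,s,1,e]) ∈ I := by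
    intro r hr h
    have := I.mul_mem_left (algebraMap F _ r⁻¹) _ h
    rwa [← map_mul, inv_mul_cancel₀ hr, map_one] at this
  have comI : ∀ y ∈ I, (⟨0, 0, y.imJ, y.imK⟩ : ℍ[F,s,1,e]) ∈ I := fun y hy => by
    rw [← commutator_symI]
    exact I.add_mem (I.mul_mem_left _ _ hy) (I.mul_mem_right _ _ hy)
  have comJ : ∀ y ∈ I, (⟨e * y.imK, 0, y.imI, 0⟩ : ℍ[F,s,1,e]) ∈ I := fun y hy => by
    rw [← commutator_symJ]
    exact I.add_mem (I.mul_mem_left _ _ hy) (I.mul_mem_right _ _ hy)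
  have key : ∀ y ∈ I, y.imJ = 0 → y.imK = 0 → y ≠ 0 → (1 : ℍ[F,s,1,e]) ∈ I := by
    intro y hy h2 h3 hy0
    by_cases h1 : y.imI = 0
    · have h0 : y.re ≠ 0 := fun h0 => hy0 (QuaternionAlgebra.ext h0 h1 h2 h3)
      refine unit y.re h0 ?_
      convert hy using 1
      ext <;> simp [QuaternionAlgebra.algebraMap_eq, h1, h2, h3]
    · refine unit (y.imI * e) (mul_ne_zero h1 he) ?_
      have := I.mul_mem_right _ (symJ s e) (comJ y hy)
      convert this using 1
      ext <;> simp [QuaternionAlgebra.algebraMap_eq, h3, symJ, mul_comm]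
  have hJ := comI x hx
  have hmul := I.mul_mem_right _ (symJ s e) hJ
  by_cases hz : (⟨0, 0, x.imJ, x.imK⟩ : ℍ[F,s,1,e]) = 0
  · rw [QuaternionAlgebra.ext_iff] at hz
    exact key x hx hz.2.2.1 hz.2.2.2 hx0
  · refine key _ hmul (by simp [symJ]) (by simp [symJ]) fun h0 => hz ?_
    rw [QuaternionAlgebra.ext_iff] at h0
    simp [symJ, he] at h0
    ext <;> simp [h0]
end SymHom

section Sym
variable (F : Type) [Field F] [CharP F 2]
open Classical in
/-- The Brauer class of the symbol algebra `[s, e)`, set to zero if `e = 0`. -/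
noncomputable def sym (s e : F) : Br F :=
  if he : e ≠ 0 then
    haveI := isCentral_sym s he
    haveI := isSimpleRing_sym s he
    cls F ℍ[F,s,1,e]
  else 0

variable {F}
theorem sym_zero_right (s : F) : sym F s 0 = 0 := by simp [sym]

theorem sym_eq_cls (s : F) {e : F} (he : e ≠ 0) [Algebra.IsCentral F ℍ[F,s,1,e]]
    [IsSimpleRing ℍ[F,s,1,e]] : sym F s e = cls F ℍ[F,s,1,e] := by simp [sym, he]

variable {A : Type} [Ring A] [Algebra F A] [Algebra.IsCentral F A] [IsSimpleRing A]
  [FiniteDimensional F A]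

theorem cls_eq_sym {s e : F} (he : e ≠ 0) (i j : A) (hi : i * i = i + algebraMap F A s)
    (hj : j * j = algebraMap F A e) (hij : j * i = i * j + j) (hA : Module.finrank F A = 4) :
    cls F A = sym F s e := by
  have := isCentral_sym s he
  have := isSimpleRing_sym s he
  rw [sym_eq_cls s he]
  exact (cls_congr (algEquivOfFinrank (symHom s e i j hi hj hij)
    (by rw [hA, QuaternionAlgebra.finrank_eq_four]))).symm

theorem cls_eq_sym_add_sym {s e s' e' : F} (he : e ≠ 0) (he' : e' ≠ 0) (i j i' j' : A)
    (hi : i * i = i + algebraMap F A s) (hj : j * j = algebraMap F A e) (hij : j * i = i * j + j)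
    (hi' : i' * i' = i' + algebraMap F A s') (hj' : j' * j' = algebraMap F A e')
    (hij' : j' * i' = i' * j' + j')
    (c1 : Commute i i') (c2 : Commute i j') (c3 : Commute j i') (c4 : Commute j j')
    (hA : Module.finrank F A = 16) :
    cls F A = sym F s e + sym F s' e' := by
  have := isCentral_sym s he
  have := isSimpleRing_sym s he
  have := isCentral_sym s' he'
  have := isSimpleRing_sym s' he'
  rw [sym_eq_cls s he, sym_eq_cls s' he', ← cls_tensor]
  refine (cls_congr (algEquivOfFinrank (Algebra.TensorProduct.lift (symHom s e i j hi hj hij)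
    (symHom s' e' i' j' hi' hj' hij') fun x y => ?_)
    (by rw [hA, Module.finrank_tensorProduct, QuaternionAlgebra.finrank_eq_four,
      QuaternionAlgebra.finrank_eq_four]))).symm
  have hx : symHom s e i j hi hj hij x = x.re • 1 + x.imI • i + x.imJ • j + x.imK • (i * j) := by
    simp [symHom, QuaternionAlgebra.Basis.liftHom, QuaternionAlgebra.Basis.lift,
      Algebra.algebraMap_eq_smul_one]
  have hy : symHom s' e' i' j' hi' hj' hij' y =
      y.re • 1 + y.imI • i' + y.imJ • j' + y.imK • (i' * j') := by
    simp [symHom, QuaternionAlgebra.Basis.liftHom, QuaternionAlgebra.Basis.lift,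
      Algebra.algebraMap_eq_smul_one]
  rw [hx, hy]
  have c5 : ∀ z, Commute i z → Commute j z → Commute
      (x.re • 1 + x.imI • i + x.imJ • j + x.imK • (i * j)) z := fun z h h' =>
    (((((Commute.one_left z).smul_left _).add_left (h.smul_left _)).add_left
      (h'.smul_left _)).add_left ((h.mul_left h').smul_left _))
  exact ((((Commute.one_right _).smul_right _).add_right ((c5 _ c1 c3).smul_right _)).add_right
    ((c5 _ c2 c4).smul_right _)).add_right (((c5 _ c1 c3).mul_right (c5 _ c2 c4)).smul_right _)

theorem sym_norm (s x y : F) : sym F s (x ^ 2 + x * y + s * y ^ 2) = 0 := by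
  by_cases he : x ^ 2 + x * y + s * y ^ 2 = 0
  · rw [he, sym_zero_right]
  rw [← cls_eq_sym (A := Matrix (Fin 2) (Fin 2) F) he !![0, s; 1, 1]
    (!![x, y * s; y, x + y] * !![1, 1; 0, 1])]
  · rw [cls_matrix F F 2, cls_self]
  · ext i j; fin_cases i <;> fin_cases j <;>
      simp [Matrix.mul_apply, Fin.sum_univ_two, Matrix.algebraMap_matrix_apply]
    ring
  · have h2 : (2 : F) = 0 := CharTwo.two_eq_zero
    ext i j; fin_cases i <;> fin_cases j <;>
      simp [Matrix.mul_apply, Fin.sum_univ_two, Matrix.algebraMap_matrix_apply] <;> grind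
  · have h2 : (2 : F) = 0 := CharTwo.two_eq_zero
    ext i j; fin_cases i <;> fin_cases j <;>
      simp [Matrix.mul_apply, Fin.sum_univ_two] <;> grind
  · simp [Module.finrank_matrix]

theorem sym_one_right (s : F) : sym F s 1 = 0 := by
  simpa using sym_norm s 1 0
theorem sym_sq_right (s x : F) : sym F s (x ^ 2) = 0 := by
  simpa using sym_norm s x 0
theorem sym_self (s : F) : sym F s s = 0 := by
  simpa using sym_norm s 0 1
theorem sym_artinSchreier (x b : F) : sym F (x ^ 2 + x) b = 0 := by
  have h2 : (2 : F) = 0 := CharTwo.two_eq_zero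
  convert sym_norm (x ^ 2 + x) (1 + x * (1 + b)) (1 + b) using 2
  grind
theorem sym_zero_left (b : F) : sym F 0 b = 0 := by
  simpa using sym_artinSchreier (0 : F) b

end Sym
end CharTwoBrauer

namespace CharTwoBrauer
open Quaternion

section Relations
variable {F : Type} [Field F] [CharP F 2]

/-- Generators of a biquaternion algebra, with all the relations between them. -/
structure BiGens (F : Type*) {A : Type*} [Field F] [Ring A] [Algebra F A] (s e s' e' : F)
    (i j i' j' : A) : Prop where
  hi : i * i = i + algebraMap F A s
  hj : j * j = algebraMap F A e
  hij : j * i = i * j + j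
  hi' : i' * i' = i' + algebraMap F A s'
  hj' : j' * j' = algebraMap F A e'
  hij' : j' * i' = i' * j' + j'
  cii : i' * i = i * i'
  cij : j' * i = i * j'
  cji : i' * j = j * i'
  cjj : j' * j = j * j'

theorem exists_biGens (s s' : F) {e e' : F} (he : e ≠ 0) (he' : e' ≠ 0) :
    ∃ (A : Type) (_ : Ring A) (_ : Algebra F A) (_ : Algebra.IsCentral F A) (_ : IsSimpleRing A)
      (_ : FiniteDimensional F A) (i j i' j' : A), BiGens F s e s' e' i j i' j' ∧
      Module.finrank F A = 16 ∧ cls F A = sym F s e + sym F s' e' := by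
  have := isCentral_sym s he
  have := isSimpleRing_sym s he
  have := isCentral_sym s' he'
  have := isSimpleRing_sym s' he'
  refine ⟨ℍ[F,s,1,e] ⊗[F] ℍ[F,s',1,e'], inferInstance, inferInstance, inferInstance,
    inferInstance, inferInstance, symI s e ⊗ₜ 1, symJ s e ⊗ₜ 1, 1 ⊗ₜ symI s' e', 1 ⊗ₜ symJ s' e',
    ?_, ?_, ?_⟩
  · constructor <;> simp [symI_mul_self, symJ_mul_self, symJ_mul_symI, TensorProduct.tmul_add,
      TensorProduct.add_tmul, Algebra.algebraMap_eq_smul_one, ← TensorProduct.smul_tmul',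
      Algebra.TensorProduct.one_def]
  · simp [Module.finrank_tensorProduct, QuaternionAlgebra.finrank_eq_four]
  · rw [sym_eq_cls s he, sym_eq_cls s' he', ← cls_tensor]

/-- Left multiplication form of a product identity. -/
theorem mul_left_of {A : Type*} [Ring A] {a b c : A} (h : a * b = c) (x : A) :
    a * (b * x) = c * x := by rw [← mul_assoc, h]

theorem sym_add_left (a a' b : F) : sym F a b + sym F a' b = sym F (a + a') b := by
  by_cases hb : b = 0
  · simp [hb, sym_zero_right]
  obtain ⟨A, _, _, _, _, _, i, j, i', j', ⟨hi, hj, hij, hi', hj', hij', cii, cij, cji, cjj⟩, hA,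
    h⟩ := exists_biGens a a' hb hb
  have h0 : ∀ x : A, x + x = 0 := fun x => add_self_eq_zero_of_module F x
  have h2 : (2 : A) = 0 := by rw [← one_add_one_eq_two, h0]
  have cb : ∀ x : A, x * algebraMap F A b = algebraMap F A b * x :=
    fun x => (Algebra.commutes b x).symm
  rw [← h, cls_eq_sym_add_sym hb (mul_ne_zero hb hb) (i + i') j i' (j * j') (s := a + a')
    (s' := a'), ← sq, sym_sq_right, add_zero] <;>
  simp only [Commute, SemiconjBy, mul_add, add_mul, mul_assoc, hi, hj, hij, hi', hj', hij', cii,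
    cij, cji, cjj, mul_left_of cjj, mul_left_of hj, mul_left_of hij, mul_left_of cji,
    map_add, map_mul, hA, mul_left_of hij', cb, mul_left_of (cb j)] <;>
  (try abel_nf) <;> (try simp [two_nsmul, h0, h2])

theorem sym_mul_right (a : F) {b b' : F} (hb : b ≠ 0) (hb' : b' ≠ 0) :
    sym F a b + sym F a b' = sym F a (b * b') := by
  obtain ⟨A, _, _, _, _, _, i, j, i', j', ⟨hi, hj, hij, hi', hj', hij', cii, cij, cji, cjj⟩, hA,
    h⟩ := exists_biGens a a hb hb'
  have h0 : ∀ x : A, x + x = 0 := fun x => add_self_eq_zero_of_module F x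
  have h2 : (2 : A) = 0 := by rw [← one_add_one_eq_two, h0]
  have cb : ∀ x : A, x * algebraMap F A b' = algebraMap F A b' * x :=
    fun x => (Algebra.commutes b' x).symm
  have hcc : algebraMap F A b * algebraMap F A b' = algebraMap F A b' * algebraMap F A b := cb _
  rw [← h, cls_eq_sym_add_sym (mul_ne_zero hb hb') hb' i (j * j') (i + i') j' (s := a)
    (s' := 0), sym_zero_left, add_zero] <;>
  simp only [Commute, SemiconjBy, mul_add, add_mul, mul_assoc, hi, hj, hij, hi', hj', hij', cii,
    cij, cji, cjj, mul_left_of cjj, mul_left_of hj, mul_left_of hij, mul_left_of cji, map_zero,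
    map_add, map_mul, hA, mul_left_of hij', cb, mul_left_of (cb j), mul_left_of hij'] <;>
  (try abel_nf) <;> (try simp [two_nsmul, h0, h2])

theorem sym_add_self (a b : F) : sym F a b + sym F a b = 0 := by
  rw [sym_add_left, CharTwo.add_self_eq_zero, sym_zero_left]

theorem sym_neg (a b : F) : -sym F a b = sym F a b :=
  neg_eq_of_add_eq_zero_left (sym_add_self a b)

theorem sym_mul_sq (a b : F) {c : F} (hc : c ≠ 0) : sym F a (b * c ^ 2) = sym F a b := by
  by_cases hb : b = 0
  · simp [hb]
  rw [← sym_mul_right a hb (pow_ne_zero 2 hc), sym_sq_right, add_zero]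

theorem sym_add_artinSchreier (a b x : F) : sym F (a + (x ^ 2 + x)) b = sym F a b := by
  rw [← sym_add_left, sym_artinSchreier, add_zero]

theorem sym_mul_norm (s e x y : F) (h : x ^ 2 + x * y + s * y ^ 2 ≠ 0) :
    sym F s (e * (x ^ 2 + x * y + s * y ^ 2)) = sym F s e := by
  by_cases he : e = 0
  · simp [he]
  rw [← sym_mul_right s he h, sym_norm, add_zero]

/-- Symmetry: `[x, y) = [x, z)` when `yz = x`. -/
theorem sym_mul_self (s e : F) : sym F (s * e) e = sym F (s * e) s := by
  by_cases hs : s = 0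
  · simp [hs, sym_zero_left, sym_zero_right]
  by_cases he : e = 0
  · simp [he, sym_zero_left, sym_zero_right]
  have := sym_mul_right (s * e) hs he
  rw [sym_self] at this
  rw [eq_neg_of_add_eq_zero_right this, sym_neg]

theorem sym_add_arg (s e f : F) :
    sym F (s * (e + f)) (e + f) = sym F (s * e) e + sym F (s * f) f := by
  rw [sym_mul_self, sym_mul_self, sym_mul_self, sym_add_left, mul_add]

theorem sym_mul_arg (s e f : F) :
    sym F (s * (e * f)) (e * f) = sym F (s * f * e) e + sym F (s * e * f) f := by
  by_cases he : e = 0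
  · simp [he, sym_zero_left, sym_zero_right]
  by_cases hf : f = 0
  · simp [hf, sym_zero_left, sym_zero_right]
  rw [← sym_mul_right _ he hf]
  congr 2 <;> ring

end Relations

section NormCriterion
variable {F : Type} [Field F] [CharP F 2]

theorem exists_artinSchreier_of_isotropic {s x y : F} (h : x ^ 2 + x * y + s * y ^ 2 = 0)
    (hxy : x ≠ 0 ∨ y ≠ 0) : ∃ t, s = t ^ 2 + t := by
  have h2 : (2 : F) = 0 := CharTwo.two_eq_zero
  have hy : y ≠ 0 := by
    rintro rfl
    simp at h
    simp [h] at hxy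
  refine ⟨x / y, ?_⟩
  field_simp
  grind

theorem exists_norm_of_artinSchreier (t b : F) :
    ∃ x y, b = x ^ 2 + x * y + (t ^ 2 + t) * y ^ 2 := by
  have h2 : (2 : F) = 0 := CharTwo.two_eq_zero
  exact ⟨1 + t * (1 + b), 1 + b, by grind⟩

/-- The conjugation of a symbol algebra. -/
def symConj {s e : F} (q : ℍ[F,s,1,e]) : ℍ[F,s,1,e] := ⟨q.re + q.imI, q.imI, q.imJ, q.imK⟩

theorem symConj_mul_self {s e : F} (q : ℍ[F,s,1,e]) : symConj q * q = algebraMap F _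
    ((q.re ^ 2 + q.re * q.imI + s * q.imI ^ 2) +
      e * (q.imJ ^ 2 + q.imJ * q.imK + s * q.imK ^ 2)) := by
  have h2 : (2 : F) = 0 := CharTwo.two_eq_zero
  ext <;> simp [symConj, QuaternionAlgebra.algebraMap_eq] <;> grind

theorem exists_norm_of_sym_eq_zero {s e : F} (he : e ≠ 0) (h : sym F s e = 0) :
    ∃ x y, e = x ^ 2 + x * y + s * y ^ 2 := by
  have h2 : (2 : F) = 0 := CharTwo.two_eq_zero
  have := isCentral_sym s he
  have := isSimpleRing_sym s he
  rw [sym_eq_cls s he] at h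
  by_contra hcon
  have hs : ∀ x y : F, x ^ 2 + x * y + s * y ^ 2 = 0 → x = 0 ∧ y = 0 := by
    intro x y hxy
    by_contra h'
    obtain ⟨t, rfl⟩ := exists_artinSchreier_of_isotropic hxy (by tauto)
    exact hcon (exists_norm_of_artinSchreier t e)
  have hq : ∀ q : ℍ[F,s,1,e], symConj q * q = 0 → q = 0 := by
    intro q hq
    rw [symConj_mul_self, FaithfulSMul.algebraMap_eq_zero_iff] at hq
    by_cases hm : q.imJ ^ 2 + q.imJ * q.imK + s * q.imK ^ 2 = 0
    · rw [hm, mul_zero, add_zero] at hq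
      exact QuaternionAlgebra.ext (hs _ _ hq).1 (hs _ _ hq).2 (hs _ _ hm).1 (hs _ _ hm).2
    · exfalso
      apply hcon
      generalize q.re = x at *
      generalize q.imI = y at *
      generalize q.imJ = z at *
      generalize q.imK = w at *
      set m := z ^ 2 + z * w + s * w ^ 2 with hmdef
      refine ⟨(x * z + x * w + s * y * w) / m, (x * w + y * z) / m, ?_⟩
      have : e * m = x ^ 2 + x * y + s * y ^ 2 := by grind
      field_simp
      have h3 : e * m ^ 2 = (x ^ 2 + x * y + s * y ^ 2) * m := by rw [← this]; ring
      rw [h3, hmdef]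
      grind
  have : NoZeroDivisors ℍ[F,s,1,e] := ⟨fun {a b} hab => by
    by_contra! hne
    have h1 : symConj a * a * b = 0 := by rw [mul_assoc, hab, mul_zero]
    have h3 : symConj a * a ≠ 0 := fun h0 => hne.1 (hq a h0)
    rw [symConj_mul_self] at h1 h3
    rw [← Algebra.smul_def, smul_eq_zero] at h1
    rcases h1 with h1 | h1
    · rw [h1, map_zero] at h3; exact h3 rfl
    · exact hne.2 h1⟩
  have := finrank_eq_one_of_cls_eq_zero F _ h
  rw [QuaternionAlgebra.finrank_eq_four] at this
  omega

end NormCriterion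
end CharTwoBrauer

namespace CharTwoBrauer
open Quaternion

section QuadSep

/-- `K / F` is a quadratic extension generated by a root `θ` of `X² + X + a`. -/
structure IsQuadSep (F : Type*) {K : Type*} [Field F] [Field K] [Algebra F K] (a : F) (θ : K) :
    Prop where
  mul_self : θ * θ = θ + algebraMap F K a
  finrank_eq : Module.finrank F K = 2
  notMem : θ ∉ (algebraMap F K).range

namespace IsQuadSep
variable {F K : Type*} [Field F] [Field K] [Algebra F K] {a : F} {θ : K}

theorem finiteDimensional (h : IsQuadSep F a θ) : FiniteDimensional F K :=
  Module.finite_of_finrank_pos (by rw [h.finrank_eq]; norm_num)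

theorem eq_zero_of_add (h : IsQuadSep F a θ) {x y : F} (hxy : algebraMap F K x + algebraMap F K y * θ = 0) :
    x = 0 ∧ y = 0 := by
  have hy : y = 0 := by
    by_contra hy
    refine h.notMem ⟨-x / y, ?_⟩
    have : algebraMap F K y ≠ 0 := by simpa using hy
    rw [map_div₀, map_neg, div_eq_iff this]
    linear_combination -hxy
  subst hy
  simpa using hxy

/-- The map from the quadratic algebra to `K`. -/
noncomputable def hom (h : IsQuadSep F a θ) : QuadraticAlgebra F a 1 →ₐ[F] K :=
  QuadraticAlgebra.lift ⟨θ, by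
    rw [h.mul_self, one_smul, Algebra.algebraMap_eq_smul_one, add_comm]⟩

theorem hom_apply (h : IsQuadSep F a θ) (z : QuadraticAlgebra F a 1) :
    h.hom z = algebraMap F K z.re + algebraMap F K z.im * θ := by
  simp [hom, Algebra.algebraMap_eq_smul_one]

theorem hom_bijective (h : IsQuadSep F a θ) : Function.Bijective h.hom := by
  have := h.finiteDimensional
  have hinj : Function.Injective h.hom := by
    rw [injective_iff_map_eq_zero]
    intro z hz
    rw [hom_apply] at hz
    exact QuadraticAlgebra.ext (h.eq_zero_of_add hz).1 (h.eq_zero_of_add hz).2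
  have hfr : Module.finrank F (QuadraticAlgebra F a 1) = Module.finrank F K := by
    rw [QuadraticAlgebra.finrank_eq_two, h.finrank_eq]
  exact ⟨hinj, (LinearMap.injective_iff_surjective_of_finrank_eq_finrank hfr
    (f := h.hom.toLinearMap)).mp hinj⟩

/-- The quadratic algebra presentation of `K`. -/
noncomputable def equiv (h : IsQuadSep F a θ) : QuadraticAlgebra F a 1 ≃ₐ[F] K :=
  AlgEquiv.ofBijective h.hom h.hom_bijective

theorem equiv_apply (h : IsQuadSep F a θ) (z : QuadraticAlgebra F a 1) :
    h.equiv z = algebraMap F K z.re + algebraMap F K z.im * θ := h.hom_apply z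

theorem exists_eq (h : IsQuadSep F a θ) (z : K) : ∃ x y : F, z = algebraMap F K x + algebraMap F K y * θ := by
  obtain ⟨w, rfl⟩ := h.equiv.surjective z
  exact ⟨w.re, w.im, h.equiv_apply w⟩

/-- Homomorphisms out of `K` are determined by the image of `θ`. -/
theorem exists_algHom (h : IsQuadSep F a θ) {A : Type*} [Ring A] [Algebra F A] (u : A)
    (hu : u * u = u + algebraMap F A a) : ∃ f : K →ₐ[F] A, f θ = u := by
  refine ⟨(QuadraticAlgebra.lift ⟨u, by
    rw [hu, one_smul, Algebra.algebraMap_eq_smul_one, add_comm]⟩ : QuadraticAlgebra F a 1 →ₐ[F] A).comp h.equiv.symm.toAlgHom, ?_⟩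
  have : h.equiv.symm θ = ⟨0, 1⟩ := by rw [AlgEquiv.symm_apply_eq, equiv_apply]; simp
  simp [this]

end IsQuadSep
end QuadSep

section Res
variable {F K : Type} [Field F] [CharP F 2] [Field K] [CharP K 2] [Algebra F K]

theorem res_sym (s e : F) : res F K (sym F s e) = sym K (algebraMap F K s) (algebraMap F K e) := by
  by_cases he : e = 0
  · simp [he, sym_zero_right]
  have := isCentral_sym s he
  have := isSimpleRing_sym s he
  rw [sym_eq_cls s he, res_cls]
  have hmap : ∀ c : F, algebraMap K (K ⊗[F] ℍ[F,s,1,e]) (algebraMap F K c) =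
      1 ⊗ₜ algebraMap F _ c := fun c => by
    change algebraMap F K c ⊗ₜ 1 = _
    rw [Algebra.algebraMap_eq_smul_one,
      Algebra.algebraMap_eq_smul_one (A := ℍ[F,s,1,e]), TensorProduct.smul_tmul]
  refine cls_eq_sym (by simpa using he) (1 ⊗ₜ symI s e) (1 ⊗ₜ symJ s e) ?_ ?_ ?_ ?_
  · rw [hmap, Algebra.TensorProduct.tmul_mul_tmul, symI_mul_self, TensorProduct.tmul_add, one_mul]
  · rw [hmap, Algebra.TensorProduct.tmul_mul_tmul, symJ_mul_self, one_mul]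
  · rw [Algebra.TensorProduct.tmul_mul_tmul, symJ_mul_symI, TensorProduct.tmul_add, one_mul,
      Algebra.TensorProduct.tmul_mul_tmul, one_mul]
  · rw [Module.finrank_baseChange, QuaternionAlgebra.finrank_eq_four]
end Res

section Kernel
variable {F K : Type} [Field F] [CharP F 2] [Field K] [Algebra F K]

theorem exists_four_dim_of_res_eq_zero (hK : Module.finrank F K = 2) {x : Br F}
    (hx : res F K x = 0) :
    ∃ (A : Type) (_ : Ring A) (_ : Algebra F A) (_ : Algebra.IsCentral F A) (_ : IsSimpleRing A)
      (_ : FiniteDimensional F A), cls F A = x ∧ Nonempty (K →ₐ[F] A) ∧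
      Module.finrank F A = 4 := by
  have : FiniteDimensional F K := Module.finite_of_finrank_pos (by rw [hK]; norm_num)
  obtain ⟨S, _, _, _, _, _, rfl⟩ := x.exists_rep
  obtain ⟨A, i1, i2, i3, i4, i5, h, h', hd⟩ := exists_embedding_of_res_eq (K := K) (B := K)
    (hx.trans (cls_self K).symm)
  exact ⟨A, i1, i2, i3, i4, i5, h, h', by rw [hd, hK]; simp⟩

/-- A four-dimensional algebra containing `K` is `K + K y` once `y` satisfies an independence
condition. -/
theorem exists_add_mul_eq {A : Type} [Ring A] [Algebra F A] [FiniteDimensional F A]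
    (hK : Module.finrank F K = 2) (hA : Module.finrank F A = 4) (φ : K →ₐ[F] A) (y : A)
    (hy : ∀ a b : K, φ a + φ b * y = 0 → b = 0) (x : A) : ∃ a b : K, x = φ a + φ b * y := by
  have : FiniteDimensional F K := Module.finite_of_finrank_pos (by rw [hK]; norm_num)
  have : Nontrivial A := Module.nontrivial_of_finrank_pos (R := F) (by rw [hA]; norm_num)
  let T : K × K →ₗ[F] A := LinearMap.coprod φ.toLinearMap
    ((LinearMap.mulRight F y).comp φ.toLinearMap)
  have hT : Function.Injective T := by
    rw [injective_iff_map_eq_zero]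
    rintro ⟨a, b⟩ hab
    have h0 : φ a + φ b * y = 0 := by simpa [T] using hab
    have hb := hy a b h0
    subst hb
    have : φ a = 0 := by simpa using h0
    simpa using this
  have hs := (LinearMap.injective_iff_surjective_of_finrank_eq_finrank (f := T) (by
    rw [Module.finrank_prod, hK, hA])).mp hT
  obtain ⟨⟨a, b⟩, rfl⟩ := hs x
  exact ⟨a, b, by simp [T]⟩

theorem exists_eq_sym_of_res_eq_zero_sep {a : F} {θ : K} (h : IsQuadSep F a θ) {x : Br F}
    (hx : res F K x = 0) : ∃ c, c ≠ 0 ∧ x = sym F a c := by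
  obtain ⟨A, _, _, _, _, _, rfl, ⟨φ⟩, hA⟩ := exists_four_dim_of_res_eq_zero h.finrank_eq hx
  have h0 : ∀ x : A, x + x = 0 := fun x => add_self_eq_zero_of_module F x
  have := h.finiteDimensional
  have hi : φ θ * φ θ = φ θ + algebraMap F A a := by
    rw [← map_mul, h.mul_self, map_add, AlgHom.commutes]
  obtain ⟨ψ, hψ⟩ := h.exists_algHom (φ θ + 1) (by
    have : φ θ * φ θ + φ θ + (φ θ + 1) = φ θ * φ θ + (φ θ + φ θ) + 1 := by abel
    rw [mul_add, add_mul, one_mul, mul_one, this, h0, hi]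
    abel)
  obtain ⟨u, hu⟩ := skolemNoether φ ψ
  have hui : (u : A) * φ θ = φ θ * u + u := by
    have := hu θ
    rw [hψ] at this
    rw [← add_one_mul, this, mul_assoc, Units.inv_mul, mul_one]
  have hcom : ∀ b : K, φ θ * φ b = φ b * φ θ := fun b => by rw [← map_mul, mul_comm, map_mul]
  have hdec := exists_add_mul_eq h.finrank_eq hA φ u (by
    intro a b hab
    have h1 : φ θ * (φ a + φ b * u) + (φ a + φ b * u) * φ θ = φ b * u := by
      rw [mul_add, add_mul, mul_assoc (φ b), hui, hcom, ← mul_assoc, hcom, mul_add, mul_assoc]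
      have : φ a * φ θ + φ b * (φ θ * u) + (φ a * φ θ + (φ b * (φ θ * u) + φ b * u)) =
        (φ a * φ θ + φ a * φ θ) + (φ b * (φ θ * u) + φ b * (φ θ * u)) + φ b * u := by abel
      rw [this, h0, h0, zero_add, zero_add]
    rw [hab, mul_zero, zero_mul, add_zero] at h1
    have : φ b = 0 := by
      rw [← mul_one (φ b), ← Units.mul_inv u, ← mul_assoc, ← h1, zero_mul]
    simpa using this)
  have huu : (u * u : A) ∈ Subalgebra.center F A := by
    rw [Subalgebra.mem_center_iff]
    have h1 : Commute (u * u : A) (φ θ) := by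
      change (u * u : A) * φ θ = φ θ * (u * u)
      rw [mul_assoc, hui, mul_add, ← mul_assoc, hui, add_mul, add_assoc, h0, add_zero, mul_assoc]
    have h2 : ∀ b : K, Commute (u * u : A) (φ b) := by
      intro b
      obtain ⟨x, y, rfl⟩ := h.exists_eq b
      rw [map_add, map_mul, AlgHom.commutes, AlgHom.commutes]
      exact (Algebra.commute_algebraMap_right _ _).add_right
        ((Algebra.commute_algebraMap_right _ _).mul_right h1)
    intro z
    obtain ⟨a, b, rfl⟩ := hdec z
    exact ((h2 a).add_right ((h2 b).mul_right
      ((Commute.refl (u : A)).mul_left (Commute.refl (u : A))))).symm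
  rw [Algebra.IsCentral.center_eq_bot] at huu
  obtain ⟨c, hc⟩ := Algebra.mem_bot.mp huu
  have hc0 : c ≠ 0 := by
    rintro rfl
    rw [map_zero] at hc
    exact (u * u).ne_zero (by simpa using hc.symm)
  exact ⟨c, hc0, cls_eq_sym hc0 (φ θ) u hi hc.symm hui hA⟩

theorem exists_eq_sym_of_res_eq_zero_insep {e : F} {r : K} (hK : Module.finrank F K = 2)
    (hr : r * r = algebraMap F K e) (hnot : r ∉ (algebraMap F K).range) {x : Br F}
    (hx : res F K x = 0) : ∃ s, x = sym F s e := by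
  obtain ⟨A, _, _, _, _, _, rfl, ⟨φ⟩, hA⟩ := exists_four_dim_of_res_eq_zero hK hx
  have h0 : ∀ x : A, x + x = 0 := fun x => add_self_eq_zero_of_module F x
  have he : e ≠ 0 := by
    rintro rfl
    rw [map_zero, mul_self_eq_zero] at hr
    exact hnot ⟨0, by rw [hr, map_zero]⟩
  have hj : φ r * φ r = algebraMap F A e := by rw [← map_mul, hr, AlgHom.commutes]
  have hcom : ∀ b : K, φ r * φ b = φ b * φ r := fun b => by rw [← map_mul, mul_comm, map_mul]
  obtain ⟨y, hy⟩ : ∃ y, φ r * y + y * φ r ≠ 0 := by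
    by_contra! hcon
    have : φ r ∈ Subalgebra.center F A := by
      rw [Subalgebra.mem_center_iff]
      exact fun b => (eq_of_add_eq_zero_of_module F (hcon b)).symm
    rw [Algebra.IsCentral.center_eq_bot] at this
    obtain ⟨c, hc⟩ := Algebra.mem_bot.mp this
    exact hnot ⟨c, φ.injective ((φ.commutes c).trans hc)⟩
  have hd : ∀ (w : A) (a b : K), φ r * (φ a + φ b * w) + (φ a + φ b * w) * φ r =
      φ b * (φ r * w + w * φ r) := by
    intro w a b
    rw [mul_add, add_mul, ← mul_assoc, hcom, hcom, mul_add]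
    have : φ a * φ r + φ b * φ r * w + (φ a * φ r + φ b * w * φ r) =
      (φ a * φ r + φ a * φ r) + (φ b * φ r * w + φ b * w * φ r) := by abel
    rw [this, h0, zero_add, mul_assoc, mul_assoc]
  have hunit : ∀ (w : A) (b : K), w ≠ 0 → φ b * w = 0 → b = 0 := by
    intro w b hw hb
    by_contra hb0
    apply hw
    rw [← one_mul w, ← map_one φ, ← inv_mul_cancel₀ hb0, map_mul, mul_assoc, hb, mul_zero]
  have hdec : ∀ w : A, φ r * w + w * φ r ≠ 0 → ∀ z : A, ∃ a b : K, z = φ a + φ b * w :=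
    fun w hw => exists_add_mul_eq hK hA φ w fun a b hab => hunit _ b hw (by
      rw [← hd w a b, hab, mul_zero, zero_mul, add_zero])
  obtain ⟨a, b, hab⟩ := hdec y hy (φ r * y + y * φ r)
  have hb : b = 0 := by
    refine hunit _ b hy ?_
    rw [← hd y a b, ← hab, mul_add, add_mul, ← mul_assoc, hj, mul_assoc, mul_assoc y, hj,
      ← Algebra.commutes, ← mul_assoc]
    have : algebraMap F A e * y + φ r * y * φ r + (φ r * y * φ r + algebraMap F A e * y) =
      (algebraMap F A e * y + algebraMap F A e * y) + (φ r * y * φ r + φ r * y * φ r) := by abel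
    rw [this, h0, h0, zero_add]
  subst hb
  rw [map_zero, zero_mul, add_zero] at hab
  have ha : a ≠ 0 := by rintro rfl; exact hy (by rw [hab, map_zero])
  set i := φ (r * a⁻¹) * y with hidef
  have hi : φ r * i + i * φ r = φ r := by
    have := hd y 0 (r * a⁻¹)
    rw [map_zero, zero_add, hab, ← map_mul, mul_assoc r, inv_mul_cancel₀ ha, mul_one] at this
    exact this
  have hr0 : φ r ≠ 0 := by
    intro h; rw [h, zero_mul] at hj
    exact he (by simpa using hj.symm)
  have hji : φ r * i = i * φ r + φ r := by
    have h1 : φ r * i = (φ r * i + i * φ r) + i * φ r := by rw [add_assoc, h0, add_zero]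
    rw [h1, hi, add_comm]
  have hcen : i * i + i ∈ Subalgebra.center F A := by
    rw [Subalgebra.mem_center_iff]
    have c1 : Commute (i * i + i) i := by
      change _ = _; rw [add_mul, mul_add, mul_assoc]
    have c2 : Commute (i * i + i) (φ r) := by
      change (i * i + i) * φ r = φ r * (i * i + i)
      rw [mul_add (φ r), ← mul_assoc (φ r), hji, add_mul, add_mul, mul_assoc i (φ r), hji, mul_add]
      have : i * (i * φ r) + i * φ r + (i * φ r + φ r) + (i * φ r + φ r) =
        i * (i * φ r) + i * φ r + (i * φ r + i * φ r) + (φ r + φ r) := by abel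
      rw [this, h0, h0, add_zero, add_zero, mul_assoc]
    have c3 : ∀ b : K, Commute (i * i + i) (φ b) := by
      intro b
      have : FiniteDimensional F K := Module.finite_of_finrank_pos (by rw [hK]; norm_num)
      have hspan : ∃ x y : F, b = algebraMap F K x + algebraMap F K y * r := by
        let T : F × F →ₗ[F] K := LinearMap.coprod (Algebra.linearMap F K)
          ((LinearMap.mulRight F r).comp (Algebra.linearMap F K))
        have hT : Function.Injective T := by
          rw [injective_iff_map_eq_zero]
          rintro ⟨x, y⟩ hxy
          have hxy' : algebraMap F K x + algebraMap F K y * r = 0 := by simpa [T] using hxy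
          have hy0 : y = 0 := by
            by_contra hy0
            refine hnot ⟨-x / y, ?_⟩
            have : algebraMap F K y ≠ 0 := by simpa using hy0
            rw [map_div₀, map_neg, div_eq_iff this]
            linear_combination -hxy'
          subst hy0
          simpa using hxy'
        have hs := (LinearMap.injective_iff_surjective_of_finrank_eq_finrank (f := T) (by
          rw [Module.finrank_prod, hK, Module.finrank_self])).mp hT
        obtain ⟨⟨x, y⟩, rfl⟩ := hs b
        exact ⟨x, y, by simp [T]⟩
      obtain ⟨x, y, rfl⟩ := hspan
      rw [map_add, map_mul, AlgHom.commutes, AlgHom.commutes]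
      exact (Algebra.commute_algebraMap_right _ _).add_right
        ((Algebra.commute_algebraMap_right _ _).mul_right c2)
    intro z
    obtain ⟨a, b, rfl⟩ := hdec i (by rw [hi]; exact hr0) z
    exact ((c3 a).add_right ((c3 b).mul_right c1)).symm
  rw [Algebra.IsCentral.center_eq_bot] at hcen
  obtain ⟨s, hs⟩ := Algebra.mem_bot.mp hcen
  refine ⟨s, cls_eq_sym he i (φ r) ?_ hj hji hA⟩
  rw [hs, add_comm, add_assoc, h0, add_zero]
end Kernel
end CharTwoBrauer

namespace CharTwoBrauer
open KaehlerDifferential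

section BMap
variable (F : Type) [Field F] [CharP F 2]

/-- The symbol map on formal sums of differentials. -/
noncomputable def bFree : (F →₀ F) →+ Br F :=
  Finsupp.liftAddHom fun e =>
    { toFun := fun s => sym F (s * e) e
      map_zero' := by simp [sym_zero_left]
      map_add' := fun s t => by rw [add_mul, sym_add_left] }

theorem bFree_single (e s : F) : bFree F (Finsupp.single e s) = sym F (s * e) e := by
  simp [bFree, Finsupp.sum_single_index, sym_zero_left]

theorem bFree_smul_eq_zero (x : F →₀ F) (hx : x ∈ kerTotal ℤ F) :
    ∀ r : F, bFree F (r • x) = 0 := by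
  unfold kerTotal at hx
  induction hx using Submodule.span_induction with
  | zero => simp
  | add x y _ _ hx hy => intro r; rw [smul_add, map_add, hx, hy, add_zero]
  | smul c x _ hx => intro r; rw [smul_smul, hx]
  | mem x h =>
    intro r
    rcases h with (⟨⟨x, y⟩, rfl⟩ | ⟨⟨x, y⟩, rfl⟩) | ⟨n, rfl⟩
    · simp only [smul_sub, smul_add, Finsupp.smul_single, map_sub, map_add, bFree_single,
        smul_eq_mul, mul_one]
      rw [sym_add_arg, sub_self]
    · simp only [smul_sub, smul_add, Finsupp.smul_single, map_sub, map_add, bFree_single,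
        smul_eq_mul, mul_one]
      rw [sym_mul_arg, add_comm, sub_self]
    · simp only [Finsupp.smul_single, bFree_single, smul_eq_mul, mul_one]
      have : (algebraMap ℤ F n) = 0 ∨ (algebraMap ℤ F n) = 1 := by
        rcases Int.even_or_odd' n with ⟨k, rfl | rfl⟩
        · left; simp [CharTwo.two_eq_zero]
        · right; simp [CharTwo.two_eq_zero]
      rcases this with h | h
      · rw [h, sym_zero_right]
      · rw [h, sym_one_right]

/-- The symbol map on the presentation of the module of differentials. -/
noncomputable def bQuot : ((F →₀ F) ⧸ kerTotal ℤ F) →+ Br F :=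
  QuotientAddGroup.lift (kerTotal ℤ F).toAddSubgroup (bFree F) (fun x hx => by
    simpa using bFree_smul_eq_zero F x hx 1)

/-- The symbol map `s • D e ↦ [s e, e)`. -/
noncomputable def bmap : Ω[F⁄ℤ] →+ Br F :=
  (bQuot F).comp (quotKerTotalEquiv ℤ F).symm.toLinearMap.toAddMonoidHom

variable {F}

theorem bmap_smul_D (s e : F) : bmap F (s • D ℤ F e) = sym F (s * e) e := by
  have : (quotKerTotalEquiv ℤ F).symm (s • D ℤ F e) =
      Submodule.Quotient.mk (Finsupp.single e s) := by
    rw [LinearEquiv.symm_apply_eq]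
    simp [quotKerTotalEquiv]
  change bQuot F ((quotKerTotalEquiv ℤ F).symm (s • D ℤ F e)) = _
  rw [this]
  exact bFree_single F e s

theorem bmap_D (e : F) : bmap F (D ℤ F e) = 0 := by
  rw [← one_smul F (D ℤ F e), bmap_smul_D, one_mul, sym_self]

theorem sym_eq_bmap (s : F) {e : F} (he : e ≠ 0) : sym F s e = bmap F ((s / e) • D ℤ F e) := by
  rw [bmap_smul_D, div_mul_cancel₀ _ he]

theorem bmap_artinSchreier (g e : F) : bmap F ((g ^ 2 * e + g) • D ℤ F e) = 0 := by
  rw [bmap_smul_D, ← sym_artinSchreier (g * e) e]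
  congr 1; ring

theorem omega_induction {R S : Type*} [CommRing R] [CommRing S] [Algebra R S]
    {P : Ω[S⁄R] → Prop} (zero : P 0)
    (add : ∀ x y, P x → P y → P (x + y)) (smul : ∀ s e : S, P (s • D R S e)) (ω) : P ω := by
  have h : ω ∈ Submodule.span S (Set.range (D R S)) := by
    rw [span_range_derivation]; trivial
  refine Submodule.closure_induction (p := fun x _ => P x) zero (fun x y _ _ => add x y) ?_ h
  rintro s _ ⟨e, rfl⟩
  exact smul s e

variable {K : Type} [Field K] [CharP K 2] [Algebra F K]

theorem res_bmap (ω : Ω[F⁄ℤ]) : res F K (bmap F ω) = bmap K (map ℤ ℤ F K ω) := by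
  induction ω using omega_induction with
  | zero => simp
  | add x y hx hy => simp [hx, hy]
  | smul s e => rw [bmap_smul_D, res_sym, map_smul, KaehlerDifferential.map_D,
      ← algebraMap_smul K s, bmap_smul_D, map_mul]

theorem omega_add_self (ω : Ω[F⁄ℤ]) : ω + ω = 0 := add_self_eq_zero_of_module F ω

theorem bmap_add_self (ω : Ω[F⁄ℤ]) : bmap F ω + bmap F ω = 0 := by
  rw [← map_add, omega_add_self, map_zero]

theorem D_sq (x : F) : D ℤ F (x ^ 2) = 0 := by
  rw [Derivation.leibniz_pow]
  simp only [Nat.add_one_sub_one, pow_one]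
  rw [two_nsmul, omega_add_self]

/-- Every class in the image of the symbol map, in terms of symbols. -/
theorem exists_finset_sum (ω : Ω[F⁄ℤ]) : ∃ (n : ℕ) (s e : Fin n → F),
    ω = ∑ i, s i • D ℤ F (e i) := by
  induction ω using omega_induction with
  | zero => exact ⟨0, 0, 0, by simp⟩
  | add x y hx hy =>
    obtain ⟨n, s, e, rfl⟩ := hx
    obtain ⟨m, t, f, rfl⟩ := hy
    exact ⟨n + m, Fin.append s t, Fin.append e f, by simp [Fin.sum_univ_add]⟩
  | smul s e => exact ⟨1, fun _ => s, fun _ => e, by simp⟩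

end BMap
end CharTwoBrauer

namespace CharTwoBrauer

section Swap
variable {F : Type} [Field F] [CharP F 2]

/-- An endomorphism generating a purely inseparable quadratic field is a commutator with itself. -/
theorem exists_commutator_of_not_square {V : Type*} [AddCommGroup V] [Module F V]
    (g : Module.End F V) {c : F} (hg : g * g = algebraMap F _ c) (hc : ¬ ∃ m, m * m = c) :
    ∃ y : Module.End F V, g * y + y * g = g := by
  classical
  let p : Polynomial F := Polynomial.X ^ 2 - Polynomial.C c
  have hp : Irreducible p := by
    refine Polynomial.irreducible_of_degree_le_three_of_not_isRoot ?_ ?_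
    · have : p.natDegree = 2 := by simp [p]
      rw [this]; simp
    · intro x hx
      refine hc ⟨x, ?_⟩
      simp only [p, Polynomial.IsRoot, Polynomial.eval_sub, Polynomial.eval_pow,
        Polynomial.eval_X, Polynomial.eval_C] at hx
      rw [← sq]; exact sub_eq_zero.1 hx
  have : Fact (Irreducible p) := ⟨hp⟩
  let φ : AdjoinRoot p →ₐ[F] Module.End F V :=
    Ideal.Quotient.liftₐ (Ideal.span {p}) (Polynomial.aeval g) (fun q hq => by
      obtain ⟨q, rfl⟩ := Ideal.mem_span_singleton.1 hq
      have : Polynomial.aeval g p = 0 := by simp [p, pow_two, hg]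
      rw [map_mul, this, zero_mul])
  let : Module (AdjoinRoot p) V := Module.compHom V φ.toRingHom
  have hsm : ∀ (l : AdjoinRoot p) (v : V), l • v = φ l v := fun _ _ => rfl
  have : IsScalarTower F (AdjoinRoot p) V := ⟨fun a l v => by simp [hsm]⟩
  have hr : φ (AdjoinRoot.root p) = g := Polynomial.aeval_X g
  have hgs : ∀ v : V, g v = AdjoinRoot.root p • v := fun v => by rw [hsm, hr]
  have hrr : AdjoinRoot.root p * AdjoinRoot.root p = algebraMap F _ c := by
    have := AdjoinRoot.eval₂_root p
    simp only [p, Polynomial.eval₂_sub, Polynomial.eval₂_pow, Polynomial.eval₂_X,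
      Polynomial.eval₂_C] at this
    rw [← sq]; exact sub_eq_zero.1 this
  have hm : p.Monic := Polynomial.monic_X_pow_sub_C c two_ne_zero
  let b := Module.Basis.ofVectorSpace (AdjoinRoot p) V
  let pb := AdjoinRoot.powerBasis' hm
  let bf : Module.Basis (Fin 2) F (AdjoinRoot p) := pb.basis.reindex (finCongr (by simp [pb, p]))
  have hb0 : bf 0 = 1 := by simp [bf, pb]
  have hb1 : bf 1 = AdjoinRoot.root p := by simp [bf, pb]
  let bb := bf.smulTower b
  let y : Module.End F V := bb.constr F fun i => if i.1 = 0 then 0 else bb i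
  have hbb : ∀ i, bb i = bf i.1 • b i.2 := fun i => Module.Basis.smulTower_apply bf b i
  have hy : ∀ i, y (bb i) = if i.1 = 0 then 0 else bb i := fun i => by simp [y]
  have hy0 : ∀ j, y (b j) = 0 := fun j => by simpa [hbb, hb0] using hy (0, j)
  have hy1 : ∀ j, y (AdjoinRoot.root p • b j) = AdjoinRoot.root p • b j := fun j => by
    simpa [hbb, hb1] using hy (1, j)
  refine ⟨y, bb.ext fun ⟨i, j⟩ => ?_⟩
  fin_cases i
  · simp [hbb, hb0, hgs, hy0, hy1]
  · have : AdjoinRoot.root p • AdjoinRoot.root p • b j = c • b j := by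
      rw [smul_smul, hrr, algebraMap_smul]
    simp [hbb, hb1, hgs, hy0, hy1, this]

theorem exists_pseudoinverse {V : Type*} [AddCommGroup V] [Module F V] (f : Module.End F V) :
    ∃ s : Module.End F V, f * s * f = f := by
  obtain ⟨t, ht⟩ := f.rangeRestrict.exists_rightInverse_of_surjective f.range_rangeRestrict
  obtain ⟨s, hs⟩ := LinearMap.exists_extend t
  refine ⟨s, LinearMap.ext fun v => ?_⟩
  have h1 : s (f v) = t (f.rangeRestrict v) := by rw [← hs]; rfl
  have h2 := congrArg Subtype.val (LinearMap.congr_fun ht (f.rangeRestrict v))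
  simpa [h1] using h2

theorem exists_pseudoinverse_sq_zero {R : Type*} [Ring R] [Algebra F R] {n s : R}
    (hn : n * n = 0) (hs : n * s * n = n) : ∃ t : R, n * t * n = n ∧ t * t = 0 := by
  have h1 : n * (s + n * s * s) = n * s := by
    rw [mul_add, ← mul_assoc, ← mul_assoc, hn]; simp
  have h2 : n * (s + n * s * s) * n = n := by rw [h1, hs]
  have h3 : n * (s + n * s * s) * ((s + n * s * s) * n) = 0 := by
    rw [h1, add_mul, mul_add]
    have : n * s * (n * s * s * n) = n * s * (s * n) := by
      rw [← mul_assoc, ← mul_assoc, ← mul_assoc, hs]; simp only [mul_assoc]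
    rw [this, add_self_eq_zero_of_module F]
  generalize s + n * s * s = t at *
  refine ⟨t * n * t, ?_, ?_⟩
  · rw [← mul_assoc, ← mul_assoc, h2, h2]
  · have : t * n * t * (t * n * t) = t * (n * t * (t * n)) * t := by simp only [mul_assoc]
    rw [this, h3]; simp

variable {A : Type} [Ring A] [Algebra F A]

theorem add_comm_ne_one [Nontrivial A] (y : A ⊗[F] A) :
    y + Algebra.TensorProduct.comm F A A y ≠ 1 := by
  intro h
  obtain ⟨f, hf⟩ : ∃ f : A →ₗ[F] F, f 1 = 1 := by
    obtain ⟨f, hf⟩ := LinearMap.exists_extend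
      (p := F ∙ (1 : A)) (LinearEquiv.toSpanNonzeroSingleton F A 1 one_ne_zero).symm.toLinearMap
    refine ⟨f, ?_⟩
    have := LinearMap.congr_fun hf ⟨1, Submodule.mem_span_singleton_self 1⟩
    simp only [LinearMap.comp_apply, Submodule.subtype_apply, LinearEquiv.coe_coe] at this
    rw [this, LinearEquiv.symm_apply_eq]
    ext; simp
  let ff : A ⊗[F] A →ₗ[F] F := LinearMap.mul' F F ∘ₗ TensorProduct.map f f
  have hs : ∀ y, ff (Algebra.TensorProduct.comm F A A y) = ff y := by
    intro y
    induction y with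
    | zero => simp
    | add x y hx hy => rw [map_add, map_add, hx, hy, map_add]
    | tmul a b => simp [ff, mul_comm]
  have := congrArg ff h
  rw [map_add, hs, CharTwo.add_self_eq_zero] at this
  simp [ff, Algebra.TensorProduct.one_def, hf] at this

theorem exists_symmetric_decomposition [FiniteDimensional F A] (y : A ⊗[F] A)
    (hy : Algebra.TensorProduct.comm F A A y = y) :
    ∃ (n : ℕ) (c : Fin n → F) (a : Fin n → A) (x : A ⊗[F] A),
      y = x + Algebra.TensorProduct.comm F A A x + ∑ i, c i • (a i ⊗ₜ a i) := by
  classical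
  let b := Module.finBasis F A
  let c (i j) := (b.tensorProduct b).repr y (i, j)
  have h0 : y = ∑ i, ∑ j, c i j • (b i ⊗ₜ[F] b j) := by
    conv_lhs => rw [← (b.tensorProduct b).sum_repr y, Fintype.sum_prod_type]
    simp [c]
  have h1 : Algebra.TensorProduct.comm F A A y = ∑ i, ∑ j, c j i • (b i ⊗ₜ[F] b j) := by
    rw [Finset.sum_comm]
    conv_lhs => rw [h0]
    simp
  have hc : ∀ i j, c i j = c j i := by
    intro i j
    have h2 : (b.tensorProduct b).repr (∑ i, ∑ j, c j i • (b i ⊗ₜ[F] b j)) (i, j) = c j i := by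
      have : (∑ i, ∑ j, c j i • (b i ⊗ₜ[F] b j)) =
          ∑ p, (fun p : Fin _ × Fin _ => c p.2 p.1) p • (b.tensorProduct b) p := by
        rw [Fintype.sum_prod_type]; simp
      rw [this, Module.Basis.repr_sum_self]
    rw [← h2, ← h1, hy]
  refine ⟨_, fun i => c i i, b, ∑ i, ∑ j, (if i < j then c i j else 0) • (b i ⊗ₜ[F] b j), ?_⟩
  have h3 : Algebra.TensorProduct.comm F A A
      (∑ i, ∑ j, (if i < j then c i j else 0) • (b i ⊗ₜ[F] b j)) =
      ∑ i, ∑ j, (if j < i then c i j else 0) • (b i ⊗ₜ[F] b j) := by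
    rw [Finset.sum_comm]
    refine (map_sum _ _ _).trans (Finset.sum_congr rfl fun i _ => (map_sum _ _ _).trans
      (Finset.sum_congr rfl fun j _ => ?_))
    rw [map_smul, Algebra.TensorProduct.comm_tmul, hc]
  have h4 : ∑ i, c i i • (b i ⊗ₜ[F] b i) =
      ∑ i, ∑ j, (if i = j then c i j else 0) • (b i ⊗ₜ[F] b j) := by
    simp [ite_smul]
  rw [h3, h4, ← Finset.sum_add_distrib, ← Finset.sum_add_distrib]
  conv_lhs => rw [h0]
  refine Finset.sum_congr rfl fun i _ => ?_
  rw [← Finset.sum_add_distrib, ← Finset.sum_add_distrib]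
  refine Finset.sum_congr rfl fun j _ => ?_
  rw [← add_smul, ← add_smul]
  congr 1
  rcases lt_trichotomy i j with h | h | h
  · simp [h, h.ne, h.not_gt]
  · simp [h]
  · simp [h, h.ne', h.not_gt]

end Swap
end CharTwoBrauer

namespace CharTwoBrauer

section Frob
variable {F : Type} [Field F] [CharP F 2] {A : Type} [Ring A] [Algebra F A]
  [Algebra.IsCentral F A] [IsSimpleRing A] [FiniteDimensional F A]

/-- The data extracted from a swap element `g = 1 + n` in `A ⊗ A`. -/
theorem exists_swap_idempotent {V : Type} [AddCommGroup V] [Module F V]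
    (e : A ⊗[F] A ≃ₐ[F] Module.End F V) :
    ∃ n r : A ⊗[F] A, r ≠ 0 ∧ r * r = r ∧ n * n = 0 ∧ n * r = 0 ∧ r * n = 0 ∧
      (∀ x, (1 + n) * x = Algebra.TensorProduct.comm F A A x * (1 + n)) ∧
      ∃ s, r = 1 + (n * s + s * n) := by
  obtain ⟨u, hu⟩ := skolemNoether (AlgHom.id F (A ⊗[F] A))
    (Algebra.TensorProduct.comm F A A : A ⊗[F] A →ₐ[F] A ⊗[F] A)
  have hu' : ∀ x, ↑u * x = Algebra.TensorProduct.comm F A A x * ↑u := fun x => by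
    have := hu x
    simp only [AlgHom.coe_id, id_eq, AlgEquiv.coe_toAlgHom] at this
    rw [this, mul_assoc, Units.inv_mul, mul_one]
  have hno : ∀ y : A ⊗[F] A, (u : A ⊗[F] A) * y + y * u ≠ u := by
    intro y hy
    have h1 : (Algebra.TensorProduct.comm F A A y + y) * (u : A ⊗[F] A) = 1 * u := by
      rw [add_mul, ← hu', hy, one_mul]
    have h2 := u.isUnit.mul_right_cancel h1
    rw [add_comm] at h2
    exact add_comm_ne_one y h2
  have hcomm : ∀ x, Algebra.TensorProduct.comm F A A (Algebra.TensorProduct.comm F A A x) = x := by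
    intro x
    exact (Algebra.TensorProduct.comm F A A).symm_apply_apply x
  obtain ⟨c, hc⟩ : ∃ c : F, (u : A ⊗[F] A) * u = algebraMap F _ c := by
    have : (u : A ⊗[F] A) * u ∈ Subalgebra.center F (A ⊗[F] A) := by
      rw [Subalgebra.mem_center_iff]
      intro x
      rw [mul_assoc (u : A ⊗[F] A) u x, hu' x, ← mul_assoc (u : A ⊗[F] A),
        hu' (Algebra.TensorProduct.comm F A A x), hcomm, mul_assoc]
    rw [Algebra.IsCentral.center_eq_bot, Algebra.mem_bot] at this
    obtain ⟨c, hc⟩ := this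
    exact ⟨c, hc.symm⟩
  have hsq : ∃ m, m * m = c := by
    by_contra hsq
    obtain ⟨y, hy⟩ := exists_commutator_of_not_square (e u) (c := c)
      (by rw [← map_mul, hc, AlgEquiv.commutes]) hsq
    refine hno (e.symm y) (e.injective ?_)
    simpa using hy
  obtain ⟨m, rfl⟩ := hsq
  have hm : m ≠ 0 := by
    rintro rfl
    have : IsUnit ((u : A ⊗[F] A) * u) := u.isUnit.mul u.isUnit
    rw [hc] at this
    simp at this
  set g : A ⊗[F] A := m⁻¹ • (u : A ⊗[F] A) with hgdef
  have hgg : g * g = 1 := by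
    rw [hgdef, smul_mul_smul_comm, hc, Algebra.algebraMap_eq_smul_one, smul_smul]
    rw [show m⁻¹ * m⁻¹ * (m * m) = 1 by field_simp, one_smul]
  have hg' : ∀ x, g * x = Algebra.TensorProduct.comm F A A x * g := fun x => by
    rw [hgdef, smul_mul_assoc, hu', mul_smul_comm]
  have hno' : ∀ y : A ⊗[F] A, g * y + y * g ≠ g := fun y hy => by
    refine hno y ?_
    have h1 : (u : A ⊗[F] A) = m • g := by rw [hgdef, smul_smul, mul_inv_cancel₀ hm, one_smul]
    rw [h1, smul_mul_assoc, mul_smul_comm, ← smul_add, hy]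
  clear_value g
  obtain ⟨n, rfl⟩ : ∃ n, g = 1 + n := ⟨1 + g, by
    rw [← add_assoc, add_self_eq_zero_of_module F, zero_add]⟩
  have h2 : ∀ x : A ⊗[F] A, x + x = 0 := add_self_eq_zero_of_module F
  have hnn : n * n = 0 := by
    have h3 : (1 + n) * (1 + n) = 1 + (n + n) + n * n := by noncomm_ring
    rw [h3, h2, add_zero] at hgg
    simpa using hgg
  obtain ⟨s, hs, hss⟩ : ∃ s : A ⊗[F] A, n * s * n = n ∧ s * s = 0 := by
    obtain ⟨s, hs⟩ := exists_pseudoinverse (e n)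
    refine exists_pseudoinverse_sq_zero (F := F) (s := e.symm s) hnn (e.injective ?_)
    simpa using hs
  have hns : n * (n * s) = 0 := by rw [← mul_assoc, hnn, zero_mul]
  have hsn : s * n * n = 0 := by rw [mul_assoc, hnn, mul_zero]
  have hs' : n * (s * n) = n := by rw [← mul_assoc, hs]
  have hq1 : n * (1 + (n * s + s * n)) = 0 := by
    rw [mul_add, mul_one, mul_add, hns, zero_add, ← mul_assoc, hs, h2]
  have hq2 : (1 + (n * s + s * n)) * n = 0 := by
    rw [add_mul, one_mul, add_mul, hsn, add_zero, hs, h2]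
  refine ⟨n, 1 + (n * s + s * n), ?_, ?_, hnn, hq1, hq2, hg', s, rfl⟩
  · intro h0
    have h1 : n * s + s * n = 1 := by
      have := eq_of_add_eq_zero_of_module F h0
      exact this.symm
    refine hno' (s + s * n) ?_
    have : (1 + n) * (s + s * n) + (s + s * n) * (1 + n) =
        (s + s) + (s * n + s * n) + (n * s + s * n) + n * s * n + s * n * n := by noncomm_ring
    rw [this, h2, h2, h1, hs, hsn]; simp
  · rw [mul_add, mul_one, mul_add, ← mul_assoc, ← mul_assoc, hq2, zero_mul, zero_add]
    have : (1 + (n * s + s * n)) * (s * n) = s * n + n * (s * s) * n + s * (n * (s * n)) := by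
      noncomm_ring
    rw [mul_assoc, this, hss, hs']
    simp [h2]

/-- If `2 [A] = 0`, then `A` maps to a matrix algebra along the Frobenius of `F`, with spanning
image. -/
theorem exists_frobenius_hom (h : cls F A + cls F A = 0) :
    ∃ (d : ℕ) (_ : d ≠ 0) (ψ : A →+* Matrix (Fin d) (Fin d) F),
      (∀ (c : F) a, ψ (c • a) = c ^ 2 • ψ a) ∧ Submodule.span F (Set.range ψ) = ⊤ := by
  rw [← cls_tensor, cls_eq_zero_iff] at h
  obtain ⟨N, hN, ⟨e0⟩⟩ := h
  let e : A ⊗[F] A ≃ₐ[F] Module.End F (Fin N → F) := e0.trans Matrix.toLinAlgEquiv'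
  obtain ⟨n, r, hr0, hrr, hnn, hnr, hrn, hsw, s, hs⟩ := exists_swap_idempotent e
  have h2 : ∀ x : A ⊗[F] A, x + x = 0 := add_self_eq_zero_of_module F
  have hkill : ∀ x, r * (x + Algebra.TensorProduct.comm F A A x) * r = 0 := by
    intro x
    have h1 : (1 + n) * r = r := by rw [add_mul, hnr, one_mul, add_zero]
    have h3 : r * (1 + n) = r := by rw [mul_add, hrn, mul_one, add_zero]
    have h4 : r * (Algebra.TensorProduct.comm F A A x) * r = r * x * r := by
      have h5 : r * (Algebra.TensorProduct.comm F A A x) * r =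
          r * (Algebra.TensorProduct.comm F A A x * (1 + n)) * r := by
        rw [mul_assoc, mul_assoc, mul_assoc, h1]
      rw [h5, ← hsw, ← mul_assoc, h3]
    rw [mul_add, add_mul, h4, h2]
  have hmul : ∀ a b : A, r * ((a * b) ⊗ₜ[F] (a * b)) * r =
      r * (a ⊗ₜ[F] a) * r * (r * (b ⊗ₜ[F] b) * r) := by
    intro a b
    have hc : ∀ a : A, n * (a ⊗ₜ[F] a) = (a ⊗ₜ[F] a) * n := by
      intro a
      have := hsw (a ⊗ₜ[F] a)
      rw [Algebra.TensorProduct.comm_tmul, add_mul, mul_add, one_mul, mul_one] at this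
      exact add_left_cancel this
    have h1 : r * (a ⊗ₜ[F] a) * r * (r * (b ⊗ₜ[F] b) * r) =
        r * (a ⊗ₜ[F] a) * (r * r) * (b ⊗ₜ[F] b) * r := by simp only [mul_assoc]
    have h3 : r * (a ⊗ₜ[F] a) * (1 + (n * s + s * n)) * (b ⊗ₜ[F] b) * r =
        r * (a ⊗ₜ[F] a * b ⊗ₜ[F] b) * r + r * ((a ⊗ₜ[F] a) * n) * (s * (b ⊗ₜ[F] b) * r) +
          r * (a ⊗ₜ[F] a) * s * (n * (b ⊗ₜ[F] b)) * r := by noncomm_ring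
    have h4 : r * ((a ⊗ₜ[F] a) * n) = 0 := by rw [← hc, ← mul_assoc, hrn, zero_mul]
    have h5 : r * (a ⊗ₜ[F] a) * s * (n * (b ⊗ₜ[F] b)) * r = 0 := by
      rw [hc, ← mul_assoc, mul_assoc _ n, hnr, mul_zero]
    rw [h1, hrr]
    rw [← hs, h4, h5, zero_mul, add_zero, add_zero, Algebra.TensorProduct.tmul_mul_tmul] at h3
    exact h3.symm
  let W : Submodule F (Fin N → F) := LinearMap.range (e r)
  have hrW : ∀ w : W, e r w = w := by
    rintro ⟨_, v, rfl⟩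
    rw [← Module.End.mul_apply, ← map_mul, hrr]
  let ρ : A ⊗[F] A →ₗ[F] Module.End F W :=
    { toFun := fun x => ((e r).rangeRestrict ∘ₗ e x) ∘ₗ W.subtype
      map_add' := fun x y => by ext; simp
      map_smul' := fun c x => by ext; simp }
  have hρ : ∀ x w, (ρ x w : Fin N → F) = e r (e x w) := fun x w => rfl
  have hρr : ∀ x w, (ρ x w : Fin N → F) = e (r * x * r) w := fun x w => by
    rw [hρ, map_mul, map_mul, Module.End.mul_apply, Module.End.mul_apply, hrW]
  let ψ : A →+* Module.End F W :=
    { toFun := fun a => ρ (a ⊗ₜ a)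
      map_one' := by
        ext w : 2
        rw [← Algebra.TensorProduct.one_def, hρ, map_one]
        exact hrW w
      map_zero' := by simp
      map_mul' := fun a b => by
        refine LinearMap.ext fun w => Subtype.ext ?_
        rw [hρr, hmul, Module.End.mul_apply, hρr, hρr, map_mul, Module.End.mul_apply]
      map_add' := fun a b => by
        refine LinearMap.ext fun w => Subtype.ext ?_
        have : (a + b) ⊗ₜ[F] (a + b) = a ⊗ₜ[F] a + b ⊗ₜ[F] b +
            (a ⊗ₜ[F] b + Algebra.TensorProduct.comm F A A (a ⊗ₜ[F] b)) := by
          simp only [TensorProduct.add_tmul, TensorProduct.tmul_add,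
            Algebra.TensorProduct.comm_tmul]
          abel
        rw [this, map_add, map_add, LinearMap.add_apply, Submodule.coe_add, hρr _ w, hkill]
        simp }
  have hψ : ∀ a, ψ a = ρ (a ⊗ₜ a) := fun _ => rfl
  have hWn : W ≠ ⊥ := by
    intro h
    have := LinearMap.range_eq_bot.1 h
    exact hr0 (e.injective (by rw [this, map_zero]))
  have hspan : ∀ f : Module.End F W, f ∈ Submodule.span F (Set.range ψ) := by
    intro f
    let Y : Module.End F (Fin N → F) := (W.subtype ∘ₗ f) ∘ₗ (e r).rangeRestrict
    obtain ⟨y, hy⟩ := e.surjective Y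
    have hYr : r * y = y := by
      refine e.injective (LinearMap.ext fun v => ?_)
      rw [map_mul, hy, Module.End.mul_apply]
      exact hrW _
    have hYr' : y * r = y := by
      refine e.injective (LinearMap.ext fun v => ?_)
      rw [map_mul, hy, Module.End.mul_apply]
      change (W.subtype (f ((e r).rangeRestrict _))) = W.subtype (f ((e r).rangeRestrict _))
      congr 2
      exact Subtype.ext (hrW ⟨e r v, v, rfl⟩)
    have hys : Algebra.TensorProduct.comm F A A y = y := by
      have h1 := hsw y
      have h3 : n * y = 0 := by rw [← hYr, ← mul_assoc, hnr, zero_mul]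
      have h4 : (1 + n) * y = y := by rw [add_mul, one_mul, h3, add_zero]
      have h8 : y * n = 0 := by rw [← hYr', mul_assoc, hrn, mul_zero]
      have h9 : (1 + n) * (1 + n) = 1 := by
        have : (1 + n) * (1 + n) = 1 + (n + n) + n * n := by noncomm_ring
        rw [this, h2, hnn, add_zero, add_zero]
      have h10 := congrArg (· * (1 + n)) h1
      simp only [h4] at h10
      rw [mul_assoc, h9, mul_one, mul_add, h8, mul_one, add_zero] at h10
      exact h10.symm
    obtain ⟨k, c, a, x, hx⟩ := exists_symmetric_decomposition y hys
    have hf : f = ∑ i, c i • ψ (a i) := by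
      have h1 : f = ρ y := by
        refine LinearMap.ext fun w => Subtype.ext ?_
        rw [hρr, hYr, hYr', hy]
        change W.subtype (f w) = W.subtype (f ((e r).rangeRestrict _))
        congr 2
        exact Subtype.ext (hrW w).symm
      have h3 : ρ (x + Algebra.TensorProduct.comm F A A x) = 0 := by
        refine LinearMap.ext fun w => Subtype.ext ?_
        rw [hρr, hkill]; simp
      rw [h1, hx, map_add, h3, zero_add, map_sum]
      simp [hψ]
    rw [hf]
    exact Submodule.sum_mem _ fun i _ => Submodule.smul_mem _ _ (Submodule.subset_span ⟨_, rfl⟩)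
  have : Nontrivial W := Submodule.nontrivial_iff_ne_bot.2 hWn
  let E := algEquivMatrix (Module.finBasis F W)
  refine ⟨Module.finrank F W, Module.finrank_pos.ne', (E : _ →+* _).comp ψ, ?_, ?_⟩
  · intro c a
    have : ψ (c • a) = c ^ 2 • ψ a := by
      rw [hψ, hψ, ← map_smul, TensorProduct.smul_tmul_smul, sq]
    simp [this]
  · rw [eq_top_iff]
    intro M _
    have h1 := Submodule.mem_map_of_mem (f := E.toLinearMap) (hspan (E.symm M))
    rw [Submodule.map_span, ← Set.range_comp] at h1
    simpa using h1

end Frob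
end CharTwoBrauer

namespace CharTwoBrauer

section Surj

/-- The field `F`, viewed as an extension of itself along the Frobenius. -/
def FrobExt (F : Type) : Type := F

instance (F : Type) [Field F] : Field (FrobExt F) := inferInstanceAs (Field F)

noncomputable instance (F : Type) [Field F] [CharP F 2] : Algebra F (FrobExt F) :=
  (frobenius F 2).toAlgebra

theorem exists_algebraMap_frobExt {F : Type} [Field F] [CharP F 2] (r : FrobExt F) :
    ∃ c : F, algebraMap F (FrobExt F) c = r ^ 2 := ⟨r, rfl⟩

variable {F : Type} [Field F] [CharP F 2]

theorem exists_insep_splitting (x : Br F) (h : x + x = 0) :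
    ∃ (E : Type) (_ : Field E) (_ : Algebra F E), FiniteDimensional F E ∧
      (∀ r : E, ∃ c : F, algebraMap F E c = r ^ 2) ∧ res F E x = 0 := by
  classical
  obtain ⟨A, _, _, _, _, _, rfl⟩ := x.exists_rep
  obtain ⟨d, hd, ψ₀, hψ₀, hspan⟩ := exists_frobenius_hom h
  have : NeZero d := ⟨hd⟩
  let P := FrobExt F
  let ψ : A →ₐ[F] Matrix (Fin d) (Fin d) P :=
    { (ψ₀ : A →+* Matrix (Fin d) (Fin d) F) with
      commutes' := fun c => by
        have h1 := hψ₀ c 1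
        rw [← Algebra.algebraMap_eq_smul_one, map_one] at h1
        change ψ₀ _ = _
        rw [h1]
        refine Matrix.ext fun i j => ?_
        have h3 : algebraMap F (Matrix (Fin d) (Fin d) P) c i j =
          if i = j then algebraMap F P c else 0 := Matrix.algebraMap_matrix_apply
        refine Eq.trans (b := c ^ 2 * ((1 : Matrix (Fin d) (Fin d) F) i j)) rfl ?_
        refine Eq.trans ?_ h3.symm
        by_cases hij : i = j
        · refine Eq.trans ?_ (if_pos hij).symm
          rw [hij, Matrix.one_apply_eq]
          exact mul_one (c ^ 2)
        · refine Eq.trans ?_ (if_neg hij).symm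
          rw [Matrix.one_apply_ne hij]
          exact mul_zero (c ^ 2) }
  have hψ : ∀ a, ψ a = ψ₀ a := fun _ => rfl
  have hdim : Module.finrank F A = d * d := by
    let Ψ : P ⊗[F] A →ₐ[P] Matrix (Fin d) (Fin d) P := liftBaseChange ψ
    have hs : Function.Surjective Ψ := by
      refine LinearMap.range_eq_top (f := Ψ.toLinearMap).1 ?_
      rw [eq_top_iff]
      have h1 : Submodule.span P (Set.range ψ) = ⊤ := hspan
      rw [← h1, Submodule.span_le]
      rintro _ ⟨a, rfl⟩
      exact ⟨1 ⊗ₜ a, by simp [Ψ]⟩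
    have hi : Function.Injective Ψ := RingHom.injective Ψ.toRingHom
    have := LinearEquiv.finrank_eq (LinearEquiv.ofBijective Ψ.toLinearMap ⟨hi, hs⟩)
    rw [Module.finrank_baseChange, Module.finrank_matrix] at this
    simpa using this
  let b := Module.finBasis F A
  let S : Set P := Set.range fun t : Fin _ × Fin d × Fin d => ψ (b t.1) t.2.1 t.2.2
  have hSf : S.Finite := Set.finite_range _
  let E := IntermediateField.adjoin F S
  have hfin : FiniteDimensional F E := by
    have : Finite S := hSf
    refine IntermediateField.finiteDimensional_adjoin fun r _ => ?_
    obtain ⟨c, hc⟩ := exists_algebraMap_frobExt r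
    exact ⟨Polynomial.X ^ 2 - Polynomial.C c, Polynomial.monic_X_pow_sub_C c two_ne_zero,
      by simpa [sub_eq_zero] using hc.symm⟩
  have hmem : ∀ a i j, ψ a i j ∈ E := by
    intro a i j
    rw [← b.sum_repr a, map_sum, Matrix.sum_apply]
    refine sum_mem fun k _ => ?_
    rw [map_smul, Matrix.smul_apply]
    exact E.smul_mem (IntermediateField.subset_adjoin F S ⟨(k, i, j), rfl⟩)
  let f : A →ₐ[F] Matrix (Fin d) (Fin d) E :=
    { toFun := fun a => Matrix.of fun i j => ⟨ψ a i j, hmem a i j⟩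
      map_one' := by ext i j; simp [Matrix.one_apply]; split_ifs <;> rfl
      map_mul' := fun a b => by ext i j; simp [Matrix.mul_apply]
      map_zero' := by ext i j; simp
      map_add' := fun a b => by ext i j; simp
      commutes' := fun c => by
        ext i j
        simp [Matrix.algebraMap_matrix_apply]
        split_ifs <;> rfl }
  refine ⟨E, inferInstance, inferInstance, hfin, ?_, ?_⟩
  · intro r
    obtain ⟨c, hc⟩ := exists_algebraMap_frobExt (r : P)
    exact ⟨c, Subtype.ext hc⟩
  · rw [res_cls, cls_congr (algEquivOfFinrank (liftBaseChange (K := E) f) (by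
      simp [Module.finrank_baseChange, Module.finrank_matrix, hdim])), cls_matrix, cls_self]

theorem res_injective_of_bijective {E : Type} [Field E] [Algebra F E]
    (h : Function.Bijective (algebraMap F E)) {x : Br F} (hx : res F E x = 0) : x = 0 := by
  let i : E ≃+* F := (RingEquiv.ofBijective (algebraMap F E) h).symm
  let : Algebra E F := i.toRingHom.toAlgebra
  have : IsScalarTower F E F := IsScalarTower.of_algebraMap_eq fun c =>
    ((RingEquiv.ofBijective (algebraMap F E) h).symm_apply_apply c).symm
  rw [← res_self F x, ← res_res F E F, hx, map_zero]

open IntermediateField in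
theorem mem_closure_of_res_eq_zero_insep (E : Type) [Field E] (n : ℕ) :
    ∀ (F : Type) [Field F] [CharP F 2] [Algebra F E] [FiniteDimensional F E],
      Module.finrank F E = n → (∀ r : E, ∃ c : F, algebraMap F E c = r ^ 2) →
      ∀ x : Br F, res F E x = 0 →
      x ∈ AddSubgroup.closure {y | ∃ s e, (∃ r : E, algebraMap F E e = r ^ 2) ∧ y = sym F s e} := by
  induction n using Nat.strong_induction_on with
  | _ n ih =>
  intro F _ _ _ _ hn hE x hx
  by_cases hb : Function.Surjective (algebraMap F E)
  · rw [res_injective_of_bijective ⟨(algebraMap F E).injective, hb⟩ hx]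
    exact zero_mem _
  · simp only [Function.Surjective, not_forall] at hb
    obtain ⟨r, hr⟩ := hb
    obtain ⟨c, hc⟩ := hE r
    let K := F⟮r⟯
    have : CharP K 2 := charP_of_injective_algebraMap (algebraMap F K).injective 2
    have hr_int : IsIntegral F r := Algebra.IsIntegral.isIntegral r
    have hK : Module.finrank F K = 2 := by
      rw [IntermediateField.adjoin.finrank hr_int]
      have h1 : minpoly F r = Polynomial.X ^ 2 - Polynomial.C c := by
        refine (minpoly.eq_of_irreducible_of_monic ?_ (by simp [hc])
          (Polynomial.monic_X_pow_sub_C c two_ne_zero)).symm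
        refine Polynomial.irreducible_of_degree_le_three_of_not_isRoot (by simp) fun y hy => hr ⟨y, ?_⟩
        have h1 : y ^ 2 = c := by simpa [sub_eq_zero] using hy
        have : CharP E 2 := charP_of_injective_algebraMap (algebraMap F E).injective 2
        refine CharTwo.sq_injective ?_
        change (algebraMap F E y) ^ 2 = r ^ 2
        rw [← map_pow, h1, hc]
      rw [h1]; simp
    have hlt : Module.finrank K E < n := by
      have h1 := Module.finrank_mul_finrank F K E
      have h2 : 0 < Module.finrank K E := Module.finrank_pos
      rw [hK] at h1; omega
    have h1 := ih _ hlt K rfl (fun r => by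
      obtain ⟨c, hc⟩ := hE r
      exact ⟨algebraMap F K c, by rw [← hc, ← IsScalarTower.algebraMap_apply]⟩)
      (res F K x) (by rw [res_res, hx])
    have h2 : res F K x ∈ (AddSubgroup.closure
        {y | ∃ s e, (∃ r : E, algebraMap F E e = r ^ 2) ∧ y = sym F s e}).map (res F K) := by
      refine (AddSubgroup.closure_le _).2 ?_ h1
      rintro _ ⟨s, e, ⟨t, ht⟩, rfl⟩
      obtain ⟨e', he'⟩ := hE t
      obtain ⟨s', hs'⟩ := hE (s : E)
      refine ⟨sym F s' e', AddSubgroup.subset_closure ⟨s', e', ⟨t, he'⟩, rfl⟩, ?_⟩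
      have h3 : algebraMap F K e' = e := (algebraMap K E).injective (by
        rw [ht, ← he', ← IsScalarTower.algebraMap_apply])
      have h4 : algebraMap F K s' = s ^ 2 := (algebraMap K E).injective (by
        rw [map_pow, ← IsScalarTower.algebraMap_apply, hs']; rfl)
      rw [res_sym, h3, h4]
      have h5 : s ^ 2 = s + (s ^ 2 + s) := by
        have h2 : (2 : K) = 0 := CharTwo.two_eq_zero
        linear_combination (-s) * h2
      rw [h5, sym_add_artinSchreier]
    obtain ⟨y, hy, hyx⟩ := h2
    have h3 : res F K (x - y) = 0 := by rw [map_sub, hyx, sub_self]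
    let r' : K := ⟨r, mem_adjoin_simple_self F r⟩
    obtain ⟨s, hs⟩ := exists_eq_sym_of_res_eq_zero_insep (r := r') (e := c) hK
      (Subtype.ext (by rw [← sq]; exact hc.symm))
      (by rintro ⟨y, hy⟩; exact hr ⟨y, congrArg Subtype.val hy⟩) h3
    rw [show x = (x - y) + y by abel]
    exact add_mem (AddSubgroup.subset_closure ⟨s, c, ⟨r, hc⟩, hs⟩) hy

/-- Every Brauer class killed by two is in the image of the symbol map. -/
theorem exists_bmap_eq (x : Br F) (h : x + x = 0) : ∃ ω, bmap F ω = x := by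
  obtain ⟨E, _, _, _, hE, hx⟩ := exists_insep_splitting x h
  have h1 := mem_closure_of_res_eq_zero_insep E _ F rfl hE x hx
  have h2 : AddSubgroup.closure
      {y | ∃ s e, (∃ r : E, algebraMap F E e = r ^ 2) ∧ y = sym F s e} ≤ (bmap F).range := by
    rw [AddSubgroup.closure_le]
    rintro _ ⟨s, e, -, rfl⟩
    by_cases he : e = 0
    · rw [he, sym_zero_right]; exact zero_mem _
    · exact ⟨_, (sym_eq_bmap s he).symm⟩
  exact h2 h1

end Surj
end CharTwoBrauer

namespace CharTwoBrauer
open KaehlerDifferential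

section Kernel
variable {F : Type} [Field F] [CharP F 2]

theorem D_inv_mem {M : Submodule F Ω[F⁄ℤ]} {c : F} (hc : D ℤ F c ∈ M) : D ℤ F c⁻¹ ∈ M := by
  rw [Derivation.leibniz_inv]
  exact M.smul_mem _ hc

theorem exists_sq_of_mem_adjoin {k : ℕ} (e : Fin k → F) {P : Type} [Field P] [Algebra F P]
    (r : Fin k → P) (hr : ∀ j, r j ^ 2 = algebraMap F P (e j)) (z : P)
    (hz : z ∈ IntermediateField.adjoin F (Set.range r)) :
    ∃ c, algebraMap F P c = z ^ 2 ∧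
      D ℤ F c ∈ Submodule.span F (Set.range fun j => D ℤ F (e j)) := by
  have : CharP P 2 := charP_of_injective_algebraMap (algebraMap F P).injective 2
  induction hz using IntermediateField.adjoin_induction with
  | mem x hx =>
    obtain ⟨j, rfl⟩ := hx
    exact ⟨e j, (hr j).symm, Submodule.subset_span ⟨j, rfl⟩⟩
  | algebraMap x => exact ⟨x ^ 2, by simp, by rw [D_sq]; exact zero_mem _⟩
  | add x y _ _ hx hy =>
    obtain ⟨c, hc, hcm⟩ := hx
    obtain ⟨d, hd, hdm⟩ := hy
    exact ⟨c + d, by rw [map_add, hc, hd, CharTwo.add_sq], by rw [map_add]; exact add_mem hcm hdm⟩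
  | inv x _ hx =>
    obtain ⟨c, hc, hcm⟩ := hx
    exact ⟨c⁻¹, by rw [map_inv₀, hc, inv_pow], D_inv_mem hcm⟩
  | mul x y _ _ hx hy =>
    obtain ⟨c, hc, hcm⟩ := hx
    obtain ⟨d, hd, hdm⟩ := hy
    refine ⟨c * d, by rw [map_mul, hc, hd, mul_pow], ?_⟩
    rw [Derivation.leibniz]
    exact add_mem (Submodule.smul_mem _ _ hdm) (Submodule.smul_mem _ _ hcm)

/-- The relation extracted from the splitting of the first symbol over the field obtained by
adjoining square roots of the other slots. -/
theorem exists_reduction_of_sqrt {k : ℕ} (e : Fin (k + 1) → F) (s : Fin (k + 1) → F)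
    (h : bmap F (∑ j, s j • D ℤ F (e j)) = 0) (he : e 0 ≠ 0)
    {E : Type} [Field E] [CharP E 2] [Algebra F E] (r : Fin k → E)
    (hr : ∀ j, algebraMap F E (e j.succ) = r j ^ 2)
    (hE : ∀ z : E, ∃ c, algebraMap F E c = z ^ 2 ∧
      D ℤ F c ∈ Submodule.span F (Set.range fun j : Fin k => D ℤ F (e j.succ))) :
    ∃ g h, s 0 • D ℤ F (e 0) + ((g ^ 2 * e 0 + g) • D ℤ F (e 0) + D ℤ F h) ∈
      Submodule.span F (Set.range fun j : Fin k => D ℤ F (e j.succ)) := by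
  have hres := congrArg (res F E) h
  rw [map_zero, Fin.sum_univ_succ, map_add, map_add, bmap_smul_D, res_sym, res_bmap] at hres
  have h0 : map ℤ ℤ F E (∑ j : Fin k, s j.succ • D ℤ F (e j.succ)) = 0 := by
    rw [map_sum]
    refine Finset.sum_eq_zero fun j _ => ?_
    rw [map_smul, KaehlerDifferential.map_D, hr, D_sq, smul_zero]
  rw [h0, map_zero, add_zero] at hres
  have he' : algebraMap F E (e 0) ≠ 0 := by simpa using he
  obtain ⟨x, y, hxy⟩ := exists_norm_of_sym_eq_zero he' hres
  obtain ⟨X, hX, hXm⟩ := hE x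
  obtain ⟨Y, hY, hYm⟩ := hE y
  by_cases hy : y = 0
  · refine ⟨0, 0, ?_⟩
    have : X = e 0 := (algebraMap F E).injective (by rw [hX, hxy, hy]; ring)
    simp only [map_zero, add_zero]
    simp only [ne_eq, OfNat.ofNat_ne_zero, not_false_eq_true, zero_pow, zero_mul, zero_smul,
      add_zero]
    rw [← this]
    exact Submodule.smul_mem _ _ hXm
  · have hY0 : Y ≠ 0 := by
      rintro rfl
      rw [map_zero] at hY
      exact hy (pow_eq_zero_iff two_ne_zero |>.1 hY.symm)
    have hYE : algebraMap F E Y ≠ 0 := by simpa using hY0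
    set t : F := (e 0 + X + s 0 * e 0 * Y) / Y with ht
    have ht' : algebraMap F E t = x / y := by
      rw [ht, map_div₀, map_add, map_add, map_mul, hX, hxy, hY]
      have h2 : (2 : E) = 0 := CharTwo.two_eq_zero
      field_simp
      linear_combination (x ^ 2 + algebraMap F E (s 0 * e 0) * y ^ 2) * h2
    have hs : s 0 * e 0 = e 0 / Y + (t ^ 2 + t) := by
      apply (algebraMap F E).injective
      rw [map_add, map_add, map_pow, ht', map_div₀, hY, hxy]
      have h2 : (2 : E) = 0 := CharTwo.two_eq_zero
      field_simp
      linear_combination (-x ^ 2 - x * y) * h2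
    refine ⟨t / e 0, e 0 / Y, ?_⟩
    have hs' : s 0 = 1 / Y + ((t / e 0) ^ 2 * e 0 + t / e 0) := by
      field_simp
      field_simp at hs
      linear_combination hs
    have h3 : s 0 • D ℤ F (e 0) + (((t / e 0) ^ 2 * e 0 + t / e 0) • D ℤ F (e 0) +
        D ℤ F (e 0 / Y)) = (e 0) • D ℤ F (Y⁻¹) := by
      rw [div_eq_mul_inv (e 0) Y, Derivation.leibniz, ← add_assoc, ← add_smul]
      have : s 0 + ((t / e 0) ^ 2 * e 0 + t / e 0) = Y⁻¹ := by
        have h2 : (2 : F) = 0 := CharTwo.two_eq_zero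
        conv_lhs => rw [hs']
        linear_combination ((t / e 0) ^ 2 * e 0 + t / e 0) * h2
      rw [this, ← add_assoc, add_right_comm, omega_add_self, zero_add]
    rw [h3]
    exact Submodule.smul_mem _ _ (D_inv_mem hYm)

theorem exists_reduction {k : ℕ} (e : Fin (k + 1) → F) (s : Fin (k + 1) → F)
    (h : bmap F (∑ j, s j • D ℤ F (e j)) = 0) :
    ∃ g h, s 0 • D ℤ F (e 0) + ((g ^ 2 * e 0 + g) • D ℤ F (e 0) + D ℤ F h) ∈
      Submodule.span F (Set.range fun j : Fin k => D ℤ F (e j.succ)) := by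
  by_cases he : e 0 = 0
  · exact ⟨0, 0, by simp [he]⟩
  have hroot : ∀ j : Fin k, ∃ r : AlgebraicClosure F, r ^ 2 = algebraMap F _ (e j.succ) := fun j =>
    IsAlgClosed.exists_pow_nat_eq _ two_pos
  choose r hr using hroot
  let E := IntermediateField.adjoin F (Set.range r)
  have : CharP E 2 := charP_of_injective_algebraMap (algebraMap F E).injective 2
  refine exists_reduction_of_sqrt e s h he
    (fun j => (⟨r j, IntermediateField.subset_adjoin F _ (Set.mem_range_self j)⟩ : E))
    (fun j => Subtype.ext (hr j).symm) fun z => ?_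
  obtain ⟨c, hc, hm⟩ := exists_sq_of_mem_adjoin (fun j : Fin k => e j.succ) r hr z z.2
  exact ⟨c, Subtype.ext hc, hm⟩

theorem exists_of_bmap_eq_zero (k : ℕ) : ∀ (e : Fin k → F) (s : Fin k → F),
    bmap F (∑ j, s j • D ℤ F (e j)) = 0 →
    ∃ (g : Fin k → F) (h : F),
      ∑ j, s j • D ℤ F (e j) = ∑ j, (g j ^ 2 * e j + g j) • D ℤ F (e j) + D ℤ F h := by
  induction k with
  | zero => exact fun e s _ => ⟨0, 0, by simp⟩
  | succ k ih =>
    intro e s hb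
    obtain ⟨g, h, hgh⟩ := exists_reduction e s hb
    obtain ⟨c, hc⟩ := (Submodule.mem_span_range_iff_exists_fun F).1 hgh
    set R := (g ^ 2 * e 0 + g) • D ℤ F (e 0) + D ℤ F h with hR
    have hbR : bmap F R = 0 := by rw [hR, map_add, bmap_artinSchreier, bmap_D, add_zero]
    have h0 : s 0 • D ℤ F (e 0) = ∑ j : Fin k, c j • D ℤ F (e j.succ) + R := by
      rw [hc, add_assoc, omega_add_self, add_zero]
    have h1 : ∑ j, s j • D ℤ F (e j) =
        ∑ j : Fin k, (c j + s j.succ) • D ℤ F (e j.succ) + R := by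
      rw [Fin.sum_univ_succ, h0]
      simp only [add_smul, Finset.sum_add_distrib]
      abel
    have h2 := hb
    rw [h1, map_add, hbR, add_zero] at h2
    obtain ⟨g', h', hg'⟩ := ih _ _ h2
    refine ⟨Fin.cons g g', h + h', ?_⟩
    rw [h1, hg', Fin.sum_univ_succ]
    simp only [Fin.cons_zero, Fin.cons_succ, map_add, hR]
    abel

end Kernel
end CharTwoBrauer

namespace CharTwoBrauer
open KaehlerDifferential

section Transfer
variable {F K : Type} [Field F] [CharP F 2] [Field K] [CharP K 2] [Algebra F K] {a : F} {θ : K}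

theorem IsQuadSep.isSeparable (h : IsQuadSep F a θ) : Algebra.IsSeparable F K := by
  have hfd := h.finiteDimensional
  have hs : IsSeparable F θ := by
    let p : Polynomial F := Polynomial.X ^ 2 + Polynomial.X + Polynomial.C a
    have hp : p.Separable := by
      refine (Polynomial.separable_def p).2 ⟨0, 1, ?_⟩
      have : (2 : Polynomial F) = 0 := CharTwo.two_eq_zero
      simp only [p, Polynomial.derivative_add, Polynomial.derivative_X_pow,
        Polynomial.derivative_X, Polynomial.derivative_C]
      push_cast
      simp [this, CharTwo.two_eq_zero]
    refine hp.of_dvd (minpoly.dvd F θ ?_)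
    have h2 : (2 : K) = 0 := CharTwo.two_eq_zero
    simp only [p, map_add, map_pow, Polynomial.aeval_X, Polynomial.aeval_C]
    linear_combination h.mul_self + (θ + algebraMap F K a) * h2
  have ht : IntermediateField.adjoin F {θ} = ⊤ := by
    rw [eq_top_iff]
    intro z _
    obtain ⟨x, y, rfl⟩ := h.exists_eq z
    exact add_mem (IntermediateField.algebraMap_mem _ _)
      (mul_mem (IntermediateField.algebraMap_mem _ _) (IntermediateField.mem_adjoin_simple_self F θ))
  have h1 := (IntermediateField.isSeparable_adjoin_simple_iff_isSeparable (F := F) (x := θ)).2 hs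
  rw [ht] at h1
  exact Algebra.IsSeparable.of_algHom F (⊤ : IntermediateField F K)
    (IntermediateField.topEquiv (F := F) (E := K)).symm.toAlgHom

theorem IsQuadSep.translate (h : IsQuadSep F a θ) (c : F) :
    IsQuadSep F (a + (c ^ 2 + c)) (θ + algebraMap F K c) where
  mul_self := by
    have h2 : (2 : K) = 0 := CharTwo.two_eq_zero
    simp only [map_add, map_pow]
    linear_combination h.mul_self + (θ * algebraMap F K c - algebraMap F K c) * h2
  finrank_eq := h.finrank_eq
  notMem := by
    rintro ⟨z, hz⟩
    exact h.notMem ⟨z - c, by rw [map_sub, hz]; ring⟩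

theorem IsQuadSep.D_eq (h : IsQuadSep F a θ) : D ℤ K θ = map ℤ ℤ F K (D ℤ F a) := by
  have h1 := congrArg (D ℤ K) h.mul_self
  rw [Derivation.leibniz, omega_add_self, map_add] at h1
  rw [KaehlerDifferential.map_D]
  exact eq_of_add_eq_zero_of_module K h1.symm

theorem IsQuadSep.D_add_mul (h : IsQuadSep F a θ) (x y : F) :
    D ℤ K (algebraMap F K x + algebraMap F K y * θ) = map ℤ ℤ F K (D ℤ F x + y • D ℤ F a) +
      θ • map ℤ ℤ F K (D ℤ F y) := by
  rw [map_add, Derivation.leibniz, h.D_eq, map_add, map_smul, KaehlerDifferential.map_D,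
    KaehlerDifferential.map_D, KaehlerDifferential.map_D, algebraMap_smul, add_assoc]

/-- `T` is the trace map on differentials. -/
def IsTr (F : Type) {K : Type} [Field F] [Field K] [Algebra F K] (θ : K)
    (T : Ω[K⁄ℤ] →+ Ω[F⁄ℤ]) : Prop :=
  ∀ (x y : F) (ω : Ω[F⁄ℤ]),
    T ((algebraMap F K x + algebraMap F K y * θ) • map ℤ ℤ F K ω) = y • ω

theorem IsTr.translate {T : Ω[K⁄ℤ] →+ Ω[F⁄ℤ]} (hT : IsTr F θ T) (c : F) :
    IsTr F (θ + algebraMap F K c) T := by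
  intro x y ω
  rw [← hT (x + y * c) y ω, map_add, map_mul]
  congr 2
  ring

theorem IsQuadSep.exists_isTr (h : IsQuadSep F a θ) : ∃ T, IsTr F θ T := by
  have := h.isSeparable
  have := Algebra.FormallyEtale.of_isSeparable F K
  let l : K →ₗ[F] F :=
    { toFun := fun z => (h.equiv.symm z).im
      map_add' := fun x y => by simp
      map_smul' := fun c x => by simp }
  have hl : ∀ x y : F, l (algebraMap F K x + algebraMap F K y * θ) = y := by
    intro x y
    have : h.equiv.symm (algebraMap F K x + algebraMap F K y * θ) = ⟨x, y⟩ := by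
      rw [AlgEquiv.symm_apply_eq, h.equiv_apply]
    change (h.equiv.symm _).im = y
    rw [this]
  let t : K ⊗[F] Ω[F⁄ℤ] →ₗ[F] Ω[F⁄ℤ] := (TensorProduct.lid F _).toLinearMap ∘ₗ l.rTensor _
  refine ⟨t.toAddMonoidHom.comp
    (tensorKaehlerEquivOfFormallyEtale ℤ F K).symm.toLinearMap.toAddMonoidHom, ?_⟩
  intro x y ω
  have : (tensorKaehlerEquivOfFormallyEtale ℤ F K).symm
      ((algebraMap F K x + algebraMap F K y * θ) • map ℤ ℤ F K ω) =
      (algebraMap F K x + algebraMap F K y * θ) ⊗ₜ ω := by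
    rw [LinearEquiv.symm_apply_eq, tensorKaehlerEquivOfFormallyEtale_apply, mapBaseChange_tmul]
  change t ((tensorKaehlerEquivOfFormallyEtale ℤ F K).symm _) = _
  rw [this]
  simp only [t, LinearMap.comp_apply, LinearMap.rTensor_tmul, hl, LinearEquiv.coe_coe,
    TensorProduct.lid_tmul]

variable {T : Ω[K⁄ℤ] →+ Ω[F⁄ℤ]}

theorem IsTr.map (hT : IsTr F θ T) (ω : Ω[F⁄ℤ]) : T (map ℤ ℤ F K ω) = 0 := by
  simpa using hT 1 0 ω

theorem IsTr.smul_map (hT : IsTr F θ T) (ω : Ω[F⁄ℤ]) : T (θ • KaehlerDifferential.map ℤ ℤ F K ω) = ω := by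
  simpa using hT 0 1 ω

theorem IsTr.D (hT : IsTr F θ T) (h : IsQuadSep F a θ) (x y : F) :
    T (D ℤ K (algebraMap F K x + algebraMap F K y * θ)) = KaehlerDifferential.D ℤ F y := by
  rw [h.D_add_mul, map_add, hT.map, hT.smul_map, zero_add]

theorem IsTr.bmap_artinSchreier_mul (hT : IsTr F θ T) (h : IsQuadSep F a θ) (g : K) (y : F) :
    bmap F (T ((g ^ 2 * (algebraMap F K y * θ) + g) •
      KaehlerDifferential.D ℤ K (algebraMap F K y * θ))) = 0 := by
  obtain ⟨g0, g1, rfl⟩ := h.exists_eq g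
  have hD := h.D_add_mul 0 y
  rw [map_zero, zero_add, map_zero, zero_add] at hD
  have h2 : (2 : K) = 0 := CharTwo.two_eq_zero
  have h2' : (2 : F) = 0 := CharTwo.two_eq_zero
  set c0 : F := y * g1 ^ 2 * a + g0 with hc0
  set c1 : F := y * (g0 ^ 2 + g1 ^ 2 * a + g1 ^ 2) + g1 with hc1
  have hm := h.mul_self
  have hc : (algebraMap F K g0 + algebraMap F K g1 * θ) ^ 2 * (algebraMap F K y * θ) +
      (algebraMap F K g0 + algebraMap F K g1 * θ) = algebraMap F K c0 + algebraMap F K c1 * θ := by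
    simp only [hc0, hc1, map_add, map_mul, map_pow]
    grind
  have hcθ : (algebraMap F K c0 + algebraMap F K c1 * θ) * θ =
      algebraMap F K (c1 * a) + algebraMap F K (c0 + c1) * θ := by
    simp only [map_add, map_mul]
    linear_combination (algebraMap F K c1) * hm
  rw [hc, hD, smul_add, smul_smul, hcθ, map_add, hT, hT, smul_smul]
  have e1 : c1 * y = ((y * g1) ^ 2 * a + (y * g1)) + (y * (g0 + g1)) ^ 2 := by
    rw [hc1]; grind
  have e2 : c0 + c1 = (g0 + g1) ^ 2 * y + (g0 + g1) := by
    rw [hc0, hc1]; grind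
  have e3 : (y * (g0 + g1)) ^ 2 • KaehlerDifferential.D ℤ F a =
      KaehlerDifferential.D ℤ F ((y * (g0 + g1)) ^ 2 * a) := by
    rw [Derivation.leibniz, D_sq, smul_zero, add_zero]
  rw [e1, e2, add_smul, e3, map_add, map_add, bmap_artinSchreier, bmap_artinSchreier, bmap_D]
  simp

theorem IsTr.bmap_artinSchreier (hT : IsTr F θ T) (h : IsQuadSep F a θ) (g e : K) :
    bmap F (T ((g ^ 2 * e + g) • KaehlerDifferential.D ℤ K e)) = 0 := by
  obtain ⟨x, y, rfl⟩ := h.exists_eq e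
  by_cases hy : y = 0
  · subst hy
    obtain ⟨g0, g1, rfl⟩ := h.exists_eq g
    have hm := h.mul_self
    have h2 : (2 : K) = 0 := CharTwo.two_eq_zero
    have hc : (algebraMap F K g0 + algebraMap F K g1 * θ) ^ 2 * algebraMap F K x +
      (algebraMap F K g0 + algebraMap F K g1 * θ) =
      algebraMap F K ((g0 ^ 2 + g1 ^ 2 * a) * x + g0) + algebraMap F K (g1 ^ 2 * x + g1) * θ := by
      simp only [map_add, map_mul, map_pow]
      grind
    rw [map_zero, zero_mul, add_zero, hc, ← KaehlerDifferential.map_D ℤ, hT,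
      CharTwoBrauer.bmap_artinSchreier]
  · have := (hT.translate (x / y)).bmap_artinSchreier_mul (h.translate (x / y)) g y
    have hyK : algebraMap F K y ≠ 0 := by simpa using hy
    have he : algebraMap F K y * (θ + algebraMap F K (x / y)) =
        algebraMap F K x + algebraMap F K y * θ := by
      rw [map_div₀]; field_simp; ring
    rwa [he] at this

/-- The trace of a differential whose symbol vanishes has vanishing symbol. -/
theorem IsTr.bmap_eq_zero (hT : IsTr F θ T) (h : IsQuadSep F a θ) {κ : Ω[K⁄ℤ]}
    (hκ : bmap K κ = 0) : bmap F (T κ) = 0 := by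
  obtain ⟨n, s, e, rfl⟩ := exists_finset_sum κ
  obtain ⟨g, c, hg⟩ := exists_of_bmap_eq_zero n e s hκ
  obtain ⟨x, y, rfl⟩ := h.exists_eq c
  rw [hg, map_add, map_add, hT.D h, bmap_D, add_zero, map_sum, map_sum]
  exact Finset.sum_eq_zero fun i _ => hT.bmap_artinSchreier h _ _

end Transfer
end CharTwoBrauer

namespace CharTwoBrauer
open KaehlerDifferential

section SymLE
variable {F : Type} [Field F] [CharP F 2]

/-- `SymLE x m` says that `x` is a sum of at most `m` symbols. -/
inductive SymLE : Br F → ℕ → Prop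
  | zero (m : ℕ) : SymLE 0 m
  | add_sym {x : Br F} {m : ℕ} (s e : F) (h : SymLE x m) : SymLE (x + sym F s e) (m + 1)

theorem SymLE.sym (s e : F) : SymLE (sym F s e) 1 := by
  simpa using SymLE.add_sym s e (SymLE.zero 0)

theorem SymLE.mono {x : Br F} {m n : ℕ} (h : SymLE x m) (hmn : m ≤ n) : SymLE x n := by
  induction h generalizing n with
  | zero m => exact .zero n
  | add_sym s e h ih =>
    obtain ⟨n, rfl⟩ : ∃ k, n = k + 1 := ⟨n - 1, by omega⟩
    exact .add_sym s e (ih (by omega))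

theorem SymLE.add {x y : Br F} {m n : ℕ} (hx : SymLE x m) (hy : SymLE y n) :
    SymLE (x + y) (m + n) := by
  induction hy with
  | zero n => simpa using hx.mono (by omega)
  | add_sym s e h ih =>
    rw [← add_assoc]
    exact .add_sym s e ih

theorem SymLE.sum {k : ℕ} (s e : Fin k → F) : SymLE (∑ i, CharTwoBrauer.sym F (s i) (e i)) k := by
  induction k with
  | zero => simpa using SymLE.zero 0
  | succ k ih =>
    rw [Fin.sum_univ_castSucc]
    exact .add_sym _ _ (ih _ _)

theorem SymLE.bmap (s e : F) : SymLE (bmap F (s • D ℤ F e)) 1 := by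
  rw [bmap_smul_D]
  exact .sym _ _

theorem SymLE.bmap_sum {k : ℕ} (s e : Fin k → F) :
    SymLE (CharTwoBrauer.bmap F (∑ i, s i • D ℤ F (e i))) k := by
  simp only [map_sum, bmap_smul_D]
  exact .sum _ _

theorem exists_sym_eq_bmap (s e : F) : ∃ r : F, sym F s e = bmap F (r • D ℤ F e) := by
  by_cases he : e = 0
  · exact ⟨0, by simp [he, sym_zero_right]⟩
  · exact ⟨s / e, sym_eq_bmap s he⟩

theorem SymLE.exists_bmap_sum {x : Br F} {m : ℕ} (h : SymLE x m) :
    ∃ s e : Fin m → F, x = CharTwoBrauer.bmap F (∑ i, s i • D ℤ F (e i)) := by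
  induction h with
  | zero m => exact ⟨0, 0, by simp⟩
  | add_sym s e h ih =>
    obtain ⟨u, v, rfl⟩ := ih
    obtain ⟨r, hr⟩ := exists_sym_eq_bmap s e
    exact ⟨Fin.snoc u r, Fin.snoc v e, by simp [Fin.sum_univ_castSucc, hr]⟩

theorem SymLE.add_self {x : Br F} {m : ℕ} (h : SymLE x m) : x + x = 0 := by
  obtain ⟨s, e, rfl⟩ := h.exists_bmap_sum
  exact bmap_add_self _

end SymLE

section Descent
variable {F K : Type} [Field F] [CharP F 2] [Field K] [CharP K 2] [Algebra F K] {a : F} {θ : K}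

theorem IsQuadSep.bmap_theta_artinSchreier (h : IsQuadSep F a θ) (g e : F) :
    bmap K (θ • map ℤ ℤ F K ((g ^ 2 * e + g) • D ℤ F e)) =
      bmap K (map ℤ ℤ F K ((a * g ^ 2 * e) • D ℤ F e)) := by
  have h2 : (2 : K) = 0 := CharTwo.two_eq_zero
  have hm := h.mul_self
  rw [map_smul (map ℤ ℤ F K), map_smul (map ℤ ℤ F K), KaehlerDifferential.map_D,
    ← algebraMap_smul K (g ^ 2 * e + g) (D ℤ K _),
    ← algebraMap_smul K (a * g ^ 2 * e) (D ℤ K _), smul_smul, bmap_smul_D, bmap_smul_D,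
    ← sym_add_artinSchreier _ _ (θ * algebraMap F K (g * e))]
  congr 1
  simp only [map_add, map_mul, map_pow]
  grind

theorem IsQuadSep.bmap_theta_D (h : IsQuadSep F a θ) (c : F) :
    bmap K (θ • map ℤ ℤ F K (D ℤ F c)) = bmap K (map ℤ ℤ F K (c • D ℤ F a)) := by
  have h1 : D ℤ K (algebraMap F K c * θ) = map ℤ ℤ F K (c • D ℤ F a) +
      θ • map ℤ ℤ F K (D ℤ F c) := by
    have := h.D_add_mul 0 c
    simpa using this
  have h2 := congrArg (bmap K) h1
  rw [bmap_D, map_add] at h2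
  rw [← add_zero (bmap K (map ℤ ℤ F K (c • D ℤ F a))), h2, ← add_assoc, bmap_add_self, zero_add]

theorem IsQuadSep.exists_sum_of_res_eq (h : IsQuadSep F a θ) {x : Br F} (hx : x + x = 0) {k : ℕ}
    (w : Fin k → K) (e : Fin k → F)
    (hw : res F K x = bmap K (∑ j, w j • map ℤ ℤ F K (D ℤ F (e j)))) :
    ∃ (s : Fin k → F) (c d : F),
      x = bmap F (∑ j, s j • D ℤ F (e j)) + bmap F (c • D ℤ F a) + sym F a d := by
  obtain ⟨ω, rfl⟩ := exists_bmap_eq x hx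
  obtain ⟨T, hT⟩ := h.exists_isTr
  choose r s hrs using fun j => h.exists_eq (w j)
  have hsum : ∑ j, w j • map ℤ ℤ F K (D ℤ F (e j)) =
      map ℤ ℤ F K (∑ j, r j • D ℤ F (e j)) + θ • map ℤ ℤ F K (∑ j, s j • D ℤ F (e j)) := by
    rw [map_sum, map_sum, Finset.smul_sum, ← Finset.sum_add_distrib]
    refine Finset.sum_congr rfl fun j _ => ?_
    rw [hrs j, map_smul, map_smul, ← algebraMap_smul K (r j), ← algebraMap_smul K (s j),
      smul_smul, ← add_smul, mul_comm θ]
  rw [res_bmap, hsum] at hw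
  have h0 : bmap K (map ℤ ℤ F K ω + (map ℤ ℤ F K (∑ j, r j • D ℤ F (e j)) +
      θ • map ℤ ℤ F K (∑ j, s j • D ℤ F (e j)))) = 0 := by
    rw [map_add, hw, bmap_add_self]
  have h1 := hT.bmap_eq_zero h h0
  rw [map_add T, map_add T, hT.map, hT.map, hT.smul_map, zero_add, zero_add] at h1
  obtain ⟨g, c, hg⟩ := exists_of_bmap_eq_zero k e s h1
  have h3 : bmap K (θ • map ℤ ℤ F K (∑ j, s j • D ℤ F (e j))) =
      bmap K (map ℤ ℤ F K (∑ j, (a * g j ^ 2 * e j) • D ℤ F (e j) + c • D ℤ F a)) := by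
    rw [hg, map_add, smul_add, map_add, h.bmap_theta_D, map_add, map_add, map_sum, map_sum,
      Finset.smul_sum, map_sum, map_sum]
    congr 1
    exact Finset.sum_congr rfl fun j _ => h.bmap_theta_artinSchreier _ _
  rw [map_add, h3, ← map_add, ← map_add, ← add_assoc, ← Finset.sum_add_distrib] at hw
  simp only [← add_smul] at hw
  rw [← res_bmap, ← res_bmap, ← sub_eq_zero, ← map_sub] at hw
  obtain ⟨d, -, hd⟩ := exists_eq_sym_of_res_eq_zero_sep h hw
  refine ⟨fun j => r j + a * g j ^ 2 * e j, c, d, ?_⟩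
  rw [← hd, ← map_add]
  abel

theorem IsQuadSep.symLE_of_res_eq (h : IsQuadSep F a θ) {x : Br F} (hx : x + x = 0) {k : ℕ}
    (w : Fin k → K) (e : Fin k → F) (w' : K)
    (hw : res F K x = bmap K (∑ j, w j • map ℤ ℤ F K (D ℤ F (e j)) +
      w' • map ℤ ℤ F K (D ℤ F a))) : SymLE x (k + 2) := by
  obtain ⟨s, c, d, hs⟩ := h.exists_sum_of_res_eq hx (Fin.snoc (α := fun _ => K) w w')
    (Fin.snoc (α := fun _ => F) e a) (by simpa [Fin.sum_univ_castSucc] using hw)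
  rw [Fin.sum_univ_castSucc] at hs
  simp only [Fin.snoc_castSucc, Fin.snoc_last] at hs
  rw [map_add, add_assoc (bmap F _), ← map_add, ← add_smul] at hs
  rw [hs]
  exact ((SymLE.bmap_sum _ _).add (.bmap _ _)).add (.sym _ _)

theorem IsQuadSep.symLE_of_forall (h : IsQuadSep F a θ) {x : Br F} (hx : x + x = 0) {m : ℕ}
    (α : Fin m → K) (u v : Fin m → F) (α' : K) (v' : F)
    (hw : res F K x = bmap K (∑ j, α j • D ℤ K (algebraMap F K (u j) + algebraMap F K (v j) * θ) +
      α' • D ℤ K (algebraMap F K v' * θ))) : SymLE x (2 * m + 3) := by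
  have hv := h.D_add_mul 0 v'
  simp only [map_zero, zero_add] at hv
  simp only [h.D_add_mul, hv] at hw
  refine (h.symLE_of_res_eq hx (k := m + m + 1)
    (Fin.snoc (α := fun _ => K) (Fin.append α fun j => α j * θ) (α' * θ))
    (Fin.snoc (α := fun _ => F) (Fin.append u v) v')
    (∑ j, α j * algebraMap F K (v j) + α' * algebraMap F K v') ?_).mono (by omega)
  rw [hw, Fin.sum_univ_castSucc]
  simp only [Fin.snoc_castSucc, Fin.snoc_last]
  rw [Fin.sum_univ_add]
  simp only [Fin.append_left, Fin.append_right]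
  congr 1
  simp only [map_add, smul_add, Finset.sum_add_distrib, map_smul, ← algebraMap_smul K (_ : F)
    (map ℤ ℤ F K _), smul_smul, add_smul, Finset.sum_smul]
  abel

/-- A class which becomes a sum of `m` symbols over a separable quadratic extension is a sum of
`2 m + 1` symbols. -/
theorem IsQuadSep.symLE_two_mul_add_one (h : IsQuadSep F a θ) {x : Br F} (hx : x + x = 0) {m : ℕ}
    (hm : SymLE (res F K x) m) : SymLE x (2 * m + 1) := by
  obtain ⟨α, β, hαβ⟩ := hm.exists_bmap_sum
  choose u v huv using fun j => h.exists_eq (β j)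
  simp only [huv] at hαβ
  by_cases hv : ∀ j, v j = 0
  · simp only [hv, map_zero, zero_mul, add_zero] at hαβ
    rcases Nat.eq_zero_or_pos m with rfl | hm
    · simp only [Finset.univ_eq_empty, Finset.sum_empty, map_zero] at hαβ
      obtain ⟨d, -, rfl⟩ := exists_eq_sym_of_res_eq_zero_sep h hαβ
      exact .sym _ _
    · exact (h.symLE_of_res_eq hx α u 0 (by
        simpa [KaehlerDifferential.map_D] using hαβ)).mono (by omega)
  · push Not at hv
    obtain ⟨i, hi⟩ := hv
    obtain ⟨n, rfl⟩ : ∃ n, m = n + 1 := ⟨m - 1, by have := i.2; omega⟩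
    have hiK : algebraMap F K (v i) ≠ 0 := by simpa using hi
    set c := u i / v i with hc
    refine ((h.translate c).symLE_of_forall hx (fun j : Fin n => α (i.succAbove j))
      (fun j => u (i.succAbove j) - v (i.succAbove j) * c) (fun j => v (i.succAbove j))
      (α i) (v i) ?_).mono (by omega)
    rw [hαβ, Fin.sum_univ_succAbove _ i, add_comm]
    congr 2
    · refine Finset.sum_congr rfl fun j _ => ?_
      congr 2
      simp only [map_sub, map_mul]
      ring
    · congr 2
      rw [hc, map_div₀]
      field_simp
      ring

end Descent
end CharTwoBrauer

namespace CharTwoBrauer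
open Quaternion

section Albert
variable {F : Type} [Field F] [CharP F 2]

/-- The Albert form of two symbols is isotropic. -/
def AlbIso (s e s' e' : F) : Prop :=
  ∃ c0 c1 b0 b1 d0 d1 : F, ¬ (c0 = 0 ∧ c1 = 0 ∧ b0 = 0 ∧ b1 = 0 ∧ d0 = 0 ∧ d1 = 0) ∧
    c0 ^ 2 + c0 * c1 + (s + s') * c1 ^ 2 + e * (b0 ^ 2 + b0 * b1 + s * b1 ^ 2) +
      e' * (d0 ^ 2 + d0 * d1 + s' * d1 ^ 2) = 0

theorem exists_sym_eq_add (s e k x y : F) :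
    ∃ f, sym F s e = sym F (s + (k ^ 2 + k) + e * (x ^ 2 + x * y + s * y ^ 2)) f := by
  by_cases h : e * (x ^ 2 + x * y + s * y ^ 2) = 0
  · exact ⟨e, by rw [h, add_zero, sym_add_artinSchreier]⟩
  · refine ⟨e * (x ^ 2 + x * y + s * y ^ 2), ?_⟩
    rw [← sym_add_left, sym_self, add_zero, sym_add_artinSchreier,
      sym_mul_norm _ _ _ _ (right_ne_zero_of_mul h)]

theorem exists_sym_eq_right (s e k x y : F) (hxy : x ≠ 0 ∨ y ≠ 0) :
    ∃ t, sym F s e = sym F t (k ^ 2 + e * (x ^ 2 + x * y + s * y ^ 2)) := by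
  by_cases he : e = 0
  · exact ⟨0, by simp [he, sym_zero_left, sym_zero_right]⟩
  by_cases h : x ^ 2 + x * y + s * y ^ 2 = 0
  · obtain ⟨t, rfl⟩ := exists_artinSchreier_of_isotropic h hxy
    exact ⟨0, by rw [sym_artinSchreier, sym_zero_left]⟩
  · set n := e * (x ^ 2 + x * y + s * y ^ 2) with hn
    have hn0 : n ≠ 0 := mul_ne_zero he h
    refine ⟨s / n * (k ^ 2 + n), ?_⟩
    rw [sym_add_arg, sym_sq_right, zero_add, div_mul_cancel₀ _ hn0, hn, sym_mul_norm _ _ _ _ h]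

theorem exists_sym_add_sym (t f f' : F) : ∃ g, sym F t f + sym F t f' = sym F t g := by
  by_cases hf : f = 0
  · exact ⟨f', by rw [hf, sym_zero_right, zero_add]⟩
  by_cases hf' : f' = 0
  · exact ⟨f, by rw [hf', sym_zero_right, add_zero]⟩
  exact ⟨_, sym_mul_right t hf hf'⟩

/-- If the Albert form is isotropic, the sum of the two symbols is a symbol. -/
theorem AlbIso.exists_sym {s e s' e' : F} (h : AlbIso s e s' e') :
    ∃ t f, sym F s e + sym F s' e' = sym F t f := by
  have h2 : (2 : F) = 0 := CharTwo.two_eq_zero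
  obtain ⟨c0, c1, b0, b1, d0, d1, hne, h⟩ := h
  by_cases hc1 : c1 = 0
  · subst hc1
    by_cases hb : b0 = 0 ∧ b1 = 0
    · obtain ⟨rfl, rfl⟩ := hb
      by_cases hd : d0 = 0 ∧ d1 = 0
      · obtain ⟨rfl, rfl⟩ := hd
        simp at h hne
        exact absurd h hne
      · obtain ⟨t, ht⟩ := exists_sym_eq_right s' e' c0 d0 d1 (by tauto)
        refine ⟨s, e, ?_⟩
        rw [ht, show c0 ^ 2 + e' * (d0 ^ 2 + d0 * d1 + s' * d1 ^ 2) = 0 by linear_combination h,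
          sym_zero_right, add_zero]
    · by_cases hd : d0 = 0 ∧ d1 = 0
      · obtain ⟨rfl, rfl⟩ := hd
        obtain ⟨t, ht⟩ := exists_sym_eq_right s e c0 b0 b1 (by tauto)
        refine ⟨s', e', ?_⟩
        rw [ht, show c0 ^ 2 + e * (b0 ^ 2 + b0 * b1 + s * b1 ^ 2) = 0 by linear_combination h,
          sym_zero_right, zero_add]
      · obtain ⟨t, ht⟩ := exists_sym_eq_right s e c0 b0 b1 (by tauto)
        obtain ⟨t', ht'⟩ := exists_sym_eq_right s' e' 0 d0 d1 (by tauto)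
        refine ⟨t + t', c0 ^ 2 + e * (b0 ^ 2 + b0 * b1 + s * b1 ^ 2), ?_⟩
        rw [← sym_add_left, ht, ht']
        congr 2
        grind
  · obtain ⟨f, hf⟩ := exists_sym_eq_add s e (c0 / c1) (b0 / c1) (b1 / c1)
    obtain ⟨f', hf'⟩ := exists_sym_eq_add s' e' 0 (d0 / c1) (d1 / c1)
    obtain ⟨g, hg⟩ := exists_sym_add_sym (s + ((c0 / c1) ^ 2 + c0 / c1) +
      e * ((b0 / c1) ^ 2 + b0 / c1 * (b1 / c1) + s * (b1 / c1) ^ 2)) f f'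
    refine ⟨_, g, Eq.trans ?_ hg⟩
    rw [hf, hf']
    congr 2
    field_simp
    grind

theorem self_mul_symConj {s e : F} (q : ℍ[F,s,1,e]) : q * symConj q = algebraMap F _
    ((q.re ^ 2 + q.re * q.imI + s * q.imI ^ 2) +
      e * (q.imJ ^ 2 + q.imJ * q.imK + s * q.imK ^ 2)) := by
  have h2 : (2 : F) = 0 := CharTwo.two_eq_zero
  ext <;> simp [symConj, QuaternionAlgebra.algebraMap_eq] <;> grind

variable {s e s' e' : F}

theorem AlbIso.of_norm_left (he : e ≠ 0) {x y : F} (h : e = x ^ 2 + x * y + s * y ^ 2) :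
    AlbIso s e s' e' := by
  have h2 : (2 : F) = 0 := CharTwo.two_eq_zero
  exact ⟨e, 0, x, y, 0, 0, fun hh => he hh.1, by grind⟩

theorem AlbIso.of_isotropic_left {x y : F} (h : x ^ 2 + x * y + s * y ^ 2 = 0)
    (hxy : x ≠ 0 ∨ y ≠ 0) : AlbIso s e s' e' :=
  ⟨0, 0, x, y, 0, 0, by tauto, by simp [h]⟩

theorem AlbIso.symm (h : AlbIso s e s' e') : AlbIso s' e' s e := by
  obtain ⟨c0, c1, b0, b1, d0, d1, hne, h⟩ := h
  exact ⟨c0, c1, d0, d1, b0, b1, by tauto, by linear_combination h⟩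

theorem AlbIso.of_right_zero : AlbIso s e s' (0 : F) :=
  ⟨0, 0, 0, 0, 1, 0, by simp, by simp⟩

theorem exists_inv_of_not_albIso (h : ¬ AlbIso s e s' e') {q : ℍ[F,s',1,e']} (hq : q ≠ 0) :
    ∃ r, q * r = 1 ∧ r * q = 1 := by
  have h2 : (2 : F) = 0 := CharTwo.two_eq_zero
  have he' : e' ≠ 0 := by
    rintro rfl
    exact h .of_right_zero
  set n := (q.re ^ 2 + q.re * q.imI + s' * q.imI ^ 2) +
      e' * (q.imJ ^ 2 + q.imJ * q.imK + s' * q.imK ^ 2) with hn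
  have hn0 : n ≠ 0 := by
    intro hn0
    rw [hn0] at hn
    by_cases hy : q.imJ ^ 2 + q.imJ * q.imK + s' * q.imK ^ 2 = 0
    · by_cases hjk : q.imJ ≠ 0 ∨ q.imK ≠ 0
      · exact h (AlbIso.of_isotropic_left hy hjk).symm
      · rw [hy, mul_zero, add_zero] at hn
        by_cases hri : q.re ≠ 0 ∨ q.imI ≠ 0
        · exact h (AlbIso.of_isotropic_left hn.symm hri).symm
        · push Not at hjk hri
          exact hq (by ext <;> simp [hjk, hri])
    · set m := q.imJ ^ 2 + q.imJ * q.imK + s' * q.imK ^ 2 with hm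
      refine h (AlbIso.of_norm_left he' (x := (q.re * (q.imJ + q.imK) + s' * (q.imI * q.imK)) / m)
        (y := (q.re * q.imK + q.imI * q.imJ) / m) ?_).symm
      field_simp
      have : e' * m = q.re ^ 2 + q.re * q.imI + s' * q.imI ^ 2 := by
        linear_combination hn + e' * m * h2
      grind
  refine ⟨n⁻¹ • symConj q, ?_, ?_⟩
  · rw [mul_smul_comm, self_mul_symConj, ← hn, Algebra.algebraMap_eq_smul_one, smul_smul,
      inv_mul_cancel₀ hn0, one_smul]
  · rw [smul_mul_assoc, symConj_mul_self, ← hn, Algebra.algebraMap_eq_smul_one, smul_smul,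
      inv_mul_cancel₀ hn0, one_smul]

theorem ne_zero_of_not_albIso_quadratic (h : ¬ AlbIso s e s' e') (p : ℍ[F,s',1,e']) :
    p * p + p + algebraMap F _ s ≠ 0 := by
  have h2 : (2 : F) = 0 := CharTwo.two_eq_zero
  intro hp
  have h0 := congrArg (·.re) hp
  have h1 := congrArg (·.imI) hp
  have hj := congrArg (·.imJ) hp
  have hk := congrArg (·.imK) hp
  simp [QuaternionAlgebra.algebraMap_eq] at h0 h1 hj hk
  by_cases hI : p.imI = 1
  · refine h ⟨p.re, 1, 0, 0, p.imJ, p.imK, by simp, ?_⟩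
    rw [hI] at h0
    grind
  · have e1 : p.imI = 0 := by grind
    have e2 : p.imJ = 0 := by grind
    have e3 : p.imK = 0 := by grind
    refine h (AlbIso.of_isotropic_left (x := p.re) (y := 1) ?_ (by simp))
    rw [e1, e2, e3] at h0
    linear_combination h0

theorem not_commute_of_not_albIso (h : ¬ AlbIso s e s' e') (p q : ℍ[F,s',1,e'])
    (hc : p * q + q * p = 0) : p * p + p * q + s • (q * q) + algebraMap F _ e ≠ 0 := by
  have h2 : (2 : F) = 0 := CharTwo.two_eq_zero
  have he' : e' ≠ 0 := by
    rintro rfl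
    exact h .of_right_zero
  have he : e ≠ 0 := by
    rintro rfl
    exact h AlbIso.of_right_zero.symm
  intro hp
  have c0 := congrArg (·.re) hc
  have cJ := congrArg (·.imJ) hc
  have cK := congrArg (·.imK) hc
  have h0 := congrArg (·.re) hp
  have h1 := congrArg (·.imI) hp
  have hj := congrArg (·.imJ) hp
  have hk := congrArg (·.imK) hp
  simp [QuaternionAlgebra.algebraMap_eq] at h0 h1 hj hk c0 cJ cK
  have x1 : p.imI * q.imJ + p.imJ * q.imI = 0 := by grind
  have x2 : p.imI * q.imK + p.imK * q.imI = 0 := by grind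
  have x3 : p.imJ * q.imK + p.imK * q.imJ = 0 := by
    have : e' * (p.imJ * q.imK + p.imK * q.imJ) = 0 := by grind
    simpa [he'] using this
  by_cases hq : q.imI = 0 ∧ q.imJ = 0 ∧ q.imK = 0
  · obtain ⟨q1, q2, q3⟩ := hq
    simp only [q1, q2, q3] at h0 h1 hj hk
    by_cases hpF : p.imI = 0 ∧ p.imJ = 0 ∧ p.imK = 0
    · obtain ⟨p1, p2, p3⟩ := hpF
      simp only [p1, p2, p3] at h0
      exact h (AlbIso.of_norm_left he (x := p.re) (y := q.re) (by grind))
    · have hpq : p.imI = q.re := by grind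
      refine h ⟨p.re, q.re, 1, 0, p.imJ, p.imK, by simp, ?_⟩
      rw [hpq] at h0
      grind
  · obtain ⟨μ, m1, m2, m3⟩ : ∃ μ, p.imI = μ * q.imI ∧ p.imJ = μ * q.imJ ∧ p.imK = μ * q.imK := by
      by_cases q1 : q.imI = 0
      · by_cases q2 : q.imJ = 0
        · have q3 : q.imK ≠ 0 := by tauto
          exact ⟨p.imK / q.imK, by field_simp; grind, by field_simp; grind, by field_simp⟩
        · exact ⟨p.imJ / q.imJ, by field_simp; grind, by field_simp, by field_simp; grind⟩
      · exact ⟨p.imI / q.imI, by field_simp, by field_simp; grind, by field_simp; grind⟩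
    set l := p.re + μ * q.re with hl
    set M := μ ^ 2 + μ + s with hM
    have hre : p.re = l + μ * q.re := by rw [hl]; grind
    rw [hre, m1, m2, m3] at h0 h1 hj hk
    have hMl : M * q.imI = l := by
      have g1 : q.imI * (M * q.imI + l) = 0 := by rw [hM]; grind
      have g2 : q.imJ * (M * q.imI + l) = 0 := by rw [hM]; grind
      have g3 : q.imK * (M * q.imI + l) = 0 := by rw [hM]; grind
      have : M * q.imI + l = 0 := by
        by_contra hcon
        simp [hcon] at g1 g2 g3
        exact hq ⟨g1, g2, g3⟩
      linear_combination this - l * h2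
    refine h ⟨M * q.re + μ * l, l, μ, 1, M * q.imJ, M * q.imK, by simp, ?_⟩
    have hN : M * (q.re ^ 2 + q.re * q.imI + s' * q.imI ^ 2 +
      e' * (q.imJ ^ 2 + q.imJ * q.imK + s' * q.imK ^ 2)) = e + l ^ 2 := by
      rw [hM] at hMl ⊢
      grind
    rw [← hMl] at hN ⊢
    rw [hM] at hN ⊢
    grind

section Division
variable {D : Type*} [Ring D] [Algebra F D] (φ : ℍ[F,s',1,e'] →ₐ[F] D) {i j : D}

theorem exists_right_inv_of_not_albIso (h : ¬ AlbIso s e s' e')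
    (hi : i * i = i + algebraMap F D s) (ci : ∀ q, i * φ q = φ q * i)
    (x y : ℍ[F,s',1,e']) (hxy : x ≠ 0 ∨ y ≠ 0) :
    ∃ u v, (φ x + φ y * i) * (φ u + φ v * i) = 1 := by
  by_cases hy : y = 0
  · subst hy
    obtain ⟨r, hr, -⟩ := exists_inv_of_not_albIso h (q := x) (by tauto)
    exact ⟨r, 0, by simp [← map_mul, hr]⟩
  · obtain ⟨y', hy1, hy2⟩ := exists_inv_of_not_albIso h hy
    set p := y' * x with hp
    obtain ⟨q, hq, -⟩ := exists_inv_of_not_albIso h (ne_zero_of_not_albIso_quadratic h p)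
    have hx : x = y * p := by rw [hp, ← mul_assoc, hy1, one_mul]
    refine ⟨(p + 1) * q * y', q * y', ?_⟩
    have h1 : (φ p + i) * (φ ((p + 1) * q) + φ q * i) = 1 := by
      have h0 : ∀ z : D, z + z = 0 := fun x => add_self_eq_zero_of_module F x
      have e1 : (φ p + i) * (φ ((p + 1) * q) + φ q * i) =
          (φ (p * p + p + algebraMap F _ s) * φ q) + (φ p * φ q * i + φ p * φ q * i)
            + (φ q * i + φ q * i) := by
        simp only [map_mul, map_add, map_one, AlgHom.commutes, mul_add, add_mul, one_mul]
        rw [show i * (φ p * φ q) = φ p * φ q * i by rw [← map_mul, ci],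
          show i * (φ q * i) = φ q * i + algebraMap F D s * φ q by
            rw [← mul_assoc, ci, mul_assoc, hi, mul_add, Algebra.commutes], ci]
        noncomm_ring
      rw [e1, h0, h0, add_zero, add_zero, ← map_mul, hq, map_one]
    calc (φ x + φ y * i) * (φ ((p + 1) * q * y') + φ (q * y') * i)
        = φ y * ((φ p + i) * (φ ((p + 1) * q) + φ q * i)) * φ y' := by
          rw [hx, map_mul φ y, map_mul φ _ y', map_mul φ q y', mul_assoc (φ q) (φ y') i, ← ci y',
            ← mul_assoc (φ q), ← add_mul _ _ (φ y'), ← mul_add (φ y)]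
          simp only [mul_assoc]
      _ = 1 := by rw [h1, mul_one, ← map_mul, hy1, map_one]

theorem exists_right_inv_of_not_albIso_full [Nontrivial D] (h : ¬ AlbIso s e s' e')
    (hi : i * i = i + algebraMap F D s) (hj : j * j = algebraMap F D e) (hij : j * i = i * j + j)
    (ci : ∀ q, i * φ q = φ q * i) (cj : ∀ q, j * φ q = φ q * j)
    (x y z w : ℍ[F,s',1,e']) (hne : ¬ (x = 0 ∧ y = 0 ∧ z = 0 ∧ w = 0)) :
    ∃ d, ((φ x + φ y * i) + (φ z + φ w * i) * j) * d = 1 := by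
  have h0 : ∀ z : D, z + z = 0 := fun x => add_self_eq_zero_of_module F x
  have hR := exists_right_inv_of_not_albIso φ h hi ci
  by_cases hzw : z = 0 ∧ w = 0
  · obtain ⟨rfl, rfl⟩ := hzw
    obtain ⟨u, v, huv⟩ := hR x y (by tauto)
    exact ⟨_, by simpa using huv⟩
  · obtain ⟨u, v, huv⟩ := hR z w (by tauto)
    obtain ⟨u', v', huv'⟩ := hR u v (by
      by_contra hcon
      push Not at hcon
      simp [hcon.1, hcon.2] at huv)
    have hinv : (φ u + φ v * i) * (φ z + φ w * i) = 1 := by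
      have : φ z + φ w * i = φ u' + φ v' * i := by
        rw [← mul_one (φ z + φ w * i), ← huv', ← mul_assoc, huv, one_mul]
      rw [this, huv']
    obtain ⟨p, q, hpq⟩ : ∃ p q, (φ u + φ v * i) * (φ x + φ y * i) = φ p + φ q * i := by
      refine ⟨u * x + s • (v * y), u * y + v * x + v * y, ?_⟩
      simp only [map_add, map_mul, map_smul, add_mul, mul_add]
      rw [show φ v * i * (φ y * i) = φ v * φ y * i + s • (φ v * φ y) by
        rw [mul_assoc, ← mul_assoc i, ci, mul_assoc (φ y), hi, mul_add, mul_add,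
          ← Algebra.commutes, ← Algebra.smul_def, mul_smul_comm, mul_assoc],
        show φ v * i * φ x = φ v * φ x * i by rw [mul_assoc, ci, mul_assoc]]
      noncomm_ring
    have key : (φ p + φ q * i + j) * (φ p + φ q + φ q * i + j) =
        φ (p * p + p * q + s • (q * q) + algebraMap F _ e) + φ (p * q + q * p) * i := by
      simp only [map_add, map_mul, map_smul, AlgHom.commutes, add_mul, mul_add]
      rw [show φ q * i * φ p = φ q * φ p * i by rw [mul_assoc, ci, mul_assoc],
        show φ q * i * φ q = φ q * φ q * i by rw [mul_assoc, ci, mul_assoc],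
        show φ q * i * (φ q * i) = φ q * φ q * i + s • (φ q * φ q) by
          rw [mul_assoc, ← mul_assoc i, ci, mul_assoc (φ q), hi, mul_add, mul_add,
            ← Algebra.commutes, ← Algebra.smul_def, mul_smul_comm, mul_assoc],
        show j * (φ q * i) = φ q * i * j + φ q * j by
          rw [← mul_assoc, cj, mul_assoc, hij, mul_add, mul_assoc], cj, cj, hj]
      have : ∀ a b c d g k l m : D, a = b + (g + g) + (k + k) + (l + l) + (m + m) → a = b := by
        intro a b _ _ g k l m hh
        rwa [h0, h0, h0, h0, add_zero, add_zero, add_zero, add_zero] at hh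
      refine this _ _ 0 0 (φ q * φ q * i) (φ q * i * j) (φ q * j) (φ p * j) ?_
      simp only [mul_assoc]
      abel
    obtain ⟨a, b, hab⟩ := hR (p * p + p * q + s • (q * q) + algebraMap F _ e) (p * q + q * p) (by
      by_contra hcon
      push Not at hcon
      exact not_commute_of_not_albIso h p q hcon.2 hcon.1)
    refine ⟨(φ p + φ q + φ q * i + j) * (φ a + φ b * i) * (φ u + φ v * i), ?_⟩
    have hz : φ x + φ y * i + (φ z + φ w * i) * j =
        (φ z + φ w * i) * (φ p + φ q * i + j) := by
      rw [mul_add _ _ j, ← hpq, ← mul_assoc, huv, one_mul]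
    rw [hz, mul_assoc (φ z + φ w * i), ← mul_assoc (φ p + φ q * i + j),
      ← mul_assoc (φ p + φ q * i + j), key, hab, one_mul, huv]

end Division

theorem noZeroDivisors_of_exists_right_inv {D : Type*} [Ring D]
    (h : ∀ z : D, z ≠ 0 → ∃ w, z * w = 1) : NoZeroDivisors D where
  eq_zero_or_eq_zero_of_mul_eq_zero := by
    intro a b hab
    by_cases ha : a = 0
    · exact Or.inl ha
    right
    obtain ⟨c, hc⟩ := h a ha
    by_cases hc0 : c = 0
    · have : (1 : D) = 0 := by rw [← hc, hc0, mul_zero]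
      rw [← one_mul b, this, zero_mul]
    obtain ⟨d, hd⟩ := h c hc0
    have : a = d := by rw [← mul_one a, ← hd, ← mul_assoc, hc, one_mul]
    rw [← one_mul b, ← hd, ← this, mul_assoc, hab, mul_zero]

theorem exists_tensor_eq (t : ℍ[F,s,1,e] ⊗[F] ℍ[F,s',1,e']) :
    ∃ x y z w : ℍ[F,s',1,e'], t = (1 ⊗ₜ x + 1 ⊗ₜ y * symI s e ⊗ₜ 1) +
      (1 ⊗ₜ z + 1 ⊗ₜ w * symI s e ⊗ₜ 1) * symJ s e ⊗ₜ 1 := by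
  induction t with
  | zero => exact ⟨0, 0, 0, 0, by simp⟩
  | tmul p q =>
    refine ⟨p.re • q, p.imI • q, p.imJ • q, p.imK • q, ?_⟩
    simp only [Algebra.TensorProduct.tmul_mul_tmul, one_mul, mul_one, add_mul]
    simp only [← TensorProduct.smul_tmul, ← TensorProduct.add_tmul]
    congr 1
    ext <;> simp [symI, symJ]
  | add t u ht hu =>
    obtain ⟨x, y, z, w, rfl⟩ := ht
    obtain ⟨x', y', z', w', rfl⟩ := hu
    refine ⟨x + x', y + y', z + z', w + w', ?_⟩
    simp only [TensorProduct.tmul_add, add_mul]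
    abel

/-- The biquaternion algebra of two symbols with anisotropic Albert form has no zero divisors. -/
theorem noZeroDivisors_of_not_albIso (h : ¬ AlbIso s e s' e') :
    NoZeroDivisors (ℍ[F,s,1,e] ⊗[F] ℍ[F,s',1,e']) := by
  refine noZeroDivisors_of_exists_right_inv fun t ht => ?_
  obtain ⟨x, y, z, w, rfl⟩ := exists_tensor_eq t
  have c := exists_right_inv_of_not_albIso_full
    (Algebra.TensorProduct.includeRight : ℍ[F,s',1,e'] →ₐ[F] ℍ[F,s,1,e] ⊗[F] ℍ[F,s',1,e']) h
    (i := symI s e ⊗ₜ 1) (j := symJ s e ⊗ₜ 1)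
    (by simp [symI_mul_self, TensorProduct.add_tmul])
    (by simp [symJ_mul_self])
    (by simp [symJ_mul_symI, TensorProduct.add_tmul])
    (by simp) (by simp) x y z w (by
      rintro ⟨rfl, rfl, rfl, rfl⟩
      simp at ht)
  simpa using c

/-- If the sum of two symbols is a symbol then the Albert form is isotropic. -/
theorem AlbIso.of_sym_add_sym {t f : F} (h : sym F s e + sym F s' e' = sym F t f) :
    AlbIso s e s' e' := by
  by_contra hcon
  have he' : e' ≠ 0 := by
    rintro rfl
    exact hcon .of_right_zero
  have he : e ≠ 0 := by
    rintro rfl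
    exact hcon AlbIso.of_right_zero.symm
  obtain ⟨t, f, hf, h⟩ : ∃ t f, f ≠ 0 ∧ sym F s e + sym F s' e' = sym F t f := by
    by_cases hf : f = 0
    · exact ⟨0, 1, one_ne_zero, by rw [h, hf, sym_zero_right, sym_zero_left]⟩
    · exact ⟨t, f, hf, h⟩
  have := isCentral_sym s he
  have := isSimpleRing_sym s he
  have := isCentral_sym s' he'
  have := isSimpleRing_sym s' he'
  have := isCentral_sym t hf
  have := isSimpleRing_sym t hf
  have := noZeroDivisors_of_not_albIso hcon
  rw [sym_eq_cls s he, sym_eq_cls s' he', ← cls_tensor, sym_eq_cls t hf,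
    ← cls_matrix F ℍ[F,t,1,f] 2] at h
  obtain ⟨g⟩ := nonempty_algEquiv_of_cls_eq h
    (by simp [Module.finrank_tensorProduct, Module.finrank_matrix, QuaternionAlgebra.finrank_eq_four])
  let E : Matrix (Fin 2) (Fin 2) ℍ[F,t,1,f] := Matrix.single 0 1 1
  have hE : g.symm E * g.symm E = 0 := by
    rw [← map_mul, Matrix.single_mul_single_of_ne _ _ _ _ (by decide), map_zero]
  rw [mul_self_eq_zero, map_eq_zero_iff _ g.symm.injective] at hE
  have := congrFun (congrFun hE 0) 1
  simp [E] at this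

end Albert
end CharTwoBrauer

namespace CharTwoBrauer
open KaehlerDifferential

section Descent
variable {F K : Type} [Field F] [CharP F 2] [Field K] [CharP K 2] [Algebra F K] {a : F} {θ : K}

theorem IsQuadSep.ne_zero (h : IsQuadSep F a θ) : a ≠ 0 := by
  rintro rfl
  have hm := h.mul_self
  have h1 : θ * (θ - 1) = 0 := by rw [mul_sub, hm]; simp
  rcases mul_eq_zero.1 h1 with h0 | h0
  · exact h.notMem ⟨0, by rw [h0, map_zero]⟩
  · exact h.notMem ⟨1, by rw [map_one]; linear_combination -h0⟩

theorem IsQuadSep.theta_ne_zero (h : IsQuadSep F a θ) : θ ≠ 0 := by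
  rintro rfl
  exact h.notMem ⟨0, map_zero _⟩

/-- Every element of `K` is `y θ'` for a suitable generator `θ'` or lies in the base field. -/
theorem IsQuadSep.exists_translate (h : IsQuadSep F a θ) (β : K) :
    (∃ e, β = algebraMap F K e) ∨ ∃ y c : F, y ≠ 0 ∧
      β = algebraMap F K y * (θ + algebraMap F K c) := by
  obtain ⟨x, y, rfl⟩ := h.exists_eq β
  by_cases hy : y = 0
  · exact Or.inl ⟨x, by simp [hy]⟩
  · have hyK : algebraMap F K y ≠ 0 := by simpa using hy
    refine Or.inr ⟨y, x / y, hy, ?_⟩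
    rw [map_div₀]
    field_simp
    ring

/-- The trace condition satisfied by classes restricted from the base. -/
theorem IsTr.bmap_eq_zero_of_res {T : Ω[K⁄ℤ] →+ Ω[F⁄ℤ]} (hT : IsTr F θ T) (h : IsQuadSep F a θ)
    {x : Br F} (hx : x + x = 0) {κ : Ω[K⁄ℤ]} (hκ : res F K x = bmap K κ) : bmap F (T κ) = 0 := by
  obtain ⟨ω, rfl⟩ := exists_bmap_eq x hx
  have := hT.bmap_eq_zero h (κ := KaehlerDifferential.map ℤ ℤ F K ω + κ) (by
    rw [map_add, ← hκ, res_bmap, bmap_add_self])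
  rwa [map_add T, hT.map, zero_add] at this

variable {T : Ω[K⁄ℤ] →+ Ω[F⁄ℤ]}

theorem IsTr.exists_base (hT : IsTr F θ T) (p q : F) {e : F} (he : e ≠ 0) :
    ∃ κ, bmap K κ = sym K (algebraMap F K p + algebraMap F K q * θ) (algebraMap F K e) ∧
      bmap F (T κ) = sym F q e := by
  have heK : algebraMap F K e ≠ 0 := by simpa using he
  refine ⟨(algebraMap F K p + algebraMap F K q * θ) • KaehlerDifferential.map ℤ ℤ F K (e⁻¹ • KaehlerDifferential.D ℤ F e), ?_, ?_⟩
  · rw [map_smul (KaehlerDifferential.map ℤ ℤ F K), KaehlerDifferential.map_D, ← algebraMap_smul K e⁻¹ (KaehlerDifferential.D ℤ K _),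
      smul_smul, bmap_smul_D, map_inv₀, mul_assoc, inv_mul_cancel₀ heK, mul_one]
  · rw [hT, smul_smul, bmap_smul_D, mul_assoc, inv_mul_cancel₀ he, mul_one]

theorem IsTr.exists_mul (hT : IsTr F θ T) (h : IsQuadSep F a θ) (u v : F) {y : F} (hy : y ≠ 0) :
    ∃ κ, bmap K κ = sym K (algebraMap F K u + algebraMap F K v * θ) (algebraMap F K y * θ) ∧
      bmap F (T κ) = sym F u a + sym F v y := by
  have hyK : algebraMap F K y ≠ 0 := by simpa using hy
  have ha := h.ne_zero
  have haK : algebraMap F K a ≠ 0 := by simpa using ha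
  have hθ := h.theta_ne_zero
  refine ⟨(algebraMap F K (u / a + v) + algebraMap F K (u / a) * θ) • KaehlerDifferential.map ℤ ℤ F K (KaehlerDifferential.D ℤ F a) +
    (algebraMap F K u + algebraMap F K v * θ) • KaehlerDifferential.map ℤ ℤ F K (y⁻¹ • KaehlerDifferential.D ℤ F y), ?_, ?_⟩
  · have hv := h.D_add_mul 0 y
    simp only [map_zero, zero_add] at hv
    rw [sym_eq_bmap _ (mul_ne_zero hyK hθ), hv, smul_add, map_smul (KaehlerDifferential.map ℤ ℤ F K),
      map_smul (KaehlerDifferential.map ℤ ℤ F K), ← algebraMap_smul K y (KaehlerDifferential.map ℤ ℤ F K _),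
      ← algebraMap_smul K y⁻¹ (KaehlerDifferential.map ℤ ℤ F K _), smul_smul, smul_smul, smul_smul]
    have hm := h.mul_self
    have h2 : (2 : K) = 0 := CharTwo.two_eq_zero
    congr 3
    · simp only [map_add, map_div₀]
      field_simp
      grind
    · simp only [map_inv₀]
      field_simp
  · rw [map_add T, hT, hT, map_add, smul_smul, bmap_smul_D, bmap_smul_D, div_mul_cancel₀ _ ha,
      mul_assoc, inv_mul_cancel₀ hy, mul_one]

theorem IsTr.exists_of_left_base (hT : IsTr F θ T) (h : IsQuadSep F a θ) (r : F) (β : K) :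
    ∃ κ f, bmap K κ = sym K (algebraMap F K r) β ∧ bmap F (T κ) = sym F r f := by
  rcases h.exists_translate β with ⟨e, rfl⟩ | ⟨y, c, hy, rfl⟩
  · by_cases he : e = 0
    · exact ⟨0, 0, by simp [he, sym_zero_right]⟩
    obtain ⟨κ, h1, h2⟩ := hT.exists_base r 0 he
    exact ⟨κ, 0, by simpa using h1, by simpa [sym_zero_left, sym_zero_right] using h2⟩
  · obtain ⟨κ, h1, h2⟩ := (hT.translate c).exists_mul (h.translate c) r 0 hy
    exact ⟨κ, _, by simpa using h1, by simpa [sym_zero_left] using h2⟩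

/-- One of the slots of the symbol can be chosen in the subfield `F`. -/
def HasBaseSlot (F : Type) {K : Type} [Field F] [Field K] [CharP K 2] [Algebra F K] (x : Br K) :
    Prop :=
  (∃ (r : F) (y : K), x = sym K (algebraMap F K r) y) ∨
    ∃ (s : K) (e : F), x = sym K s (algebraMap F K e)

theorem exists_sym_eq_norm_div (s e : F) (k l x y : F) (hl : l ≠ 0) :
    ∃ f, sym F s e =
      sym F ((k ^ 2 + k * l + s * l ^ 2 + e * (x ^ 2 + x * y + s * y ^ 2)) / l ^ 2) f := by
  obtain ⟨f, hf⟩ := exists_sym_eq_add s e (k / l) (x / l) (y / l)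
  refine ⟨f, hf.trans ?_⟩
  congr 1
  field_simp
  ring

theorem AlbIso.hasBaseSlot (h : IsQuadSep F a θ) {u v y : F} (hy : y ≠ 0)
    (hA : AlbIso u a v y) :
    HasBaseSlot F (sym K (algebraMap F K u + algebraMap F K v * θ) (algebraMap F K y * θ)) := by
  obtain ⟨c0, c1, b0, b1, d0, d1, hne, hA⟩ := hA
  have h2 : (2 : K) = 0 := CharTwo.two_eq_zero
  have hm := h.mul_self
  set k : K := algebraMap F K (y * d0) * θ with hk
  set X : K := algebraMap F K c0 + algebraMap F K b0 * (1 + θ) with hX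
  set Z : K := algebraMap F K c1 + algebraMap F K b1 * (1 + θ) with hZ
  obtain ⟨n, hn⟩ : ∃ n : F, k ^ 2 + k * algebraMap F K (y * d1) +
      (algebraMap F K u + algebraMap F K v * θ) * algebraMap F K (y * d1) ^ 2 +
      (algebraMap F K y * θ) * (X ^ 2 + X * Z + (algebraMap F K u + algebraMap F K v * θ) * Z ^ 2) =
      algebraMap F K n := by
    refine ⟨y ^ 2 * d0 ^ 2 * a + u * y ^ 2 * d1 ^ 2 + y * (a * b0 ^ 2 + a * (c0 * b1 + c1 * b0) +
      a * b0 * b1 + u * a * b1 ^ 2 + v * a * c1 ^ 2 + v * a ^ 2 * b1 ^ 2), ?_⟩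
    have hAK := congrArg (algebraMap F K) hA
    rw [hk, hX, hZ]
    simp only [map_add, map_mul, map_pow, map_zero] at hAK ⊢
    generalize algebraMap F K y = y, algebraMap F K u = u, algebraMap F K v = v,
      algebraMap F K a = a, algebraMap F K c0 = c0, algebraMap F K c1 = c1,
      algebraMap F K b0 = b0, algebraMap F K b1 = b1, algebraMap F K d0 = d0,
      algebraMap F K d1 = d1 at *
    grind
  by_cases hd1 : d1 = 0
  · subst hd1
    have hXZ : X ≠ 0 ∨ Z ≠ 0 := by
      by_contra hcon
      push Not at hcon
      have g0 := h.eq_zero_of_add (x := c0 + b0) (y := b0) (by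
        rw [← hcon.1, hX, map_add]; ring)
      have g1 := h.eq_zero_of_add (x := c1 + b1) (y := b1) (by
        rw [← hcon.2, hZ, map_add]; ring)
      obtain ⟨g0, rfl⟩ := g0
      obtain ⟨g1, rfl⟩ := g1
      rw [add_zero] at g0 g1
      subst g0 g1
      simp [hy] at hA hne
      exact hne hA
    obtain ⟨t, ht⟩ := exists_sym_eq_right (algebraMap F K u + algebraMap F K v * θ)
      (algebraMap F K y * θ) k X Z hXZ
    refine Or.inr ⟨t, n, ht.trans ?_⟩
    rw [← hn]
    simp
  · have hl : algebraMap F K (y * d1) ≠ 0 := by simp [hy, hd1]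
    obtain ⟨f, hf⟩ := exists_sym_eq_norm_div (algebraMap F K u + algebraMap F K v * θ)
      (algebraMap F K y * θ) k _ X Z hl
    rw [hn] at hf
    exact Or.inl ⟨n / (y * d1) ^ 2, f, by rw [hf, map_div₀, map_pow]⟩

theorem IsQuadSep.exists_descent_right (h : IsQuadSep F a θ) {x : Br F} (hx : x + x = 0)
    (α : K) (e : F) (hα : res F K x = sym K α (algebraMap F K e)) :
    ∃ s f, sym K α (algebraMap F K e) = res F K (sym F s f) := by
  have h2 : (2 : K) = 0 := CharTwo.two_eq_zero
  have h2' : (2 : F) = 0 := CharTwo.two_eq_zero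
  have hm := h.mul_self
  by_cases he : e = 0
  · exact ⟨0, 0, by simp [he, sym_zero_right]⟩
  obtain ⟨T, hT⟩ := h.exists_isTr
  obtain ⟨p, q, rfl⟩ := h.exists_eq α
  obtain ⟨κ, h1, h3⟩ := hT.exists_base p q he
  rw [hT.bmap_eq_zero_of_res h hx (hα.trans h1.symm)] at h3
  obtain ⟨k, l, hkl⟩ := exists_norm_of_sym_eq_zero he h3.symm
  by_cases hl : l = 0
  · refine ⟨0, 0, ?_⟩
    rw [hkl, hl, sym_zero_right, map_zero]
    simp only [mul_zero, add_zero, ne_eq, OfNat.ofNat_ne_zero, not_false_eq_true, zero_pow,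
      map_pow]
    exact sym_sq_right _ _
  · set c := e / l ^ 2 with hc
    set g := k / l with hg
    have hq : q = c + (g ^ 2 + g) := by
      rw [hc, hg]
      field_simp
      grind
    have hce : e = c * l ^ 2 := by rw [hc]; field_simp
    refine ⟨p + a * g ^ 2 + c * a, c, ?_⟩
    have hlK : algebraMap F K l ≠ 0 := by simpa using hl
    rw [hce, map_mul, map_pow, sym_mul_sq _ _ hlK, res_sym, map_add _ _ (c * a),
      ← sym_add_left (algebraMap F K (p + a * g ^ 2))]
    have e1 : sym K (algebraMap F K (c * a)) (algebraMap F K c) =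
        sym K (θ * algebraMap F K c) (algebraMap F K c) := by
      have := h.bmap_theta_D c
      rw [map_smul (map ℤ ℤ F K), KaehlerDifferential.map_D, KaehlerDifferential.map_D, bmap_smul_D,
        ← algebraMap_smul K c (D ℤ K _), bmap_smul_D] at this
      rw [this, map_mul, mul_comm, sym_mul_self]
    rw [e1, sym_add_left, ← sym_add_artinSchreier _ _ (θ * algebraMap F K g), hq]
    congr 1
    simp only [map_add, map_mul, map_pow]
    grind

theorem IsQuadSep.exists_descent_left (h : IsQuadSep F a θ) {x : Br F} (hx : x + x = 0)
    (r : F) (β : K) (hα : res F K x = sym K (algebraMap F K r) β) :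
    ∃ s f, sym K (algebraMap F K r) β = res F K (sym F s f) := by
  have h2 : (2 : K) = 0 := CharTwo.two_eq_zero
  rcases h.exists_translate β with ⟨e, rfl⟩ | ⟨y, c, hy, rfl⟩
  · exact ⟨r, e, (res_sym _ _).symm⟩
  have h' := h.translate c
  set a' := a + (c ^ 2 + c) with ha'
  set θ' := θ + algebraMap F K c with hθ'
  obtain ⟨T, hT⟩ := h'.exists_isTr
  obtain ⟨κ, h1, h3⟩ := hT.exists_mul h' r 0 hy
  rw [map_zero, zero_mul, add_zero] at h1
  rw [hT.bmap_eq_zero_of_res h' hx (hα.trans h1.symm), sym_zero_left, add_zero] at h3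
  obtain ⟨k, l, hkl⟩ := exists_norm_of_sym_eq_zero h'.ne_zero h3.symm
  have hm := h'.mul_self
  set b := algebraMap F K y * θ' with hb
  have hb0 : b ≠ 0 := mul_ne_zero (by simpa using hy) h'.theta_ne_zero
  set P := algebraMap F K (y * k) + b with hP
  have hN : P ^ 2 + P * algebraMap F K (y * l) + algebraMap F K r * algebraMap F K (y * l) ^ 2 =
      b * algebraMap F K (y + y * l) := by
    have := congrArg (algebraMap F K) hkl
    rw [hP, hb]
    simp only [map_add, map_mul, map_pow] at this ⊢
    grind
  by_cases hyl : y + y * l = 0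
  · have hl : y * l ≠ 0 := by
      intro hl
      rw [hl, add_zero] at hyl
      exact hy hyl
    rw [hyl, map_zero, mul_zero] at hN
    obtain ⟨t, ht⟩ := exists_artinSchreier_of_isotropic hN (Or.inr (by simpa using hl))
    exact ⟨0, 0, by rw [ht, sym_artinSchreier, sym_zero_left, map_zero]⟩
  · refine ⟨r, y + y * l, ?_⟩
    have := sym_norm (algebraMap F K r) P (algebraMap F K (y * l))
    rw [hN, ← sym_mul_right _ hb0 (by rwa [Ne, map_eq_zero]), ← res_sym] at this
    rw [eq_neg_of_add_eq_zero_left this, res_sym, sym_neg]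

/-- A symbol over a separable quadratic extension which is a restriction is the restriction of
a symbol. -/
theorem IsQuadSep.exists_descent (h : IsQuadSep F a θ) {x : Br F} (hx : x + x = 0)
    {α β : K} (hα : res F K x = sym K α β) : ∃ s f, res F K x = res F K (sym F s f) := by
  rcases h.exists_translate β with ⟨e, rfl⟩ | ⟨y, c, hy, rfl⟩
  · rw [hα]
    exact h.exists_descent_right hx _ _ hα
  have h' := h.translate c
  obtain ⟨u, v, rfl⟩ := h'.exists_eq α
  obtain ⟨T, hT⟩ := h'.exists_isTr
  obtain ⟨κ, h1, h3⟩ := hT.exists_mul h' u v hy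
  rw [hT.bmap_eq_zero_of_res h' hx (hα.trans h1.symm)] at h3
  have hA : AlbIso u (a + (c ^ 2 + c)) v y :=
    AlbIso.of_sym_add_sym (t := 0) (f := 0) (by rw [← h3, sym_zero_right])
  rcases hA.hasBaseSlot h' hy with ⟨r, z, hr⟩ | ⟨s, e, hs⟩
  · rw [hα, hr]
    exact h.exists_descent_left hx r z (hα.trans hr)
  · rw [hα, hs]
    exact h.exists_descent_right hx s e (hα.trans hs)

theorem IsQuadSep.symLE_two (h : IsQuadSep F a θ) {x : Br F} (hx : x + x = 0)
    {α β : K} (hα : res F K x = sym K α β) : SymLE x 2 := by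
  obtain ⟨s, f, hsf⟩ := h.exists_descent hx hα
  rw [← sub_eq_zero, ← map_sub] at hsf
  obtain ⟨c, -, hc⟩ := exists_eq_sym_of_res_eq_zero_sep h hsf
  rw [sub_eq_iff_eq_add'] at hc
  rw [hc]
  exact (SymLE.sym _ _).add (.sym _ _)

end Descent
end CharTwoBrauer

namespace CharTwoBrauer

section AntiAut
variable {F A B : Type} [Field F] [Ring A] [Algebra F A] [Algebra.IsCentral F A] [IsSimpleRing A]
  [FiniteDimensional F A] [Ring B] [Algebra F B] [IsSimpleRing B] [FiniteDimensional F B]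

/-- An anti-endomorphism of a simple subalgebra extends to an anti-automorphism of an algebra
whose Brauer class is killed by two. -/
theorem exists_antiAut (hA : cls F A + cls F A = 0) (ι : B →ₐ[F] A) (γ : B →ₗ[F] B)
    (h1 : γ 1 = 1) (hmul : ∀ x y, γ (x * y) = γ y * γ x) :
    ∃ σ : A →ₗ[F] A, Function.Injective σ ∧ σ 1 = 1 ∧ (∀ x y, σ (x * y) = σ y * σ x) ∧
      ∀ b, σ (ι b) = ι (γ b) := by
  have hop : cls F A = cls F Aᵐᵒᵖ := by rw [cls_op, eq_neg_iff_add_eq_zero, hA]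
  obtain ⟨τ⟩ := nonempty_algEquiv_of_cls_eq hop
    (MulOpposite.opLinearEquiv F (M := A)).finrank_eq
  let f : B →ₐ[F] Aᵐᵒᵖ := AlgHom.ofLinearMap
    ((MulOpposite.opLinearEquiv F (M := A)).toLinearMap ∘ₗ ι.toLinearMap ∘ₗ γ)
    (by simp [h1]) (by simp [hmul])
  obtain ⟨u, hu⟩ := skolemNoether (τ.toAlgHom.comp ι) f
  refine ⟨(MulOpposite.opLinearEquiv F (M := A)).symm.toLinearMap ∘ₗ
    LinearMap.mulLeft F (u : Aᵐᵒᵖ) ∘ₗ LinearMap.mulRight F (↑u⁻¹ : Aᵐᵒᵖ) ∘ₗ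
      τ.toLinearEquiv.toLinearMap, ?_, ?_, ?_, ?_⟩
  · intro x y hxy
    have h2 : (u : Aᵐᵒᵖ) * (τ x * ↑u⁻¹) = u * (τ y * ↑u⁻¹) := MulOpposite.unop_injective hxy
    simpa using h2
  · simp
  · intro x y
    apply MulOpposite.op_injective
    simp [mul_assoc]
  · intro b
    apply MulOpposite.op_injective
    have h2 : MulOpposite.op (ι (γ b)) = u * τ (ι b) * ↑u⁻¹ := hu b
    simp [h2, mul_assoc]
end AntiAut

/-- An algebra `A` is `B + B u` if `u` shifts an element commuting with `B` and dimensions match. -/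
theorem exists_add_mul_unit_eq {F A B : Type*} [Field F] [CharP F 2] [Ring A] [Algebra F A]
    [FiniteDimensional F A] [Ring B] [Algebra F B] [FiniteDimensional F B] {ι : B →ₐ[F] A}
    (hι : Function.Injective ι) (hd : Module.finrank F A = 2 * Module.finrank F B) {t : A} {u : Aˣ}
    (hu : u * t = t * u + u) (ht : ∀ b, ι b * t = t * ι b) (v : A) :
    ∃ b b', v = ι b + ι b' * u ∧ v * t = t * v + ι b' * u := by
  have key : ∀ b b', (ι b + ι b' * u) * t = t * (ι b + ι b' * u) + ι b' * u := by
    intro b b'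
    rw [add_mul, mul_assoc, hu, ht, mul_add, mul_add, ← mul_assoc (ι b'), ht, mul_assoc]
    abel
  let T : B × B →ₗ[F] A := LinearMap.coprod ι.toLinearMap
    ((LinearMap.mulRight F (u : A)).comp ι.toLinearMap)
  have hT : Function.Injective T := by
    rw [injective_iff_map_eq_zero]
    rintro ⟨b, b'⟩ hab
    have h0 : ι b + ι b' * u = 0 := by simpa [T] using hab
    have h1 := key b b'
    rw [h0, zero_mul, mul_zero, zero_add, eq_comm, Units.mul_left_eq_zero] at h1
    rw [h1, zero_mul, add_zero] at h0
    rw [map_eq_zero_iff _ hι] at h0 h1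
    simp [h0, h1]
  have hs := (LinearMap.injective_iff_surjective_of_finrank_eq_finrank (f := T) (by
    rw [Module.finrank_prod, hd, two_mul])).mp hT
  obtain ⟨⟨b, b'⟩, rfl⟩ := hs v
  exact ⟨b, b', by simp [T], by simpa [T] using key b b'⟩

section Core
variable {F K A B : Type*} [Field F] [CharP F 2] [Field K] [Algebra F K] [Ring A] [Algebra F A]
  [FiniteDimensional F A] [Ring B] [Algebra F B] [Algebra K B] [IsScalarTower F K B]
  [FiniteDimensional F B] [Algebra.IsCentral K B] [NoZeroDivisors B] [Nontrivial B]
  {a : F} {θ : K} {ι : B →ₐ[F] A}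

/-- Conjugation by a unit shifting `t` preserves the centralizer of `t`. -/
theorem exists_mul_unit_eq (hι : Function.Injective ι)
    (hd : Module.finrank F A = 2 * Module.finrank F B) {t : A} {u : Aˣ}
    (hu : u * t = t * u + u) (ht : ∀ b, ι b * t = t * ι b) (b : B) :
    ∃ b', u * ι b = ι b' * u := by
  obtain ⟨c, c', h1, h2⟩ := exists_add_mul_unit_eq hι hd hu ht (u * ι b * ↑u⁻¹)
  have h3 : u * ι b * ↑u⁻¹ * t = t * (u * ι b * ↑u⁻¹) := by
    have h4 : (↑u⁻¹ : A) * t = t * ↑u⁻¹ + ↑u⁻¹ := by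
      rw [Units.inv_mul_eq_iff_eq_mul, mul_add, ← mul_assoc, hu, add_mul, mul_assoc,
        Units.mul_inv, mul_one, add_assoc, add_self_eq_zero_of_module F, add_zero]
    have h5 : (u : A) * t = t * u + u := hu
    calc u * ι b * ↑u⁻¹ * t = u * (ι b * t) * ↑u⁻¹ + u * ι b * ↑u⁻¹ := by
          rw [mul_assoc, h4]; noncomm_ring
      _ = (u * t) * ι b * ↑u⁻¹ + u * ι b * ↑u⁻¹ := by rw [ht]; noncomm_ring
      _ = t * (u * ι b * ↑u⁻¹) + (u * ι b * ↑u⁻¹ + u * ι b * ↑u⁻¹) := by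
          rw [h5]; noncomm_ring
      _ = _ := by rw [add_self_eq_zero_of_module F, add_zero]
  have h6 : ι c' * u = 0 := by
    have := h2.symm.trans h3
    simpa using this
  rw [h6, add_zero] at h1
  exact ⟨c, by rw [← h1]; simp⟩

theorem unit_mul_algebraMap {u : A} (hu : u * ι (algebraMap K B θ) = ι (algebraMap K B θ) * u + u)
    (p q : F) : u * ι (algebraMap K B (algebraMap F K p + algebraMap F K q * θ)) =
      ι (algebraMap K B (algebraMap F K p + algebraMap F K q * θ)) * u + q • u := by
  simp only [map_add, map_mul, ← IsScalarTower.algebraMap_apply F K B, AlgHom.commutes]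
  rw [mul_add, ← mul_assoc, ← Algebra.commutes, ← Algebra.commutes, mul_assoc, hu, Algebra.smul_def]
  noncomm_ring

/-- A shifting unit that commutes with an element of `K` puts that element in the base field. -/
theorem IsQuadSep.exists_eq_of_commute (h : IsQuadSep F a θ) {u : A} (hu0 : u ≠ 0)
    (hu : u * ι (algebraMap K B θ) = ι (algebraMap K B θ) * u + u) {k : K}
    (hk : u * ι (algebraMap K B k) = ι (algebraMap K B k) * u) : ∃ p, k = algebraMap F K p := by
  obtain ⟨p, q, rfl⟩ := h.exists_eq k
  rw [unit_mul_algebraMap hu, add_eq_left, smul_eq_zero_iff_left hu0] at hk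
  exact ⟨p, by simp [hk]⟩

/-- A shifting unit that commutes with a quadratic element over `K` puts the coefficients of its
equation in the base field. -/
theorem IsQuadSep.exists_coeff_of_commute (h : IsQuadSep F a θ) (hι : Function.Injective ι) {u : Aˣ}
    (hu : u * ι (algebraMap K B θ) = ι (algebraMap K B θ) * u + u) {y : B}
    (hy : u * ι y = ι y * u) (hyK : y ∉ (algebraMap K B).range) {k n : K}
    (hyy : y * y = algebraMap K B k * y + algebraMap K B n) :
    (∃ p, k = algebraMap F K p) ∧ ∃ p, n = algebraMap F K p := by
  obtain ⟨p, q, rfl⟩ := h.exists_eq k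
  obtain ⟨p', q', rfl⟩ := h.exists_eq n
  have h1 : u * ι (y * y) = ι (y * y) * u := by
    rw [map_mul, ← mul_assoc, hy, mul_assoc, hy, mul_assoc]
  rw [hyy, map_add, map_mul, mul_add, ← mul_assoc, unit_mul_algebraMap hu, unit_mul_algebraMap hu,
    add_mul, mul_assoc, hy, add_mul, ← mul_assoc, smul_mul_assoc, hy] at h1
  have h2 : (ι (q • y + algebraMap F B q')) * u = 0 := by
    have h3 : ∀ x y z w : A, x + y + (z + w) = x + z → y + w = 0 := fun x y z w hx => by
      rwa [add_add_add_comm, add_eq_left] at hx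
    have := h3 _ _ _ _ h1
    rw [map_add, map_smul, AlgHom.commutes, add_mul, smul_mul_assoc, ← Algebra.smul_def, this]
  rw [Units.mul_left_eq_zero, map_eq_zero_iff _ hι] at h2
  have hq : q = 0 := by
    by_contra hq
    refine hyK ⟨algebraMap F K (-(q⁻¹ * q')), ?_⟩
    rw [← IsScalarTower.algebraMap_apply, map_neg, neg_eq_iff_add_eq_zero, map_mul,
      ← Algebra.smul_def, add_comm]
    have h4 := congrArg (q⁻¹ • ·) h2
    simpa [smul_smul, hq] using h4
  have hq' : q' = 0 := by
    simpa [hq] using h2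
  exact ⟨⟨p, by simp [hq]⟩, p', by simp [hq']⟩

theorem isUnit_of_ne_zero_of_finite (F : Type*) {B : Type*} [Field F] [Ring B] [Algebra F B]
    [FiniteDimensional F B] [NoZeroDivisors B] {b : B} (hb : b ≠ 0) : IsUnit b := by
  have : IsArtinianRing B := IsArtinianRing.of_finite F B
  exact IsArtinianRing.isUnit_of_mem_nonZeroDivisors (mem_nonZeroDivisors_of_ne_zero hb)

variable {σ : A →ₗ[F] A} {γ : B →ₗ[K] B}

/-- A unit shifting `θ` can be chosen symmetric under an anti-automorphism extending `γ`. -/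
theorem IsQuadSep.exists_symmetric_unit (h : IsQuadSep F a θ) (hι : Function.Injective ι)
    (hd : Module.finrank F A = 2 * Module.finrank F B)
    (hγ1 : γ 1 = 1) (hγγ : ∀ b, γ (γ b) = b)
    (hσi : Function.Injective σ) (hσm : ∀ x y, σ (x * y) = σ y * σ x)
    (hσ : ∀ b, σ (ι b) = ι (γ b)) {u : Aˣ}
    (hu : u * ι (algebraMap K B θ) = ι (algebraMap K B θ) * u + u) :
    ∃ w : Aˣ, w * ι (algebraMap K B θ) = ι (algebraMap K B θ) * w + w ∧ σ w = w := by
  have : Nontrivial A := hι.nontrivial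
  have hγK : ∀ k, γ (algebraMap K B k) = algebraMap K B k := fun k => by
    rw [Algebra.algebraMap_eq_smul_one, map_smul, hγ1]
  have ht : ∀ k b, ι b * ι (algebraMap K B k) = ι (algebraMap K B k) * ι b := fun k b => by
    rw [← map_mul, ← map_mul, Algebra.commutes]
  have hsh : ∀ v, v * ι (algebraMap K B θ) = ι (algebraMap K B θ) * v + v →
      σ v * ι (algebraMap K B θ) = ι (algebraMap K B θ) * σ v + σ v := by
    intro v hv
    have h1 := congrArg σ hv
    rw [hσm, map_add, hσm, hσ, hγK] at h1
    rw [h1, add_assoc, add_self_eq_zero_of_module F, add_zero]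
  have hsemi : ∀ v, v * ι (algebraMap K B θ) = ι (algebraMap K B θ) * v + v →
      ∃ b, v = ι b * u := by
    intro v hv
    obtain ⟨b, b', h1, h2⟩ := exists_add_mul_unit_eq hι hd hu (ht θ) v
    exact ⟨b', by rw [h2] at hv; exact (add_left_cancel hv).symm⟩
  have hne : σ u ≠ 0 := by
    rw [Ne, map_eq_zero_iff σ hσi]; exact u.ne_zero
  have hus := hsh _ hu
  obtain ⟨d, hdu⟩ := hsemi _ hus
  obtain ⟨c, hcu⟩ := hsemi _ (hsh _ hus)
  have hc : c ∈ Subalgebra.center K B := by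
    rw [Subalgebra.mem_center_iff]
    intro b'
    have hu' : (↑u⁻¹ : A) * ι (algebraMap K B θ) = ι (algebraMap K B θ) * ↑u⁻¹ + ↑u⁻¹ := by
      rw [Units.inv_mul_eq_iff_eq_mul, mul_add, ← mul_assoc, hu, add_mul, mul_assoc,
        Units.mul_inv, mul_one, add_assoc, add_self_eq_zero_of_module F, add_zero]
    obtain ⟨b, hb⟩ := exists_mul_unit_eq hι hd hu' (ht θ) b'
    have hb2 : u * ι b = ι b' * u := by
      rw [Units.inv_mul_eq_iff_eq_mul] at hb
      rw [hb]; simp [mul_assoc]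
    have h1 := congrArg (fun x => σ (σ x)) hb2
    simp only [hσm, hσ, hγγ, hcu] at h1
    rw [mul_assoc, hb2, ← mul_assoc, ← mul_assoc, Units.mul_left_inj, ← map_mul, ← map_mul] at h1
    exact (hι h1).symm
  rw [Algebra.IsCentral.center_eq_bot, Algebra.mem_bot] at hc
  obtain ⟨k, rfl⟩ := hc
  have hk : σ u * ι (algebraMap K B k) = ι (algebraMap K B k) * σ u := by
    have h1 := congrArg (fun x => σ (σ x)) hdu
    simp only [hσm, hσ, hγγ] at h1
    rw [hcu, hσm, hσ, hγK, ← mul_assoc, ht, mul_assoc, ← hdu] at h1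
    exact h1
  obtain ⟨p, rfl⟩ := h.exists_eq_of_commute hne hus hk
  rw [← IsScalarTower.algebraMap_apply, AlgHom.commutes, ← Algebra.smul_def] at hcu
  have hp : p = 1 := by
    obtain ⟨b, b', h1, h2⟩ := exists_add_mul_unit_eq hι hd hu (ht θ) (u * u)
    have h3 : (u : A) * u * ι (algebraMap K B θ) = ι (algebraMap K B θ) * (u * u) := by
      rw [mul_assoc, hu, mul_add, ← mul_assoc, hu, add_mul, add_assoc,
        add_self_eq_zero_of_module F, add_zero, mul_assoc]
    rw [h3, left_eq_add] at h2
    rw [h2, add_zero] at h1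
    have h4 := congrArg (fun x => σ (σ x)) h1
    simp only [hσm, hσ, hγγ, hcu] at h4
    rw [smul_mul_smul_comm, ← h1, ← Units.val_mul] at h4
    have h5 : (p * p - 1) • ((u * u : Aˣ) : A) = 0 := by rw [sub_smul, h4, one_smul, sub_self]
    rw [smul_eq_zero_iff_left (Units.ne_zero _)] at h5
    have h6 : (p + 1) ^ 2 = 0 := by
      have h2 : (2 : F) = 0 := CharTwo.two_eq_zero
      linear_combination h5 + (p + 1) * h2
    have h7 := pow_eq_zero_iff (two_ne_zero) |>.1 h6
    exact CharTwo.add_eq_zero.1 h7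
  rw [hp, one_smul] at hcu
  by_cases h0 : 1 + d = 0
  · have hd1 : d = 1 := (eq_of_add_eq_zero_of_module F h0).symm
    exact ⟨u, hu, by rw [hdu, hd1, map_one, one_mul]⟩
  · obtain ⟨w, hw⟩ := (isUnit_of_ne_zero_of_finite F h0).map ι
    have hw' : ((w * u : Aˣ) : A) = u + σ u := by
      rw [Units.val_mul, hw, map_add, map_one, add_mul, one_mul, hdu]
    refine ⟨w * u, ?_, ?_⟩
    · rw [hw', add_mul, hu, hus]; noncomm_ring
    · rw [hw', map_add, hcu, add_comm]

/-- The algebra `B` contains a noncentral symmetrized element commuting with a unit that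
shifts `θ`. -/
theorem IsQuadSep.exists_symmetrized_commute (h : IsQuadSep F a θ) (hι : Function.Injective ι)
    (hd : Module.finrank F A = 2 * Module.finrank F B)
    (hγ1 : γ 1 = 1) (hγγ : ∀ b, γ (γ b) = b)
    (hσi : Function.Injective σ) (hσm : ∀ x y, σ (x * y) = σ y * σ x)
    (hσ : ∀ b, σ (ι b) = ι (γ b)) {u₀ : Aˣ}
    (hu₀ : u₀ * ι (algebraMap K B θ) = ι (algebraMap K B θ) * u₀ + u₀)
    {i z₀ : B} (hi : γ i = i + 1) (hz : z₀ + γ z₀ ∉ (algebraMap K B).range) :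
    ∃ z, z + γ z ∉ (algebraMap K B).range ∧ ∃ u : Aˣ,
      u * ι (algebraMap K B θ) = ι (algebraMap K B θ) * u + u ∧
      u * ι (z + γ z) = ι (z + γ z) * u := by
  obtain ⟨u, hu, hus⟩ := h.exists_symmetric_unit hι hd hγ1 hγγ hσi hσm hσ hu₀
  have ht : ∀ k b, ι b * ι (algebraMap K B k) = ι (algebraMap K B k) * ι b := fun k b => by
    rw [← map_mul, ← map_mul, Algebra.commutes]
  obtain ⟨i', hi'⟩ := exists_mul_unit_eq hι hd hu (ht θ) i
  obtain ⟨b, b', h1, h2⟩ := exists_add_mul_unit_eq hι hd hu (ht θ) (u * u)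
  have h3 : (u : A) * u * ι (algebraMap K B θ) = ι (algebraMap K B θ) * (u * u) := by
    rw [mul_assoc, hu, mul_add, ← mul_assoc, hu, add_mul, add_assoc,
      add_self_eq_zero_of_module F, add_zero, mul_assoc]
  rw [h3, left_eq_add] at h2
  rw [h2, add_zero] at h1
  have h4 : u * ι i * u = ι (i' * b) := by rw [hi', mul_assoc, h1, map_mul]
  have h5 : ι (i' * b + γ (i' * b)) = u * u := by
    rw [map_add, ← hσ, ← h4, hσm, hσm, hσ, hi, hus, map_add, map_one, add_mul, mul_add, one_mul,
      ← mul_assoc, ← add_assoc, add_self_eq_zero_of_module F, zero_add]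
  by_cases hy : i' * b + γ (i' * b) ∈ (algebraMap K B).range
  swap
  · exact ⟨_, hy, u, hu, by rw [h5, mul_assoc]⟩
  obtain ⟨k, hk⟩ := hy
  rw [← hk] at h5
  obtain ⟨z', hz'⟩ := exists_mul_unit_eq hι hd hu (ht θ) z₀
  have hz'' : u * ι z' = ι z₀ * u := by
    rw [← Units.mul_left_inj u, mul_assoc, ← hz', ← mul_assoc, ← h5, ← ht, h5, mul_assoc]
  have hs : u * ι (γ z') = ι (γ z₀) * u := by
    have := congrArg σ hz'
    rwa [hσm, hσm, hσ, hσ, hus, eq_comm] at this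
  have hs' : u * ι (γ z₀) = ι (γ z') * u := by
    have := congrArg σ hz''
    rwa [hσm, hσm, hσ, hσ, hus, eq_comm] at this
  have hx : u * ι (z₀ + γ z₀) = ι (z' + γ z') * u := by
    rw [map_add, map_add, mul_add, add_mul, hz', hs']
  have hx' : u * ι (z' + γ z') = ι (z₀ + γ z₀) * u := by
    rw [map_add, map_add, mul_add, add_mul, hz'', hs]
  by_cases hy : (z₀ + z') + γ (z₀ + z') ∈ (algebraMap K B).range
  swap
  · refine ⟨_, hy, u, hu, ?_⟩
    have h6 : (z₀ + z') + γ (z₀ + z') = (z₀ + γ z₀) + (z' + γ z') := by rw [map_add]; abel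
    rw [h6, map_add, mul_add, hx, hx', add_mul, add_comm]
  have h6 : (θ • z₀ + (θ + 1) • z') + γ (θ • z₀ + (θ + 1) • z') =
      algebraMap K B θ * (z₀ + γ z₀) + (algebraMap K B θ + 1) * (z' + γ z') := by
    simp only [map_add, map_smul]
    simp only [Algebra.smul_def, map_add, map_one]
    noncomm_ring
  refine ⟨θ • z₀ + (θ + 1) • z', ?_, u, hu, ?_⟩
  · rw [h6]
    rintro ⟨m, hm⟩
    obtain ⟨n, hn⟩ := hy
    have h7 : algebraMap K B (m + θ * n) = z' + γ z' := by
      rw [map_add, map_mul, hm, hn]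
      have h8 : ∀ x y w : B, (x * y + (x + 1) * w) + x * (y + w) = w := fun x y w => by
        have : (x * y + (x + 1) * w) + x * (y + w) = (x * (y + w) + x * (y + w)) + w := by
          noncomm_ring
        rw [this, add_self_eq_zero_of_module F, zero_add]
      rw [map_add, ← add_add_add_comm, h8]
    refine hz ⟨n + (m + θ * n), ?_⟩
    rw [map_add, hn, h7, map_add, add_add_add_comm z₀, add_assoc, add_self_eq_zero_of_module F,
      add_zero]
  · rw [h6]
    generalize z₀ + γ z₀ = x at *
    generalize z' + γ z' = x' at *
    rw [map_add, map_mul, map_mul, map_add, map_one, mul_add, ← mul_assoc, hu, ← mul_assoc, mul_add,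
      hu, mul_one, add_assoc _ (u : A), add_self_eq_zero_of_module F, add_zero, ← add_one_mul,
      mul_assoc, hx, mul_assoc, hx']
    noncomm_ring

end Core

end CharTwoBrauer

namespace CharTwoBrauer
open Quaternion

section TensorConj
variable {K : Type} [Field K] [CharP K 2] {s e s' e' : K}

/-- The canonical involution of a symbol algebra as a linear map. -/
def symConjLin (s e : K) : ℍ[K,s,1,e] →ₗ[K] ℍ[K,s,1,e] where
  toFun := symConj
  map_add' x y := by ext <;> simp [symConj]; ring
  map_smul' c x := by ext <;> simp [symConj]; ring

theorem symConj_mul (p q : ℍ[K,s,1,e]) : symConj (p * q) = symConj q * symConj p := by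
  have h2 : (2 : K) = 0 := CharTwo.two_eq_zero
  ext <;> simp [symConj] <;> grind

theorem symConj_symConj (p : ℍ[K,s,1,e]) : symConj (symConj p) = p := by
  have h2 : (2 : K) = 0 := CharTwo.two_eq_zero
  ext <;> simp [symConj]; grind

theorem symConj_eq (p : ℍ[K,s,1,e]) : symConj p = p + algebraMap K _ p.imI := by
  ext <;> simp [symConj, QuaternionAlgebra.algebraMap_eq]

/-- The tensor product of two canonical involutions. -/
noncomputable def tensorConj (s e s' e' : K) :
    ℍ[K,s,1,e] ⊗[K] ℍ[K,s',1,e'] →ₗ[K] ℍ[K,s,1,e] ⊗[K] ℍ[K,s',1,e'] :=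
  TensorProduct.map (symConjLin s e) (symConjLin s' e')

theorem tensorConj_tmul (p : ℍ[K,s,1,e]) (q : ℍ[K,s',1,e']) :
    tensorConj s e s' e' (p ⊗ₜ q) = symConj p ⊗ₜ symConj q := rfl

theorem tensorConj_one : tensorConj s e s' e' 1 = 1 := by
  rw [Algebra.TensorProduct.one_def, tensorConj_tmul, symConj_eq, symConj_eq]
  simp

theorem tensorConj_mul (x y) : tensorConj s e s' e' (x * y) =
    tensorConj s e s' e' y * tensorConj s e s' e' x := by
  induction x with
  | zero => simp
  | add x x' hx hx' => rw [add_mul, map_add, map_add, mul_add, hx, hx']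
  | tmul p q =>
    induction y with
    | zero => simp
    | add x x' hx hx' => rw [mul_add, map_add, map_add, add_mul, hx, hx']
    | tmul p' q' =>
      simp only [Algebra.TensorProduct.tmul_mul_tmul, tensorConj_tmul, symConj_mul]

theorem tensorConj_tensorConj (x) : tensorConj s e s' e' (tensorConj s e s' e' x) = x := by
  induction x with
  | zero => simp
  | add x x' hx hx' => rw [map_add, map_add, hx, hx']
  | tmul p q => simp only [tensorConj_tmul, symConj_symConj]

/-- The symmetrized elements of a product of two symbol algebras. -/
theorem exists_add_tensorConj_eq (z : ℍ[K,s,1,e] ⊗[K] ℍ[K,s',1,e']) :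
    ∃ c₀ c₁ b₀ b₁ d₀ d₁ : K, z + tensorConj s e s' e' z = algebraMap K _ c₀ +
      (⟨0, c₁, b₀, b₁⟩ : ℍ[K,s,1,e]) ⊗ₜ 1 + 1 ⊗ₜ (⟨0, c₁, d₀, d₁⟩ : ℍ[K,s',1,e']) := by
  induction z with
  | zero =>
    refine ⟨0, 0, 0, 0, 0, 0, ?_⟩
    have h1 : (⟨0, 0, 0, 0⟩ : ℍ[K,s,1,e]) = 0 := rfl
    have h2 : (⟨0, 0, 0, 0⟩ : ℍ[K,s',1,e']) = 0 := rfl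
    simp [h1, h2]
  | add x y hx hy =>
    obtain ⟨c₀, c₁, b₀, b₁, d₀, d₁, h⟩ := hx
    obtain ⟨c₀', c₁', b₀', b₁', d₀', d₁', h'⟩ := hy
    refine ⟨c₀ + c₀', c₁ + c₁', b₀ + b₀', b₁ + b₁', d₀ + d₀', d₁ + d₁', ?_⟩
    have h1 : (⟨0, c₁ + c₁', b₀ + b₀', b₁ + b₁'⟩ : ℍ[K,s,1,e]) =
      ⟨0, c₁, b₀, b₁⟩ + ⟨0, c₁', b₀', b₁'⟩ := by ext <;> simp
    have h2 : (⟨0, c₁ + c₁', d₀ + d₀', d₁ + d₁'⟩ : ℍ[K,s',1,e']) =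
      ⟨0, c₁, d₀, d₁⟩ + ⟨0, c₁', d₀', d₁'⟩ := by ext <;> simp
    rw [map_add, add_add_add_comm, h, h', h1, h2, TensorProduct.add_tmul, TensorProduct.tmul_add,
      map_add]
    abel
  | tmul p q =>
    refine ⟨q.imI * p.re + p.imI * q.re + p.imI * q.imI, p.imI * q.imI, q.imI * p.imJ,
      q.imI * p.imK, p.imI * q.imJ, p.imI * q.imK, ?_⟩
    have h1 : (⟨0, p.imI * q.imI, q.imI * p.imJ, q.imI * p.imK⟩ : ℍ[K,s,1,e]) =
      q.imI • p + (q.imI * p.re) • 1 := by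
      ext <;> simp [CharTwo.add_self_eq_zero, mul_comm]
    have h2 : (⟨0, p.imI * q.imI, p.imI * q.imJ, p.imI * q.imK⟩ : ℍ[K,s',1,e']) =
      p.imI • q + (p.imI * q.re) • 1 := by
      ext <;> simp [CharTwo.add_self_eq_zero]
    rw [tensorConj_tmul, symConj_eq, symConj_eq, h1, h2, Algebra.algebraMap_eq_smul_one,
      Algebra.algebraMap_eq_smul_one, Algebra.algebraMap_eq_smul_one,
      Algebra.TensorProduct.one_def]
    simp only [TensorProduct.add_tmul, TensorProduct.tmul_add, ← TensorProduct.smul_tmul',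
      TensorProduct.tmul_smul]
    have h2 : (2 : K) = 0 := CharTwo.two_eq_zero
    match_scalars <;> grind

theorem symmetrized_mul_self (c₀ c₁ b₀ b₁ d₀ d₁ : K) (y : ℍ[K,s,1,e] ⊗[K] ℍ[K,s',1,e'])
    (hy : y = algebraMap K _ c₀ +
      (⟨0, c₁, b₀, b₁⟩ : ℍ[K,s,1,e]) ⊗ₜ 1 + 1 ⊗ₜ (⟨0, c₁, d₀, d₁⟩ : ℍ[K,s',1,e'])) :
    y * y = algebraMap K _ c₁ * y + algebraMap K _ (c₀ ^ 2 + c₀ * c₁ + (s + s') * c₁ ^ 2 +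
      e * (b₀ ^ 2 + b₀ * b₁ + s * b₁ ^ 2) + e' * (d₀ ^ 2 + d₀ * d₁ + s' * d₁ ^ 2)) := by
  have h2 : (2 : K) = 0 := CharTwo.two_eq_zero
  set X : ℍ[K,s,1,e] := ⟨0, c₁, b₀, b₁⟩ with hX
  set Y : ℍ[K,s',1,e'] := ⟨0, c₁, d₀, d₁⟩ with hY
  have hXX : X * X = c₁ • X + (s * c₁ ^ 2 + e * (b₀ ^ 2 + b₀ * b₁ + s * b₁ ^ 2)) • 1 := by
    rw [hX]
    ext <;> simp <;> grind
  have hYY : Y * Y = c₁ • Y + (s' * c₁ ^ 2 + e' * (d₀ ^ 2 + d₀ * d₁ + s' * d₁ ^ 2)) • 1 := by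
    rw [hY]
    ext <;> simp <;> grind
  rw [hy, Algebra.algebraMap_eq_smul_one, Algebra.algebraMap_eq_smul_one,
    Algebra.algebraMap_eq_smul_one, Algebra.TensorProduct.one_def]
  simp only [mul_add, add_mul, smul_mul_assoc, mul_smul_comm, Algebra.TensorProduct.tmul_mul_tmul,
    one_mul, mul_one, hXX, hYY, TensorProduct.add_tmul, TensorProduct.tmul_add,
    ← TensorProduct.smul_tmul', TensorProduct.tmul_smul]
  clear hXX hYY
  clear_value X Y
  clear hX hY hy
  match_scalars
  · linear_combination -(c₀ * c₁ * h2)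
  all_goals grind

theorem symI_add_tensorConj_notMem (he : e ≠ 0) :
    symI s e ⊗ₜ symI s' e' + tensorConj s e s' e' (symI s e ⊗ₜ symI s' e') ∉
      (algebraMap K (ℍ[K,s,1,e] ⊗[K] ℍ[K,s',1,e'])).range := by
  rintro ⟨k, hk⟩
  have h1 := Algebra.commutes k (symJ s e ⊗ₜ[K] (1 : ℍ[K,s',1,e']))
  have := isSimpleRing_sym s he
  rw [hk, tensorConj_tmul, symConj_eq, symConj_eq] at h1
  have h3 : (symI s e).imI = 1 := rfl
  have h4 : (symI s' e').imI = 1 := rfl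
  rw [h3, h4, map_one, map_one] at h1
  simp only [TensorProduct.add_tmul, TensorProduct.tmul_add, mul_add, add_mul,
    Algebra.TensorProduct.tmul_mul_tmul, one_mul, mul_one, symJ_mul_symI] at h1
  have h5 : symJ s e ⊗ₜ[K] (1 : ℍ[K,s',1,e']) = 0 := by
    have h2 : (2 : K) = 0 := CharTwo.two_eq_zero
    rw [← sub_eq_zero] at h1
    rw [← h1, ← one_smul K (symJ s e ⊗ₜ[K] (1 : ℍ[K,s',1,e']))]
    clear hk h1
    match_scalars <;> grind
  have h6 : Function.Injective (Algebra.TensorProduct.includeLeft :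
      ℍ[K,s,1,e] →ₐ[K] ℍ[K,s,1,e] ⊗[K] ℍ[K,s',1,e']) := RingHom.injective _
  have h7 : symJ s e = 0 := h6 (by simpa using h5)
  have h8 := congrArg QuaternionAlgebra.imJ h7
  simp [symJ] at h8
end TensorConj

section Descent
variable {F K : Type} [Field F] [CharP F 2] [Field K] [CharP K 2] [Algebra F K] {a : F} {θ : K}

/-- The Albert form of a biquaternion algebra over `K` whose class descends to `F` takes a value in
`F` at a vector with trace in `F`. -/
theorem IsQuadSep.exists_albert_value (h : IsQuadSep F a θ) {x : Br F} (hx : x + x = 0)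
    {s e s' e' : K} (hres : res F K x = sym K s e + sym K s' e') (hA : ¬ AlbIso s e s' e') :
    ∃ (c n : F) (c₀ b₀ b₁ d₀ d₁ : K), (c ≠ 0 ∨ b₀ ≠ 0 ∨ b₁ ≠ 0 ∨ d₀ ≠ 0 ∨ d₁ ≠ 0) ∧
      c₀ ^ 2 + c₀ * algebraMap F K c + (s + s') * algebraMap F K c ^ 2 +
      e * (b₀ ^ 2 + b₀ * b₁ + s * b₁ ^ 2) + e' * (d₀ ^ 2 + d₀ * d₁ + s' * d₁ ^ 2) =
      algebraMap F K n := by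
  have he : e ≠ 0 := by
    rintro rfl
    exact hA ⟨0, 0, 1, 0, 0, 0, by simp, by simp⟩
  have he' : e' ≠ 0 := by
    rintro rfl
    exact hA ⟨0, 0, 0, 0, 1, 0, by simp, by simp⟩
  have := isSimpleRing_sym s he
  have := isSimpleRing_sym s' he'
  have := isCentral_sym s he
  have := isCentral_sym s' he'
  have := h.finiteDimensional
  have := noZeroDivisors_of_not_albIso hA
  let B := ℍ[K,s,1,e] ⊗[K] ℍ[K,s',1,e']
  obtain ⟨S, _, _, _, _, _, rfl⟩ := x.exists_rep
  rw [sym_eq_cls s he, sym_eq_cls s' he', ← cls_tensor] at hres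
  obtain ⟨A, _, _, _, _, _, hAS, ⟨ι⟩, hd⟩ := exists_embedding_of_res_eq hres
  have : FiniteDimensional F B := Module.Finite.trans K B
  have hι : Function.Injective ι := RingHom.injective ι.toRingHom
  have hd' : Module.finrank F A = 2 * Module.finrank F B := by
    rw [hd, ← Module.finrank_mul_finrank F K B, h.finrank_eq]
    ring
  obtain ⟨σ, hσi, hσ1, hσm, hσ⟩ := exists_antiAut (hAS.symm ▸ hx) ι
    ((tensorConj s e s' e').restrictScalars F) tensorConj_one tensorConj_mul
  have ht : (ι (algebraMap K B θ)) * ι (algebraMap K B θ) =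
      ι (algebraMap K B θ) + algebraMap F A a := by
    rw [← map_mul, ← map_mul, h.mul_self, map_add, map_add,
      ← IsScalarTower.algebraMap_apply F K B, AlgHom.commutes]
  obtain ⟨φ, hφ⟩ := h.exists_algHom _ ht
  obtain ⟨ψ, hψ⟩ := h.exists_algHom (ι (algebraMap K B θ) + 1) (by
    rw [mul_add, add_mul, ht, mul_one, one_mul, add_right_comm (ι (algebraMap K B θ)),
      add_self_eq_zero_of_module F, zero_add, add_comm])
  obtain ⟨u, hu⟩ := skolemNoether φ ψ
  have hui : (u : A) * ι (algebraMap K B θ) = ι (algebraMap K B θ) * u + u := by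
    have := hu θ
    rw [hψ, hφ] at this
    rw [← add_one_mul, this, mul_assoc, Units.inv_mul, mul_one]
  obtain ⟨z, hz, v, hv, hvz⟩ := h.exists_symmetrized_commute (γ := tensorConj s e s' e') hι hd'
    tensorConj_one tensorConj_tensorConj hσi hσm hσ hui (i := symI s e ⊗ₜ 1) (by
      rw [tensorConj_tmul, symConj_eq, symConj_eq, Algebra.TensorProduct.one_def,
        ← TensorProduct.add_tmul]
      simp [symI]) (symI_add_tensorConj_notMem he)
  obtain ⟨c₀, c₁, b₀, b₁, d₀, d₁, hy⟩ := exists_add_tensorConj_eq z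
  obtain ⟨⟨c, rfl⟩, n, hn⟩ := h.exists_coeff_of_commute hι hv hvz hz
    (symmetrized_mul_self _ _ _ _ _ _ _ hy)
  refine ⟨c, n, c₀, b₀, b₁, d₀, d₁, ?_, hn⟩
  by_contra! hcon
  obtain ⟨rfl, rfl, rfl, rfl, rfl⟩ := hcon
  refine hz ⟨c₀, ?_⟩
  have h1 : (⟨0, 0, 0, 0⟩ : ℍ[K,s,1,e]) = 0 := rfl
  have h2 : (⟨0, 0, 0, 0⟩ : ℍ[K,s',1,e']) = 0 := rfl
  rw [hy, map_zero, h1, h2]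
  simp

end Descent
end CharTwoBrauer

namespace CharTwoBrauer
open KaehlerDifferential

section Rowen
variable {F K : Type} [Field F] [CharP F 2] [Field K] [CharP K 2] [Algebra F K] {a : F} {θ : K}

theorem exists_sym_add_sym_eq_of_add_eq (t₁ f₁ t₂ f₂ : K) :
    ∃ s s', sym K t₁ f₁ + sym K t₂ f₂ = sym K s (f₁ + f₂) + sym K s' f₂ := by
  by_cases h1 : f₁ = 0
  · exact ⟨t₂, 0, by simp [h1, sym_zero_right, sym_zero_left]⟩
  refine ⟨t₁ / f₁ * (f₁ + f₂), t₁ / f₁ * f₂ + t₂, ?_⟩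
  rw [sym_add_arg, div_mul_cancel₀ _ h1, add_assoc, ← sym_add_left, ← add_assoc (sym K (_ * f₂) _),
    sym_add_self, zero_add]

/-- A biquaternion class over `K` descending to `F` has a decomposition with a slot in `F`. -/
theorem IsQuadSep.exists_hasBaseSlot (h : IsQuadSep F a θ) {x : Br F} (hx : x + x = 0)
    {s e s' e' : K} (hres : res F K x = sym K s e + sym K s' e') (hA : ¬ AlbIso s e s' e') :
    ∃ κ α β, HasBaseSlot F κ ∧ res F K x = κ + sym K α β := by
  obtain ⟨c, n, c₀, b₀, b₁, d₀, d₁, hne, hn⟩ := h.exists_albert_value hx hres hA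
  have h2 : (2 : K) = 0 := CharTwo.two_eq_zero
  rw [hres]
  by_cases hc : c = 0
  · rw [hc, map_zero] at hn
    by_cases hb : b₀ = 0 ∧ b₁ = 0
    · obtain ⟨rfl, rfl⟩ := hb
      obtain ⟨t, ht⟩ := exists_sym_eq_right s' e' c₀ d₀ d₁ (by simpa [hc] using hne)
      exact ⟨_, s, e, Or.inr ⟨t, n, rfl⟩, by rw [ht, add_comm, ← hn]; congr 2; ring⟩
    by_cases hd : d₀ = 0 ∧ d₁ = 0
    · obtain ⟨rfl, rfl⟩ := hd
      obtain ⟨t, ht⟩ := exists_sym_eq_right s e c₀ b₀ b₁ (by simpa [hc] using hne)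
      exact ⟨_, s', e', Or.inr ⟨t, n, rfl⟩, by rw [ht, ← hn]; congr 2; ring⟩
    obtain ⟨t, ht⟩ := exists_sym_eq_right s e c₀ b₀ b₁ (by tauto)
    obtain ⟨t', ht'⟩ := exists_sym_eq_right s' e' 0 d₀ d₁ (by tauto)
    obtain ⟨r, r', hr⟩ := exists_sym_add_sym_eq_of_add_eq t
      (c₀ ^ 2 + e * (b₀ ^ 2 + b₀ * b₁ + s * b₁ ^ 2)) t' (0 ^ 2 + e' * (d₀ ^ 2 + d₀ * d₁ + s' * d₁ ^ 2))
    exact ⟨_, r', _, Or.inr ⟨r, n, rfl⟩, by rw [ht, ht', hr, ← hn]; congr 2; ring⟩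
  · have hcK : algebraMap F K c ≠ 0 := by simpa using hc
    obtain ⟨f, hf⟩ := exists_sym_eq_norm_div s e c₀ (algebraMap F K c) b₀ b₁ hcK
    obtain ⟨f', hf'⟩ := exists_sym_eq_norm_div s' e' 0 (algebraMap F K c) d₀ d₁ hcK
    set ρ := (c₀ ^ 2 + c₀ * algebraMap F K c + s * algebraMap F K c ^ 2 +
      e * (b₀ ^ 2 + b₀ * b₁ + s * b₁ ^ 2)) / algebraMap F K c ^ 2
    set ρ' := (0 ^ 2 + 0 * algebraMap F K c + s' * algebraMap F K c ^ 2 +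
      e' * (d₀ ^ 2 + d₀ * d₁ + s' * d₁ ^ 2)) / algebraMap F K c ^ 2
    have hρ : ρ = algebraMap F K (n / c ^ 2) + ρ' := by
      have : ρ + ρ' = algebraMap F K (n / c ^ 2) := by
        rw [map_div₀, map_pow, ← hn, ← add_div]; congr 1; ring
      rw [← this]; grind
    obtain ⟨g, hg⟩ := exists_sym_add_sym ρ' f f'
    refine ⟨_, ρ', g, Or.inl ⟨n / c ^ 2, f, rfl⟩, ?_⟩
    rw [hf, hf', hρ, ← sym_add_left, add_assoc, hg]

theorem HasBaseSlot.exists_bmap {T : Ω[K⁄ℤ] →+ Ω[F⁄ℤ]} (hT : IsTr F θ T) (h : IsQuadSep F a θ)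
    {κ : Br K} (hκ : HasBaseSlot F κ) : ∃ ω p q, bmap K ω = κ ∧ bmap F (T ω) = sym F p q := by
  rcases hκ with ⟨r, y, rfl⟩ | ⟨s, e, rfl⟩
  · obtain ⟨ω, f, h1, h2⟩ := hT.exists_of_left_base h r y
    exact ⟨ω, r, f, h1, h2⟩
  · by_cases he : e = 0
    · exact ⟨0, 0, 0, by simp [he, sym_zero_right], by simp [sym_zero_right]⟩
    obtain ⟨p, q, rfl⟩ := h.exists_eq s
    obtain ⟨ω, h1, h2⟩ := hT.exists_base p q he
    exact ⟨ω, q, e, h1, h2⟩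

/-- If one summand of a descending biquaternion class has a slot in `F`, so does the other. -/
theorem HasBaseSlot.of_res_eq (h : IsQuadSep F a θ) {x : Br F} (hx : x + x = 0) {κ : Br K}
    (hκ : HasBaseSlot F κ) {α β : K} (hres : res F K x = κ + sym K α β) :
    HasBaseSlot F (sym K α β) := by
  rcases h.exists_translate β with ⟨e, rfl⟩ | ⟨y, c, hy, rfl⟩
  · exact Or.inr ⟨_, _, rfl⟩
  obtain ⟨T, hT⟩ := h.exists_isTr
  have h' := h.translate c
  have hT' := hT.translate c
  obtain ⟨u, v, rfl⟩ := h'.exists_eq α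
  obtain ⟨ω, p, q, h1, h2⟩ := hκ.exists_bmap hT' h'
  obtain ⟨ω', h1', h2'⟩ := hT'.exists_mul h' u v hy
  have h3 := hT'.bmap_eq_zero_of_res h' hx (κ := ω + ω') (by rw [hres, map_add, h1, h1'])
  rw [map_add, map_add, h2, h2', add_eq_zero_iff_eq_neg', sym_neg] at h3
  exact AlbIso.hasBaseSlot h' hy (.of_sym_add_sym h3)

theorem IsQuadSep.symLE_add_two (h : IsQuadSep F a θ) {x y : Br F} (hx : x + x = 0) {m : ℕ}
    (hy : SymLE y m) {α β : K} (hres : res F K x = res F K y + sym K α β) : SymLE x (m + 2) := by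
  have h1 : res F K (x - y) = sym K α β := by rw [map_sub, hres, add_sub_cancel_left]
  have h2 : (x - y) + (x - y) = 0 := by rw [sub_add_sub_comm, hx, hy.add_self, sub_zero]
  have := hy.add (h.symLE_two h2 h1)
  rwa [add_sub_cancel] at this

theorem IsQuadSep.symLE_four_of_left (h : IsQuadSep F a θ) {x : Br F} (hx : x + x = 0) {r r' : F}
    {y y' : K} (hres : res F K x = sym K (algebraMap F K r) y + sym K (algebraMap F K r') y') :
    SymLE x 4 := by
  rcases h.exists_translate y with ⟨e, rfl⟩ | ⟨m, c, hm, rfl⟩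
  · exact (h.symLE_add_two hx (.sym r e) (by rw [hres, res_sym])).mono (by norm_num)
  rcases h.exists_translate y' with ⟨e, rfl⟩ | ⟨m', c', hm', rfl⟩
  · exact (h.symLE_add_two hx (.sym r' e) (by rw [hres, res_sym, add_comm])).mono (by norm_num)
  have h2 : (2 : K) = 0 := CharTwo.two_eq_zero
  have hmK : algebraMap F K m ≠ 0 := by simpa using hm
  have hmK' : algebraMap F K m' ≠ 0 := by simpa using hm'
  have hc := (h.translate c).theta_ne_zero
  have hc' := (h.translate c').theta_ne_zero
  by_cases hcc : c + c' = 0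
  · rw [CharTwo.add_eq_zero] at hcc
    subst hcc
    refine h.symLE_add_two hx ((SymLE.sym r m).add (.sym r' m')) (α := algebraMap F K (r + r'))
      (β := θ + algebraMap F K c) ?_
    rw [hres, map_add, res_sym, res_sym, map_add, ← sym_add_left, ← sym_mul_right _ hmK hc,
      ← sym_mul_right _ hmK' hc, add_add_add_comm]
  · have hd : algebraMap F K (c + c') ≠ 0 := (map_ne_zero _).2 hcc
    set d := algebraMap F K (c + c') with hdd
    obtain ⟨t, f, hA⟩ : ∃ t f, sym K (algebraMap F K r) ((θ + algebraMap F K c) / d) +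
        sym K (algebraMap F K r') ((θ + algebraMap F K c') / d) = sym K t f := by
      apply AlbIso.exists_sym
      refine ⟨1, 0, 1, 0, 1, 0, by simp, ?_⟩
      have h3 : (θ + algebraMap F K c) / d + (θ + algebraMap F K c') / d = 1 := by
        rw [← add_div, div_eq_one_iff_eq hd, hdd, map_add]
        linear_combination θ * h2
      linear_combination h3 + h2
    refine h.symLE_add_two hx ((SymLE.sym r (m * (c + c'))).add (.sym r' (m' * (c + c'))))
      (α := t) (β := f) ?_
    rw [hres, map_add, res_sym, res_sym, ← hA, map_mul, map_mul, ← hdd, add_add_add_comm,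
      sym_mul_right _ (mul_ne_zero hmK hd) (div_ne_zero hc hd),
      sym_mul_right _ (mul_ne_zero hmK' hd) (div_ne_zero hc' hd)]
    congr 2 <;> field_simp

theorem IsQuadSep.symLE_four_of_left_right (h : IsQuadSep F a θ) {x : Br F} (hx : x + x = 0)
    {r e : F} {y s : K}
    (hres : res F K x = sym K (algebraMap F K r) y + sym K s (algebraMap F K e)) :
    SymLE x 4 := by
  by_cases he : e = 0
  · exact (h.symLE_two hx (α := algebraMap F K r) (β := y) (by
      rw [hres, he, map_zero, sym_zero_right, add_zero])).mono (by norm_num)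
  rcases h.exists_translate y with ⟨f, rfl⟩ | ⟨m, c, hm, hy⟩
  · exact (h.symLE_add_two hx (.sym r f) (by rw [hres, res_sym])).mono (by norm_num)
  have hmK : algebraMap F K m ≠ 0 := by simpa using hm
  have hy0 : y ≠ 0 := hy ▸ mul_ne_zero hmK (h.translate c).theta_ne_zero
  obtain ⟨p, q, rfl⟩ : ∃ p q, s = algebraMap F K p + algebraMap F K q * y := by
    obtain ⟨p, q, rfl⟩ := (h.translate c).exists_eq s
    refine ⟨p, q / m, ?_⟩
    rw [hy, map_div₀]
    field_simp
  by_cases hq : q = 0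
  · exact (h.symLE_add_two hx (.sym p e) (by
      rw [hres, res_sym, hq, map_zero, zero_mul, add_zero, add_comm])).mono (by norm_num)
  have heK : algebraMap F K e ≠ 0 := by simpa using he
  have hqK : algebraMap F K q ≠ 0 := by simpa using hq
  refine h.symLE_add_two hx ((SymLE.sym p e).add (.sym r (e * q)))
    (α := algebraMap F K r + algebraMap F K q * y)
    (β := algebraMap F K e * (algebraMap F K q * y)) ?_
  rw [hres, map_add, res_sym, res_sym, ← sym_add_left _ _ (algebraMap F K e),
    ← sym_add_left _ _ (algebraMap F K e * _),
    ← sym_mul_right (algebraMap F K q * y) heK (mul_ne_zero hqK hy0), sym_self, add_zero,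
    ← mul_assoc (algebraMap F K e), ← map_mul, ← sym_mul_right _ (by simp [he, hq]) hy0]
  have h1 := sym_add_self (algebraMap F K r) (algebraMap F K (e * q))
  generalize sym K (algebraMap F K r) (algebraMap F K (e * q)) = z at *
  generalize sym K (algebraMap F K r) y = w at *
  rw [add_assoc, ← add_assoc z, ← add_assoc z, h1, zero_add]
  abel

theorem IsQuadSep.symLE_four_of_right (h : IsQuadSep F a θ) {x : Br F} (hx : x + x = 0)
    {e e' : F} {s s' : K}
    (hres : res F K x = sym K s (algebraMap F K e) + sym K s' (algebraMap F K e')) :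
    SymLE x 4 := by
  obtain ⟨r, hr⟩ := exists_sym_eq_bmap s (algebraMap F K e)
  obtain ⟨r', hr'⟩ := exists_sym_eq_bmap s' (algebraMap F K e')
  refine h.symLE_of_res_eq hx ![r, r'] ![e, e'] 0 ?_
  rw [hres, hr, hr', ← map_add]
  simp

/-- A 2-torsion class becoming a sum of two symbols over a separable quadratic extension is a sum
of four symbols. -/
theorem IsQuadSep.symLE_four (h : IsQuadSep F a θ) {x : Br F} (hx : x + x = 0)
    {s e s' e' : K} (hres : res F K x = sym K s e + sym K s' e') : SymLE x 4 := by
  by_cases hA : AlbIso s e s' e'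
  · obtain ⟨t, f, hf⟩ := hA.exists_sym
    exact (h.symLE_two hx (hres.trans hf)).mono (by norm_num)
  obtain ⟨κ, α, β, hκ, hres'⟩ := h.exists_hasBaseSlot hx hres hA
  have hQ := HasBaseSlot.of_res_eq h hx hκ hres'
  rcases hκ with ⟨r, y, rfl⟩ | ⟨s, e, rfl⟩ <;> rcases hQ with ⟨r', y', hQ⟩ | ⟨s', e', hQ⟩ <;>
    rw [hQ] at hres'
  · exact h.symLE_four_of_left hx hres'
  · exact h.symLE_four_of_left_right hx hres'
  · exact h.symLE_four_of_left_right hx (by rw [hres', add_comm])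
  · exact h.symLE_four_of_right hx hres'

end Rowen
end CharTwoBrauer

namespace CharTwoBrauer
open Quaternion

theorem exists_isQuadSep {F K : Type} [Field F] [CharP F 2] [Field K] [Algebra F K]
    [Algebra.IsSeparable F K] (h : Module.finrank F K = 2) :
    ∃ (a : F) (θ : K), IsQuadSep F a θ := by
  have : FiniteDimensional F K := .of_finrank_eq_succ h
  obtain ⟨θ, hθ⟩ := Algebra.trace_surjective F K 1
  let b := Module.finBasisOfFinrankEq F K h
  let M := Algebra.leftMulMatrix b θ
  have htr : M 0 0 + M 1 1 = 1 := by
    rw [← Matrix.trace_fin_two, ← Algebra.trace_eq_matrix_trace, hθ]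
  have h2 : (2 : F) = 0 := CharTwo.two_eq_zero
  refine ⟨M 0 0 * M 1 1 + M 0 1 * M 1 0, θ, ?_, h, ?_⟩
  · apply Algebra.leftMulMatrix_injective b
    rw [map_mul, map_add, AlgHom.commutes]
    change M * M = M + _
    ext i j
    fin_cases i <;> fin_cases j <;>
      simp [Matrix.mul_apply, Fin.sum_univ_two, Matrix.algebraMap_matrix_apply] <;> grind
  · rintro ⟨c, rfl⟩
    rw [Algebra.trace_algebraMap, h, two_smul, CharTwo.add_self_eq_zero] at hθ
    exact zero_ne_one hθ

/-- An intermediate field is isomorphic to itself viewed as an extension of a smaller one. -/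
def equivExtendScalars {F L : Type} [Field F] [Field L] [Algebra F L]
    {E E' : IntermediateField F L} (h : E ≤ E') : E' ≃ₐ[F] IntermediateField.extendScalars h where
  toFun x := ⟨x.1, x.2⟩
  invFun x := ⟨x.1, x.2⟩
  map_mul' _ _ := rfl
  map_add' _ _ := rfl
  commutes' _ := rfl

section Tower
variable {F K : Type} [Field F] [CharP F 2] [Field K] [CharP K 2] [Algebra F K] {a : F} {θ : K}

theorem SymLE.baseChange {x : Br F} {m : ℕ} (h : SymLE x m) : SymLE (res F K x) m := by
  induction h with
  | zero m => simpa using SymLE.zero m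
  | add_sym s e h ih =>
    rw [map_add, res_sym]
    exact .add_sym _ _ ih

theorem SymLE.res_of_algHom {E E' : Type} [Field E] [Field E'] [Algebra F E] [Algebra F E']
    [CharP E 2] [CharP E' 2] (f : E →ₐ[F] E') {x : Br F} {m : ℕ} (h : SymLE (res F E x) m) :
    SymLE (res F E' x) m := by
  algebraize [f.toRingHom]
  have : IsScalarTower F E E' := .of_algebraMap_eq fun r => (f.commutes r).symm
  rw [← res_res F E E']
  exact h.baseChange

theorem SymLE.exists_sum {x : Br F} {m : ℕ} (h : SymLE x m) :
    ∃ k ≤ m, ∃ s e : Fin k → F, (∀ i, e i ≠ 0) ∧ x = ∑ i, CharTwoBrauer.sym F (s i) (e i) := by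
  induction h with
  | zero m => exact ⟨0, by omega, 0, 0, fun i => i.elim0, by simp⟩
  | @add_sym x m s e h ih =>
    obtain ⟨k, hk, s', e', he', rfl⟩ := ih
    by_cases he : e = 0
    · exact ⟨k, by omega, s', e', he', by rw [he, sym_zero_right, add_zero]⟩
    · refine ⟨k + 1, by omega, Fin.cons s s', Fin.cons e e', Fin.cases he he', ?_⟩
      rw [Fin.sum_univ_succ, add_comm]
      simp

theorem SymLE.eq_zero {x : Br F} (h : SymLE x 0) : x = 0 := by
  cases h
  rfl

theorem SymLE.exists_eq_add_sym {x : Br F} {m : ℕ} (h : SymLE x (m + 1)) :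
    ∃ y s e, SymLE y m ∧ x = y + CharTwoBrauer.sym F s e := by
  cases h with
  | zero => exact ⟨0, 0, 0, .zero m, by simp [sym_zero_right]⟩
  | add_sym s e h => exact ⟨_, s, e, h, rfl⟩

/-- The bound on the number of symbols for classes split by a tower of `n` separable quadratic
extensions. -/
def symBound : ℕ → ℕ
  | 0 => 0
  | 1 => 1
  | 2 => 2
  | 3 => 4
  | n + 4 => 2 * symBound (n + 3) + 1

theorem symBound_add_three (n : ℕ) : symBound (n + 3) = 5 * 2 ^ n - 1 := by
  induction n with
  | zero => rfl
  | succ n ih =>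
    have := Nat.one_le_two_pow (n := n)
    rw [symBound, ih, pow_succ]
    omega

theorem IsQuadSep.symLE_symBound_succ (h : IsQuadSep F a θ) {x : Br F} (hx : x + x = 0) {n : ℕ}
    (hn : SymLE (res F K x) (symBound n)) : SymLE x (symBound (n + 1)) := by
  match n with
  | 0 => exact h.symLE_two_mul_add_one hx hn
  | 1 =>
    obtain ⟨y, s, e, hy, hxy⟩ := hn.exists_eq_add_sym
    rw [hy.eq_zero, zero_add] at hxy
    exact h.symLE_two hx hxy
  | 2 =>
    obtain ⟨y, s, e, hy, hxy⟩ := hn.exists_eq_add_sym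
    obtain ⟨z, s', e', hz, rfl⟩ := hy.exists_eq_add_sym
    rw [hz.eq_zero, zero_add] at hxy
    exact h.symLE_four hx hxy
  | n + 3 => exact h.symLE_two_mul_add_one hx hn

theorem symLE_res_of_le {L : Type} [Field L] [Algebra F L]
    {E E' : IntermediateField F L} (h : E ≤ E')
    [Algebra.IsSeparable E (IntermediateField.extendScalars h)]
    (hd : Module.finrank E (IntermediateField.extendScalars h) = 2)
    [CharP E 2] [CharP E' 2] {x : Br F} (hx : x + x = 0) {n : ℕ}
    (hn : SymLE (res F E' x) (symBound n)) : SymLE (res F E x) (symBound (n + 1)) := by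
  have : CharP (IntermediateField.extendScalars h) 2 :=
    charP_of_injective_algebraMap (algebraMap E _).injective 2
  obtain ⟨a, θ, hq⟩ := exists_isQuadSep hd
  refine hq.symLE_symBound_succ (by rw [← map_add, hx, map_zero]) ?_
  rw [res_res]
  exact hn.res_of_algHom (equivExtendScalars h).toAlgHom

/-- A class split by a tower of `n` separable quadratic extensions is a sum of `symBound n`
symbols. -/
theorem symLE_symBound_of_tower {L : Type} [Field L] [Algebra F L] {n : ℕ}
    (T : Fin (n + 1) → IntermediateField F L) (h0 : T 0 = ⊥) (hlast : T (Fin.last n) = ⊤)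
    (hT : ∀ i : Fin n, ∃ h : T i.castSucc ≤ T i.succ,
      Algebra.IsSeparable (T i.castSucc) (IntermediateField.extendScalars h) ∧
      Module.finrank (T i.castSucc) (IntermediateField.extendScalars h) = 2)
    {x : Br F} (hx : x + x = 0) (hL : res F L x = 0) : SymLE x (symBound n) := by
  have hc : ∀ i, CharP (T i) 2 := fun i =>
    charP_of_injective_algebraMap (algebraMap F (T i)).injective 2
  have : CharP L 2 := charP_of_injective_algebraMap (algebraMap F L).injective 2
  have key : ∀ i : Fin (n + 1), SymLE (res F (T i) x) (symBound (n - i)) := by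
    intro i
    induction i using Fin.reverseInduction with
    | last =>
      have h1 : SymLE (res F L x) 0 := hL ▸ .zero 0
      have h2 := h1.res_of_algHom
        (IntermediateField.topEquiv.symm.trans (IntermediateField.equivOfEq hlast).symm).toAlgHom
      simpa using h2.mono (Nat.zero_le _)
    | cast i ih =>
      obtain ⟨h, hs, hd⟩ := hT i
      have := symLE_res_of_le h hd hx ih
      convert this using 2
      simp
      omega
  have := (key 0).res_of_algHom
    (((IntermediateField.equivOfEq h0).trans (IntermediateField.botEquiv F L)) : T 0 →ₐ[F] F)
  simpa [res_self] using this

theorem finrank_eq_two_pow_of_tower {F L : Type} [Field F] [Field L] [Algebra F L] {n : ℕ}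
    (T : Fin (n + 1) → IntermediateField F L) (h0 : T 0 = ⊥) (hlast : T (Fin.last n) = ⊤)
    (hT : ∀ i : Fin n, ∃ h : T i.castSucc ≤ T i.succ,
      Module.finrank (T i.castSucc) (IntermediateField.extendScalars h) = 2) :
    Module.finrank F L = 2 ^ n := by
  have key : ∀ i : Fin (n + 1), Module.finrank F (T i) = 2 ^ (i : ℕ) := by
    intro i
    induction i using Fin.induction with
    | zero => simp [h0]
    | succ i ih =>
      obtain ⟨h, hd⟩ := hT i
      have h1 := Module.finrank_mul_finrank F (T i.castSucc) (IntermediateField.extendScalars h)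
      rw [ih, hd] at h1
      rw [(equivExtendScalars h).toLinearEquiv.finrank_eq, ← h1, Fin.val_succ, pow_succ,
        Fin.val_castSucc]
  have := key (Fin.last n)
  rw [hlast] at this
  simpa using this

end Tower

section PiTensor
variable (F : Type) [Field F]

/-- The algebra homomorphism splitting off the first factor of a tensor product. -/
noncomputable def piTensorSucc {k : ℕ} (D : Fin (k + 1) → Type) [∀ i, Ring (D i)]
    [∀ i, Algebra F (D i)] :
    D 0 ⊗[F] (⨂[F] i : Fin k, D i.succ) →ₐ[F] ⨂[F] i, D i :=
  Algebra.TensorProduct.lift (PiTensorProduct.singleAlgHom 0)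
    (PiTensorProduct.liftAlgHom ((PiTensorProduct.tprod F).curryLeft 1)
      (by
        rw [MultilinearMap.curryLeft_apply, PiTensorProduct.one_def]
        congr 1
        ext i
        refine Fin.cases ?_ (fun _ => ?_) i <;> simp)
      (fun x y => by
        rw [MultilinearMap.curryLeft_apply, MultilinearMap.curryLeft_apply,
          MultilinearMap.curryLeft_apply, PiTensorProduct.tprod_mul_tprod]
        congr 1
        ext i
        refine Fin.cases ?_ (fun _ => ?_) i <;> simp))
    (fun x y => by
      induction y using PiTensorProduct.induction_on with
      | smul_tprod r y =>
        rw [map_smul]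
        refine Commute.smul_right ?_ r
        rw [PiTensorProduct.singleAlgHom_apply, PiTensorProduct.liftAlgHom_apply,
          PiTensorProduct.lift.tprod, MultilinearMap.curryLeft_apply]
        refine Commute.tprod ?_
        rw [commute_iff_eq]
        ext i
        refine Fin.cases ?_ (fun _ => ?_) i <;> simp
      | add y z hy hz =>
        rw [map_add]
        exact hy.add_right hz)

theorem finrank_piTensor {k : ℕ} (D : Fin k → Type) [∀ i, Ring (D i)]
    [∀ i, Algebra F (D i)] [∀ i, FiniteDimensional F (D i)] :
    Module.finrank F (⨂[F] i, D i) = ∏ i, Module.finrank F (D i) := by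
  rw [Module.finrank_eq_card_basis
    (Basis.piTensorProduct fun i => Module.finBasis F (D i))]
  simp

theorem exists_cls_piTensor {k : ℕ} (D : Fin k → Type) [∀ i, Ring (D i)]
    [∀ i, Algebra F (D i)] [∀ i, FiniteDimensional F (D i)] [∀ i, Algebra.IsCentral F (D i)]
    [∀ i, IsSimpleRing (D i)] :
    ∃ (_ : Algebra.IsCentral F (⨂[F] i, D i)) (_ : IsSimpleRing (⨂[F] i, D i)),
      cls F (⨂[F] i, D i) = ∑ i, cls F (D i) := by
  induction k with
  | zero =>
    have hfr : Module.finrank F F = Module.finrank F (⨂[F] i, D i) := by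
      rw [finrank_piTensor]
      simp
    have : Nontrivial (⨂[F] i, D i) := Module.nontrivial_of_finrank_pos (R := F) (by
      rw [← hfr]
      simp)
    let e := algEquivOfFinrank (Algebra.ofId F (⨂[F] i, D i)) hfr
    have h1 : Algebra.IsCentral F (⨂[F] i, D i) := .of_algEquiv F F _ e
    have h2 : IsSimpleRing (⨂[F] i, D i) := .of_ringEquiv e.toRingEquiv inferInstance
    refine ⟨h1, h2, ?_⟩
    rw [← cls_congr e, cls_self]
    simp
  | succ k ih =>
    obtain ⟨_, _, h⟩ := ih fun i => D i.succ
    have hfr : Module.finrank F (D 0 ⊗[F] (⨂[F] i : Fin k, D i.succ)) =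
        Module.finrank F (⨂[F] i, D i) := by
      rw [Module.finrank_tensorProduct, finrank_piTensor, finrank_piTensor, Fin.prod_univ_succ]
    have : Nontrivial (⨂[F] i, D i) := Module.nontrivial_of_finrank_pos (R := F) (by
      rw [← hfr]
      exact Module.finrank_pos)
    let e := algEquivOfFinrank (piTensorSucc F D) hfr
    have h1 : Algebra.IsCentral F (⨂[F] i, D i) := .of_algEquiv F _ _ e
    have h2 : IsSimpleRing (⨂[F] i, D i) := .of_ringEquiv e.toRingEquiv inferInstance
    refine ⟨h1, h2, ?_⟩
    rw [← cls_congr e, cls_tensor, h, Fin.sum_univ_succ]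

end PiTensor

theorem adjoin_symI_symJ {F : Type} [Field F] (s e : F) :
    Algebra.adjoin F {symI s e, symJ s e} = ⊤ := by
  rw [eq_top_iff]
  intro q _
  have hI : symI s e ∈ Algebra.adjoin F {symI s e, symJ s e} :=
    Algebra.subset_adjoin (by simp)
  have hJ : symJ s e ∈ Algebra.adjoin F {symI s e, symJ s e} :=
    Algebra.subset_adjoin (by simp)
  have hq : q = algebraMap F _ q.re + q.imI • symI s e + q.imJ • symJ s e +
      q.imK • (symI s e * symJ s e) := by
    ext <;> simp [symI, symJ, QuaternionAlgebra.algebraMap_eq]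
  rw [hq]
  exact add_mem (add_mem (add_mem (Subalgebra.algebraMap_mem _ _) (Subalgebra.smul_mem _ hI _))
    (Subalgebra.smul_mem _ hJ _)) (Subalgebra.smul_mem _ (mul_mem hI hJ) _)

end CharTwoBrauer

open CharTwoBrauer Quaternion in
theorem isCyclicPAlg_quaternion {F : Type} [Field F] [CharP F 2] (s : F) {e : F} (he : e ≠ 0) :
    IsCyclicPAlg 2 F ℍ[F,s,1,e] := by
  refine ⟨s, e, he, by rw [QuaternionAlgebra.finrank_eq_four]; norm_num, symI s e, symJ s e,
    ?_, ?_, ?_, adjoin_symI_symJ s e⟩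
  · rw [pow_two, symI_mul_self, add_sub_cancel_left]
  · rw [pow_two, symJ_mul_self]
  · rw [symJ_mul_symI, sub_mul, one_mul, sub_eq_add_neg,
      neg_eq_of_add_eq_zero_left (add_self_eq_zero_of_module F (symJ s e))]

open CharTwoBrauer Quaternion in
theorem symbolLengthLE_of_symLE {F A : Type} [Field F] [CharP F 2] [Ring A] [Algebra F A]
    [Algebra.IsCentral F A] [IsSimpleRing A] [FiniteDimensional F A] {m : ℕ}
    (h : SymLE (cls F A) m) : SymbolLengthLE 2 F A m := by
  obtain ⟨k, hk, s, e, he, hsum⟩ := h.exists_sum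
  have : ∀ i, Algebra.IsCentral F ℍ[F,s i,1,e i] := fun i => isCentral_sym (s i) (he i)
  have : ∀ i, IsSimpleRing ℍ[F,s i,1,e i] := fun i => isSimpleRing_sym (s i) (he i)
  obtain ⟨_, _, hD⟩ := exists_cls_piTensor F fun i : Fin k => ℍ[F,s i,1,e i]
  simp only [fun i => sym_eq_cls (s i) (he i)] at hsum
  obtain ⟨n, m, hn, hm, hnm⟩ := (cls_eq_iff F A _).1 (hsum.trans hD.symm)
  exact ⟨k, hk, fun i => ℍ[F,s i,1,e i], inferInstance, inferInstance,
    fun i => isCyclicPAlg_quaternion (s i) (he i), n, m, hn.bot_lt, hm.bot_lt, hnm⟩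

open CharTwoBrauer in
theorem cls_add_self_of_hasExponent {F A : Type} [Field F] [Ring A] [Algebra F A]
    [Algebra.IsCentral F A] [IsSimpleRing A] [FiniteDimensional F A]
    (h : HasExponent F A 2) : cls F A + cls F A = 0 := by
  obtain ⟨_, _, hD⟩ := exists_cls_piTensor F fun _ : Fin 2 => A
  obtain ⟨n, hn, hA⟩ := h.2.1
  rw [← Fin.sum_univ_two fun _ => cls F A, ← hD]
  exact cls_eq_zero_iff.2 ⟨n, hn.ne', hA⟩

/-- If `A` is central simple of exponent `2` over `F` of characteristic `2`,
`n ≥ 3`, and `A` splits over a `2`-extension of `F` of degree `2 ^ n`, then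
`λ₂(A) ≤ 5 * 2 ^ (n - 3) - 1`. -/
theorem statement14 (F : Type) [Field F] [CharP F 2]
    (A : Type) [Ring A] [Algebra F A] (hA : IsCSA F A) (hexp : HasExponent F A 2)
    (n : ℕ) (hn : 3 ≤ n)
    (hsplit : ∃ (L : Type) (_ : Field L) (_ : Algebra F L), IsPExtension 2 F L ∧
      Module.finrank F L = 2 ^ n ∧ IsSplitAlg L (L ⊗[F] A)) :
    SymbolLengthLE 2 F A (5 * 2 ^ (n - 3) - 1) := by
  obtain ⟨_, _, _⟩ := hA
  obtain ⟨L, _, _, ⟨k, T, h0, hlast, hT⟩, hd, d, hd0, hsp⟩ := hsplit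
  have hk : k = n := by
    refine Nat.pow_right_injective le_rfl (?_ : 2 ^ k = 2 ^ n)
    rw [← hd, CharTwoBrauer.finrank_eq_two_pow_of_tower T h0 hlast fun i => ?_]
    obtain ⟨h, -, -, hdeg⟩ := hT i
    exact ⟨h, hdeg⟩
  subst hk
  obtain ⟨m, rfl⟩ := Nat.exists_eq_add_of_le' hn
  rw [Nat.add_sub_cancel, ← CharTwoBrauer.symBound_add_three]
  refine symbolLengthLE_of_symLE (CharTwoBrauer.symLE_symBound_of_tower T h0 hlast (fun i => ?_)
    (cls_add_self_of_hasExponent hexp) ?_)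
  · obtain ⟨h, _, -, hdeg⟩ := hT i
    exact ⟨h, inferInstance, hdeg⟩
  · rw [CharTwoBrauer.res_cls]
    exact CharTwoBrauer.cls_eq_zero_iff.2 ⟨d, hd0.ne', hsp⟩
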